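/- There exist absolute constants C₁, C₂ > 0 such that the following holds. Let 0 < θ < 10^{−12}, let q be a positive integer, and let q₁, q₂ be divisors of q with gcd(q₁, q₂) = 1, gcd(q₁, q/q₁) = 1, gcd(q₂, q/q₂) = 1, and such that every prime power p^{n} exactly dividing q₂ has n > 1/θ. Suppose A ⊆ SL₂(ℤ/qℤ) satisfies |π_{q₁}(A)| > q₁^{3−θ} and |π_{q₂}(A)| > q₂^{3−θ}. Then there exists a divisor q₃ of q₂ with gcd(q₃, q₂/q₃) = 1 and q₃ > q₂^{1/40000}, and a positive integer k ≤ C₁·(log(1/θ))², such that |π_{q₁q₃}(A^{k})| > (q₁q₃)^{3 − C₂·θ^{1/2}}, where A^{k} is the k-fold product set of A. -/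

import Mathlib

open scoped Pointwise Classical

namespace Gluing

open Finset Matrix

/-- Reduction of `SL₂(ℤ/n)` modulo a divisor `m` of `n`. -/
noncomputable abbrev red {m n : ℕ} (h : m ∣ n) :
    SpecialLinearGroup (Fin 2) (ZMod n) →* SpecialLinearGroup (Fin 2) (ZMod m) :=
  SpecialLinearGroup.map (ZMod.castHom h (ZMod m))

lemma card_cast_fiber {m n : ℕ} [NeZero n] (h : m ∣ n) (a : ZMod m) :
    #{x : ZMod n | ZMod.castHom h (ZMod m) x = a} = n / m := by
  have : NeZero m := ⟨fun h0 => NeZero.ne n (by simpa [h0] using h)⟩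
  have hs := ZMod.castHom_surjective h
  have key : ∀ b : ZMod m, #{x : ZMod n | ZMod.castHom h (ZMod m) x = b} =
      #{x : ZMod n | ZMod.castHom h (ZMod m) x = a} := fun b =>
    AddMonoidHom.card_fiber_eq_of_mem_range (ZMod.castHom h (ZMod m)).toAddMonoidHom
      (hs b) (hs a)
  have h2 := Finset.card_eq_sum_card_fiberwise (s := (univ : Finset (ZMod n)))
    (t := (univ : Finset (ZMod m))) (f := ZMod.castHom h (ZMod m)) (by simp)
  rw [Finset.sum_congr rfl (fun b _ => key b)] at h2
  rw [sum_const, card_univ, card_univ, ZMod.card, ZMod.card, smul_eq_mul] at h2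
  exact (Nat.div_eq_of_eq_mul_right (Nat.pos_of_ne_zero (NeZero.ne m)) h2).symm

lemma SL_ext {R : Type*} [CommRing R] {g h : SpecialLinearGroup (Fin 2) R}
    (h00 : g 0 0 = h 0 0) (h01 : g 0 1 = h 0 1) (h10 : g 1 0 = h 1 0) (h11 : g 1 1 = h 1 1) :
    g = h := by
  ext i j; fin_cases i <;> fin_cases j <;> assumption

lemma SL_det {R : Type*} [CommRing R] (g : SpecialLinearGroup (Fin 2) R) :
    g 0 0 * g 1 1 - g 0 1 * g 1 0 = 1 := by
  have := g.det_coe; rwa [Matrix.det_fin_two] at this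

lemma SL_mul {R : Type*} [CommRing R] (g h : SpecialLinearGroup (Fin 2) R) (i j : Fin 2) :
    (g * h) i j = g i 0 * h 0 j + g i 1 * h 1 j := by
  simp [Matrix.mul_apply, Fin.sum_univ_two]

lemma SL_inv {R : Type*} [CommRing R] (g : SpecialLinearGroup (Fin 2) R) :
    g⁻¹ 0 0 = g 1 1 ∧ g⁻¹ 0 1 = - g 0 1 ∧ g⁻¹ 1 0 = - g 1 0 ∧ g⁻¹ 1 1 = g 0 0 := by
  simp [Matrix.adjugate_fin_two]

lemma red_apply {m n : ℕ} (h : m ∣ n) (g : SpecialLinearGroup (Fin 2) (ZMod n)) (i j : Fin 2) :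
    red h g i j = ZMod.castHom h (ZMod m) (g i j) := by
  simp [red]

/-- Two elements of `SL₂` with the same first column differ by an upper unipotent. -/
lemma SL_of_col {R : Type*} [CommRing R] {g h : SpecialLinearGroup (Fin 2) R}
    (h00 : g 0 0 = h 0 0) (h10 : g 1 0 = h 1 0) (t : R)
    (ht : g 1 1 * h 0 1 - g 0 1 * h 1 1 = t) : h 0 1 = g 0 1 + t * g 0 0 ∧
      h 1 1 = g 1 1 + t * g 1 0 := by
  have d1 := SL_det g
  have d2 := SL_det h
  rw [← h00, ← h10] at d2
  constructor
  · rw [← ht]; linear_combination -h 0 1 * d1 + g 0 1 * d2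
  · rw [← ht]; linear_combination g 1 1 * d2 - h 1 1 * d1

lemma card_red_fiber_le {m n : ℕ} [NeZero n] (h : m ∣ n)
    (a : SpecialLinearGroup (Fin 2) (ZMod m)) :
    #{g : SpecialLinearGroup (Fin 2) (ZMod n) | red h g = a} ≤ (n / m) ^ 3 := by
  set S : Finset (SpecialLinearGroup (Fin 2) (ZMod n)) := univ.filter (fun g => red h g = a)
  let f : SpecialLinearGroup (Fin 2) (ZMod n) → ZMod n × ZMod n := fun g => (g 0 0, g 1 0)
  have h1 : #(S.image f) ≤ (n / m) ^ 2 := by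
    have : S.image f ⊆ (univ.filter (fun x : ZMod n => ZMod.castHom h (ZMod m) x = a 0 0)) ×ˢ
        (univ.filter (fun x : ZMod n => ZMod.castHom h (ZMod m) x = a 1 0)) := by
      intro p hp
      obtain ⟨g, hg, rfl⟩ := mem_image.1 hp
      have hg' : red h g = a := (mem_filter.1 hg).2
      subst hg'
      refine mem_product.2 ⟨?_, ?_⟩ <;>
        exact mem_filter.2 ⟨mem_univ _, (red_apply h g _ _).symm⟩
    refine (card_le_card this).trans ?_
    rw [card_product, card_cast_fiber, card_cast_fiber, sq]
  have h2 : ∀ b ∈ S.image f, #{g ∈ S | f g = b} ≤ n / m := by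
    intro b hb
    obtain ⟨g, hg, rfl⟩ := mem_image.1 hb
    rw [← card_cast_fiber h 0]
    refine card_le_card_of_injOn (fun k => g 1 1 * k 0 1 - g 0 1 * k 1 1) ?_ ?_
    · intro k hk
      have hk := mem_filter.1 hk
      have e1 : red h g = a := (mem_filter.1 hg).2
      have e2 : red h k = a := (mem_filter.1 hk.1).2
      refine mem_filter.2 ⟨mem_univ _, ?_⟩
      have e3 : ∀ i j, ZMod.castHom h (ZMod m) (g i j) = ZMod.castHom h (ZMod m) (k i j) := by
        intro i j; rw [← red_apply h g, ← red_apply h k, e1, e2]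
      simp only [map_sub, map_mul, e3]; ring
    · intro k hk l hl hkl
      have hk := (mem_filter.1 hk).2
      have hl := (mem_filter.1 hl).2
      simp only [f, Prod.mk.injEq] at hk hl
      have ek := SL_of_col hk.1.symm hk.2.symm _ rfl
      have el := SL_of_col hl.1.symm hl.2.symm _ rfl
      simp only at hkl
      refine SL_ext (hk.1.trans hl.1.symm) ?_ (hk.2.trans hl.2.symm) ?_
      · rw [ek.1, el.1, hkl]
      · rw [ek.2, el.2, hkl]
  have h3 := card_le_mul_card_image S (n / m) h2
  calc #S ≤ (n / m) * #(S.image f) := h3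
    _ ≤ (n / m) * (n / m) ^ 2 := Nat.mul_le_mul_left _ h1
    _ = (n / m) ^ 3 := by ring

lemma card_SL_le (n : ℕ) [NeZero n] :
    Fintype.card (SpecialLinearGroup (Fin 2) (ZMod n)) ≤ n ^ 3 := by
  have h := card_red_fiber_le (one_dvd n) 1
  rw [Nat.div_one] at h
  refine le_trans (le_of_eq ?_) h
  rw [← Finset.card_univ]
  congr 1
  ext g
  simp only [mem_univ, mem_filter, true_and, true_iff]
  have : Subsingleton (ZMod 1) := inferInstance
  exact SL_ext (Subsingleton.elim _ _) (Subsingleton.elim _ _) (Subsingleton.elim _ _)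
    (Subsingleton.elim _ _)

/-- Divisibility in `ZMod n` by a divisor of `n`. -/
lemma natCast_dvd_iff {m n : ℕ} [NeZero n] (h : m ∣ n) (x : ZMod n) :
    (m : ZMod n) ∣ x ↔ ZMod.castHom h (ZMod m) x = 0 := by
  constructor
  · rintro ⟨y, rfl⟩; rw [map_mul, map_natCast, ZMod.natCast_self, zero_mul]
  · intro hx
    have : ((x.val : ℕ) : ZMod m) = 0 := by
      have := hx
      rw [← ZMod.natCast_zmod_val x, map_natCast] at this
      exact this
    rw [ZMod.natCast_eq_zero_iff] at this
    obtain ⟨c, hc⟩ := this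
    rw [← ZMod.natCast_zmod_val x, hc]
    exact ⟨c, by push_cast; rfl⟩

lemma natCast_dvd_natCast_iff {m n k : ℕ} (h : m ∣ n) :
    (m : ZMod n) ∣ (k : ZMod n) ↔ m ∣ k := by
  constructor
  · rintro ⟨y, hy⟩
    have := congrArg (ZMod.castHom h (ZMod m)) hy
    simp only [map_natCast, map_mul, CharP.cast_eq_zero, zero_mul] at this
    exact (ZMod.natCast_eq_zero_iff _ _).1 this
  · rintro ⟨y, rfl⟩; exact ⟨y, by push_cast; rfl⟩

/-- The subgroup of matrices that are scalar modulo `r`. -/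
def Cen {R : Type*} [CommRing R] (r : R) : Subgroup (SpecialLinearGroup (Fin 2) R) where
  carrier := {h | r ∣ h 0 1 ∧ r ∣ h 1 0 ∧ r ∣ h 0 0 - h 1 1}
  one_mem' := by simp
  mul_mem' := by
    rintro g h ⟨⟨a, ha⟩, ⟨b, hb⟩, ⟨c, hc⟩⟩ ⟨⟨d, hd⟩, ⟨e, he⟩, ⟨f, hf⟩⟩
    simp only [Set.mem_ofPred_eq, SL_mul]
    rw [sub_eq_iff_eq_add] at hc hf
    rw [ha, hb, hc, hd, he, hf]
    refine ⟨⟨_, (?_ : _ = r * ((r * c + g 1 1) * d + a * h 1 1))⟩,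
      ⟨_, (?_ : _ = r * (b * (r * f + h 1 1) + g 1 1 * e))⟩,
      ⟨_, (?_ : _ = r * (c * (r * f + h 1 1) + g 1 1 * f + a * (r * e) - b * (r * d)))⟩⟩ <;> ring
  inv_mem' := by
    rintro g ⟨⟨a, ha⟩, ⟨b, hb⟩, ⟨c, hc⟩⟩
    simp only [Set.mem_ofPred_eq, SL_inv]
    refine ⟨?_, ?_, ?_⟩
    · rw [ha]; exact ⟨-a, by ring⟩
    · rw [hb]; exact ⟨-b, by ring⟩
    · exact ⟨-c, by linear_combination -hc⟩

lemma mem_Cen {R : Type*} [CommRing R] {r : R} {h : SpecialLinearGroup (Fin 2) R} :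
    h ∈ Cen r ↔ r ∣ h 0 1 ∧ r ∣ h 1 0 ∧ r ∣ h 0 0 - h 1 1 := Iff.rfl

instance {R : Type*} [CommRing R] (r : R) : (Cen r).Normal where
  conj_mem := by
    rintro h ⟨⟨a, ha⟩, ⟨b, hb⟩, ⟨c, hc⟩⟩ g
    rw [mem_Cen]
    simp only [SL_mul, SL_inv]
    rw [sub_eq_iff_eq_add] at hc
    rw [ha, hb, hc]
    refine ⟨⟨_, (?_ : _ = r * (-(g 0 0 * c * g 0 1 + g 0 1 * b * g 0 1) + g 0 0 * a * g 0 0))⟩,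
      ⟨_, (?_ : _ = r * (g 1 0 * c * g 1 1 + g 1 1 * b * g 1 1 - g 1 0 * a * g 1 0))⟩,
      ⟨_, (?_ : _ = r * (g 0 0 * c * g 1 1 + g 0 1 * b * g 1 1 - g 0 0 * a * g 1 0
       - (-(g 1 0 * c * g 0 1) - g 1 1 * b * g 0 1 + g 1 0 * a * g 0 0)))⟩⟩ <;> ring

lemma Cen_mono {R : Type*} [CommRing R] {r s : R} (h : r ∣ s) : Cen s ≤ Cen r :=
  fun _ ⟨a, b, c⟩ => ⟨h.trans a, h.trans b, h.trans c⟩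

/-- The number of square roots of one modulo `m`. -/
lemma card_sq_eq_one_le (m : ℕ) [NeZero m] :
    #{s : ZMod m | s ^ 2 = 1} ≤ 2 * #m.divisors := by
  let f : ZMod m → ℕ := fun s => Nat.gcd (s.val + (m - 1)) m
  have himg : (univ.filter (fun s : ZMod m => s ^ 2 = 1)).image f ⊆ m.divisors := by
    intro d hd
    obtain ⟨s, -, rfl⟩ := mem_image.1 hd
    exact Nat.mem_divisors.2 ⟨Nat.gcd_dvd_right _ _, NeZero.ne m⟩
  have hm : 1 ≤ m := Nat.pos_of_ne_zero (NeZero.ne m)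
  refine (card_le_mul_card_image _ 2 ?_).trans (Nat.mul_le_mul_left 2 (card_le_card himg))
  intro g hg
  have hgm : g ∣ m := (Nat.mem_divisors.1 (himg hg)).1
  obtain ⟨k, hk⟩ := hgm
  have hcl : ∀ s : ZMod m, s ^ 2 = 1 → f s = g →
      (g : ZMod m) ∣ s - 1 ∧ (k : ZMod m) ∣ s + 1 := by
    intro s hs hf
    have hcast : ((s.val + (m - 1) : ℕ) : ZMod m) = s - 1 := by
      rw [Nat.cast_add, Nat.cast_sub hm]; simp [sub_eq_add_neg]
    have h1 : (g : ZMod m) ∣ s - 1 := by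
      rw [← hcast]
      obtain ⟨c, hc⟩ : g ∣ s.val + (m - 1) := hf ▸ Nat.gcd_dvd_left _ _
      exact ⟨c, by rw [hc]; push_cast; rfl⟩
    refine ⟨h1, ?_⟩
    have hb : ∃ u : ZMod m, (g : ZMod m) = (s - 1) * u := by
      have := Nat.gcd_eq_gcd_ab (s.val + (m - 1)) m
      have h2 := congrArg (Int.cast : ℤ → ZMod m) this
      push_cast at h2
      have h3 : ((Nat.gcd (s.val + (m - 1)) m : ℕ) : ZMod m) = (g : ZMod m) := by
        rw [← hf]
      rw [h3] at h2
      refine ⟨((s.val + (m - 1)).gcdA m : ZMod m), ?_⟩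
      rw [h2, ← hcast]
      push_cast
      simp
    obtain ⟨u, hu⟩ := hb
    have hz : (g : ZMod m) * (s + 1) = 0 := by
      rw [hu]; linear_combination u * hs
    have hv : ((g * (s + 1).val : ℕ) : ZMod m) = 0 := by
      push_cast; simpa using hz
    rw [ZMod.natCast_eq_zero_iff] at hv
    have hg0 : 0 < g := Nat.pos_of_ne_zero (fun h0 => by simp [h0] at hk; omega)
    have : k ∣ (s + 1).val := by
      obtain ⟨c, hc⟩ := hv
      exact Nat.dvd_of_mul_dvd_mul_left hg0 ⟨c, by rw [hc]; nth_rewrite 1 [hk]; ring⟩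
    obtain ⟨c, hc⟩ := this
    refine ⟨c, ?_⟩
    rw [← ZMod.natCast_zmod_val (s + 1), hc]; push_cast; rfl
  have hg0 : 0 < g := Nat.pos_of_ne_zero (fun h0 => by simp [h0] at hk; omega)
  have hk0 : 0 < k := Nat.pos_of_ne_zero (fun h0 => by simp [h0] at hk; omega)
  set T := {s ∈ (univ.filter (fun s : ZMod m => s ^ 2 = 1)) | f s = g} with hT
  have hTm : ∀ s ∈ T, (g : ZMod m) ∣ s - 1 ∧ (k : ZMod m) ∣ s + 1 := by
    intro s hs
    rw [hT, mem_filter, mem_filter] at hs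
    exact hcl s hs.1.2 hs.2
  rcases T.eq_empty_or_nonempty with h0 | ⟨s0, hs0⟩
  · simp [h0]
  obtain ⟨e1, e2⟩ := hTm s0 hs0
  have h2 : ∀ s ∈ T, 2 * (s - s0) = 0 := by
    intro s hs
    obtain ⟨⟨a, ha⟩, ⟨b, hb⟩⟩ := hTm s hs
    obtain ⟨a', ha'⟩ := e1
    obtain ⟨b', hb'⟩ := e2
    have hgk : (g : ZMod m) * k = 0 := by
      rw [← Nat.cast_mul, ← hk]; simp
    have p1 : (s - 1) * (s0 + 1) = 0 := by rw [ha, hb']; linear_combination a * b' * hgk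
    have p2 : (s0 - 1) * (s + 1) = 0 := by rw [ha', hb]; linear_combination a' * b * hgk
    linear_combination p1 - p2
  refine (card_le_card_of_injOn (s := T) (t := univ.filter (fun x : ZMod m => 2 • x = 0))
    (fun s => s - s0) ?_ ?_).trans ?_
  · intro s hs
    refine mem_filter.2 ⟨mem_univ _, ?_⟩
    have := h2 s hs
    simpa [nsmul_eq_mul] using this
  · intro a _ b _ hab; simpa using hab
  · exact IsAddCyclic.card_nsmul_eq_zero_le (by norm_num)

lemma card_Cen_le {m n : ℕ} [NeZero n] (h : m ∣ n) :
    #{g : SpecialLinearGroup (Fin 2) (ZMod n) | g ∈ Cen (m : ZMod n)} ≤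
      2 * #m.divisors * (n / m) ^ 3 := by
  have : NeZero m := ⟨fun h0 => NeZero.ne n (by simpa [h0] using h)⟩
  set S := univ.filter (fun g : SpecialLinearGroup (Fin 2) (ZMod n) => g ∈ Cen (m : ZMod n))
  have h1 : #(S.image (red h)) ≤ 2 * #m.divisors := by
    refine le_trans ?_ (card_sq_eq_one_le m)
    refine card_le_card_of_injOn (fun g => g 0 0) ?_ ?_
    · intro x hx
      obtain ⟨g, hg, rfl⟩ := mem_image.1 hx
      have hg := (mem_filter.1 hg).2
      refine mem_filter.2 ⟨mem_univ _, ?_⟩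
      obtain ⟨c1, c2, c3⟩ := mem_Cen.1 hg
      rw [natCast_dvd_iff h] at c1 c2 c3
      have := SL_det (red h g)
      rw [red_apply, red_apply, red_apply, red_apply, c1, c2] at this
      rw [map_sub, sub_eq_zero] at c3
      rw [← c3] at this
      show (red h g) 0 0 ^ 2 = 1
      rw [red_apply]; linear_combination this
    · intro x hx y hy hxy
      obtain ⟨g, hg, rfl⟩ := mem_image.1 hx
      obtain ⟨k, hk, rfl⟩ := mem_image.1 hy
      obtain ⟨c1, c2, c3⟩ := mem_Cen.1 (mem_filter.1 hg).2
      obtain ⟨d1, d2, d3⟩ := mem_Cen.1 (mem_filter.1 hk).2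
      rw [natCast_dvd_iff h] at c1 c2 c3 d1 d2 d3
      rw [map_sub, sub_eq_zero] at c3 d3
      simp only [red_apply] at hxy
      apply SL_ext <;> simp only [red_apply]
      · exact hxy
      · rw [c1, d1]
      · rw [c2, d2]
      · rw [← c3, ← d3, hxy]
  have h2 := card_le_mul_card_image (f := red h) S ((n / m) ^ 3) (by
    intro b _
    refine (card_le_card ?_).trans (card_red_fiber_le h b)
    intro x hx
    exact mem_filter.2 ⟨mem_univ _, (mem_filter.1 hx).2⟩)
  calc #S ≤ (n / m) ^ 3 * #(S.image (red h)) := h2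
    _ ≤ (n / m) ^ 3 * (2 * #m.divisors) := Nat.mul_le_mul_left _ h1
    _ = _ := by ring

lemma cast_eq_zero_of_mul {g k n : ℕ} [NeZero n] (h : g * k = n) {x : ZMod n}
    (hx : (g : ZMod n) * x = 0) :
    ZMod.castHom (Dvd.intro_left g h) (ZMod k) x = 0 := by
  have hg : 0 < g := Nat.pos_of_ne_zero (fun h0 => NeZero.ne n (by simp [← h, h0]))
  have hv : ((g * x.val : ℕ) : ZMod n) = 0 := by push_cast; simpa using hx
  rw [ZMod.natCast_eq_zero_iff] at hv
  have h2 : k ∣ x.val := Nat.dvd_of_mul_dvd_mul_left hg (h ▸ hv)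
  rw [← ZMod.natCast_zmod_val x, map_natCast, ZMod.natCast_eq_zero_iff]
  exact h2

/-- The content of a matrix: the largest modulus for which it is scalar. -/
structure Content {n : ℕ} (h : SpecialLinearGroup (Fin 2) (ZMod n)) (g k a b c : ℕ) : Prop where
  mul : g * k = n
  sub : h 0 0 - h 1 1 = (g : ZMod n) * a
  off : h 0 1 = (g : ZMod n) * b
  low : h 1 0 = (g : ZMod n) * c
  prim : ∃ u v w t : ℤ, u * a + v * b + w * c + t * k = 1

lemma exists_content {n : ℕ} [NeZero n] (h : SpecialLinearGroup (Fin 2) (ZMod n)) :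
    ∃ g k a b c, Content h g k a b c := by
  set A := (h 0 0 - h 1 1).val with hA
  set B := (h 0 1).val with hB
  set C := (h 1 0).val with hC
  set g := Nat.gcd (Nat.gcd (Nat.gcd A B) C) n with hg
  have hgn : g ∣ n := Nat.gcd_dvd_right _ _
  have hg0 : 0 < g := Nat.pos_of_dvd_of_pos hgn (Nat.pos_of_ne_zero (NeZero.ne n))
  obtain ⟨k, hk⟩ := hgn
  obtain ⟨a, ha⟩ : g ∣ A := (Nat.gcd_dvd_left _ _).trans ((Nat.gcd_dvd_left _ _).trans (Nat.gcd_dvd_left _ _))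
  obtain ⟨b, hb⟩ : g ∣ B := (Nat.gcd_dvd_left _ _).trans ((Nat.gcd_dvd_left _ _).trans (Nat.gcd_dvd_right _ _))
  obtain ⟨c, hc⟩ : g ∣ C := (Nat.gcd_dvd_left _ _).trans (Nat.gcd_dvd_right _ _)
  refine ⟨g, k, a, b, c, hk.symm, ?_, ?_, ?_, ?_⟩
  · rw [← ZMod.natCast_zmod_val (h 0 0 - h 1 1), ← hA, ha]; push_cast; rfl
  · rw [← ZMod.natCast_zmod_val (h 0 1), ← hB, hb]; push_cast; rfl
  · rw [← ZMod.natCast_zmod_val (h 1 0), ← hC, hc]; push_cast; rfl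
  · have e1 := Nat.gcd_eq_gcd_ab A B
    have e2 := Nat.gcd_eq_gcd_ab (Nat.gcd A B) C
    have e3 := Nat.gcd_eq_gcd_ab (Nat.gcd (Nat.gcd A B) C) n
    rw [← hg, e2, e1] at e3
    set x1 := Nat.gcdA A B
    set y1 := Nat.gcdB A B
    set x2 := Nat.gcdA (Nat.gcd A B) C
    set y2 := Nat.gcdB (Nat.gcd A B) C
    set x3 := Nat.gcdA (Nat.gcd (Nat.gcd A B) C) n
    set y3 := Nat.gcdB (Nat.gcd (Nat.gcd A B) C) n
    refine ⟨x1 * x2 * x3, y1 * x2 * x3, y2 * x3, y3, ?_⟩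
    have hgz : (g : ℤ) ≠ 0 := by exact_mod_cast hg0.ne'
    apply mul_left_cancel₀ hgz
    have ha' : (A : ℤ) = g * a := by exact_mod_cast ha
    have hb' : (B : ℤ) = g * b := by exact_mod_cast hb
    have hc' : (C : ℤ) = g * c := by exact_mod_cast hc
    have hk' : (n : ℤ) = g * k := by exact_mod_cast hk
    rw [ha', hb', hc', hk'] at e3
    linear_combination -e3

lemma Content.mem_Cen_iff {n : ℕ} {h : SpecialLinearGroup (Fin 2) (ZMod n)} {g k a b c m : ℕ}
    (H : Content h g k a b c) (hm : m ∣ n) : h ∈ Cen (m : ZMod n) ↔ m ∣ g := by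
  rw [mem_Cen, H.sub, H.off, H.low]
  simp only [← Nat.cast_mul, natCast_dvd_natCast_iff hm]
  constructor
  · rintro ⟨h1, h2, h3⟩
    obtain ⟨u, v, w, t, ht⟩ := H.prim
    have h4 : m ∣ g * k := H.mul ▸ hm
    zify at h1 h2 h3 h4 ⊢
    have : (g : ℤ) = u * (g * a) + v * (g * b) + w * (g * c) + t * (g * k) := by
      linear_combination -(g : ℤ) * ht
    rw [this]
    exact ((h3.mul_left _).add (h1.mul_left _)).add (h2.mul_left _) |>.add (h4.mul_left _)
  · intro h; exact ⟨h.mul_right _, h.mul_right _, h.mul_right _⟩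

lemma card_centralizer_le {n : ℕ} [NeZero n] {h : SpecialLinearGroup (Fin 2) (ZMod n)}
    {g k a b c : ℕ} (H : Content h g k a b c) :
    #{M : SpecialLinearGroup (Fin 2) (ZMod n) | M * h = h * M} ≤ n ^ 2 * g := by
  have hk : k ∣ n := Dvd.intro_left g H.mul
  have : NeZero k := ⟨fun h0 => NeZero.ne n (by simpa [h0] using hk)⟩
  set S := univ.filter (fun M : SpecialLinearGroup (Fin 2) (ZMod n) => M * h = h * M) with hS
  obtain ⟨u, v, w, t, ht⟩ := H.prim
  have ht' : (u * a + v * b + w * c : ZMod k) = 1 := by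
    have := congrArg (Int.cast : ℤ → ZMod k) ht
    push_cast at this
    simpa using this
  have key : ∀ M ∈ S, (red hk M 0 0 - red hk M 1 1) * b = a * red hk M 0 1 ∧
      (red hk M 0 0 - red hk M 1 1) * c = a * red hk M 1 0 ∧
      red hk M 0 1 * c = b * red hk M 1 0 := by
    intro M hM
    have hM := (mem_filter.1 hM).2
    have e00 := congrArg (fun X : SpecialLinearGroup (Fin 2) (ZMod n) => X 0 0) hM
    have e01 := congrArg (fun X : SpecialLinearGroup (Fin 2) (ZMod n) => X 0 1) hM
    have e10 := congrArg (fun X : SpecialLinearGroup (Fin 2) (ZMod n) => X 1 0) hM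
    simp only [SL_mul] at e00 e01 e10
    have hs := H.sub
    have ho := H.off
    have hl := H.low
    have z1 : (g : ZMod n) * ((M 0 0 - M 1 1) * b - a * M 0 1) = 0 := by
      linear_combination e01 + M 0 1 * hs - (M 0 0 - M 1 1) * ho
    have z2 : (g : ZMod n) * ((M 0 0 - M 1 1) * c - a * M 1 0) = 0 := by
      linear_combination -e10 + M 1 0 * hs - (M 0 0 - M 1 1) * hl
    have z3 : (g : ZMod n) * (M 0 1 * c - b * M 1 0) = 0 := by
      linear_combination e00 - M 0 1 * hl + M 1 0 * ho
    have y1 := cast_eq_zero_of_mul H.mul z1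
    have y2 := cast_eq_zero_of_mul H.mul z2
    have y3 := cast_eq_zero_of_mul H.mul z3
    simp only [map_sub, map_mul, map_natCast, sub_eq_zero] at y1 y2 y3
    simp only [red_apply]
    exact ⟨y1, y2, y3⟩
  have h1 : #(S.image (red hk)) ≤ k ^ 2 := by
    let f : SpecialLinearGroup (Fin 2) (ZMod k) → ZMod k × ZMod k := fun M =>
      (M 1 1, u * (M 0 0 - M 1 1) + v * M 0 1 + w * M 1 0)
    calc #(S.image (red hk)) ≤ #(univ : Finset (ZMod k × ZMod k)) := by
          refine card_le_card_of_injOn f (fun _ _ => mem_univ _) ?_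
          have hrec : ∀ x ∈ S.image (red hk), x 0 0 - x 1 1 = (f x).2 * a ∧ x 0 1 = (f x).2 * b ∧
              x 1 0 = (f x).2 * c := by
            intro x hx
            obtain ⟨M, hM, rfl⟩ := mem_image.1 hx
            obtain ⟨k1, k2, k3⟩ := key M hM
            simp only [f]
            refine ⟨?_, ?_, ?_⟩
            · linear_combination -(red hk M 0 0 - red hk M 1 1) * ht' + v * k1 + w * k2
            · linear_combination -(red hk M 0 1) * ht' - u * k1 + w * k3
            · linear_combination -(red hk M 1 0) * ht' - u * k2 - v * k3
          intro x hx y hy hxy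
          obtain ⟨x1, x2, x3⟩ := hrec x hx
          obtain ⟨y1, y2, y3⟩ := hrec y hy
          have h11 : x 1 1 = y 1 1 := congrArg Prod.fst hxy
          rw [hxy] at x1 x2 x3
          refine SL_ext ?_ (x2.trans y2.symm) (x3.trans y3.symm) h11
          linear_combination x1 - y1 + h11
      _ = k ^ 2 := by rw [card_univ, Fintype.card_prod, ZMod.card, sq]
  have h2 := card_le_mul_card_image (f := red hk) S ((n / k) ^ 3) (by
    intro b _
    refine (card_le_card ?_).trans (card_red_fiber_le hk b)
    intro x hx
    exact mem_filter.2 ⟨mem_univ _, (mem_filter.1 hx).2⟩)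
  have hgk : n / k = g := by
    rw [← H.mul, Nat.mul_div_cancel _ (Nat.pos_of_ne_zero (NeZero.ne k))]
  rw [hgk] at h2
  calc #S ≤ g ^ 3 * #(S.image (red hk)) := h2
    _ ≤ g ^ 3 * k ^ 2 := Nat.mul_le_mul_left _ h1
    _ = (g * k) ^ 2 * g := by ring
    _ = _ := by rw [H.mul]

/-- `h` is scalar modulo a divisor of `d` that is at least `d / E`. -/
def NearCentral {d : ℕ} (E : ℕ) (h : SpecialLinearGroup (Fin 2) (ZMod d)) : Prop :=
  ∃ m, m ∣ d ∧ d ≤ E * m ∧ h ∈ Cen (m : ZMod d)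

lemma card_nearCentral_le (d E : ℕ) [NeZero d] :
    #{h : SpecialLinearGroup (Fin 2) (ZMod d) | NearCentral E h} ≤
      2 * #d.divisors ^ 2 * E ^ 3 := by
  have hd := Nat.pos_of_ne_zero (NeZero.ne d)
  calc #{h : SpecialLinearGroup (Fin 2) (ZMod d) | NearCentral E h}
      ≤ #((d.divisors.filter (fun m => d ≤ E * m)).biUnion (fun m =>
        univ.filter (fun h : SpecialLinearGroup (Fin 2) (ZMod d) => h ∈ Cen (m : ZMod d)))) := by
        apply card_le_card
        intro h hh
        obtain ⟨m, h1, h2, h3⟩ := (mem_filter.1 hh).2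
        refine mem_biUnion.2 ⟨m, mem_filter.2 ⟨Nat.mem_divisors.2 ⟨h1, hd.ne'⟩, h2⟩,
          mem_filter.2 ⟨mem_univ _, h3⟩⟩
    _ ≤ #(d.divisors.filter (fun m => d ≤ E * m)) * (2 * #d.divisors * E ^ 3) := by
        apply card_biUnion_le_card_mul
        intro m hm
        obtain ⟨hm1, hm2⟩ := mem_filter.1 hm
        have hmd := (Nat.mem_divisors.1 hm1).1
        refine (card_Cen_le hmd).trans ?_
        have : d / m ≤ E := Nat.div_le_of_le_mul (by rwa [mul_comm])
        have h3 : #m.divisors ≤ #d.divisors := card_le_card (Nat.divisors_subset_of_dvd hd.ne' hmd)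
        gcongr
    _ ≤ #d.divisors * (2 * #d.divisors * E ^ 3) := by
        gcongr; exact filter_subset _ _
    _ = _ := by ring

lemma nearCentral_of_centralizer {d E : ℕ} [NeZero d] (h : SpecialLinearGroup (Fin 2) (ZMod d))
    (H : d ^ 3 ≤ E * #{M : SpecialLinearGroup (Fin 2) (ZMod d) | M * h = h * M}) :
    NearCentral E h := by
  obtain ⟨g, k, a, b, c, hc⟩ := exists_content h
  have hg : g ∣ d := Dvd.intro _ hc.mul
  refine ⟨g, hg, ?_, (hc.mem_Cen_iff hg).2 dvd_rfl⟩
  have hd := Nat.pos_of_ne_zero (NeZero.ne d)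
  have h1 := H.trans (Nat.mul_le_mul_left E (card_centralizer_le hc))
  refine Nat.le_of_mul_le_mul_left (?_ : d ^ 2 * d ≤ d ^ 2 * (E * g)) (by positivity)
  calc d ^ 2 * d = d ^ 3 := by ring
    _ ≤ _ := h1
    _ = _ := by ring

lemma succ_pow_four_le (k : ℕ) : (k + 1) ^ 4 ≤ 256 * 2 ^ k := by
  rcases lt_or_ge k 6 with h | h
  · interval_cases k <;> norm_num
  · induction k, h using Nat.le_induction with
    | base => norm_num
    | succ k hk ih =>
      have : (k + 1 + 1) ^ 4 ≤ 2 * (k + 1) ^ 4 := by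
        obtain ⟨j, rfl⟩ := Nat.exists_eq_add_of_le hk
        ring_nf; nlinarith [Nat.zero_le (j ^ 4), Nat.zero_le (j^3), Nat.zero_le (j^2)]
      rw [pow_succ 2]; omega

lemma card_divisors_pow_four_le (m : ℕ) (hm : m ≠ 0) :
    #m.divisors ^ 4 ≤ 256 ^ 16 * m := by
  rw [Nat.card_divisors hm, ← Finset.prod_pow]
  have h1 : ∀ p ∈ m.primeFactors, (m.factorization p + 1) ^ 4 ≤
      (if p < 16 then 256 else 1) * p ^ m.factorization p := by
    intro p hp
    have hp2 := (Nat.prime_of_mem_primeFactors hp).two_le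
    split_ifs with h
    · exact (succ_pow_four_le _).trans (by gcongr)
    · rw [one_mul]
      have : m.factorization p + 1 ≤ 2 ^ m.factorization p := Nat.lt_two_pow_self
      calc (m.factorization p + 1) ^ 4 ≤ (2 ^ m.factorization p) ^ 4 := by gcongr
        _ = 16 ^ m.factorization p := by rw [← pow_mul, mul_comm, pow_mul]; norm_num
        _ ≤ _ := by gcongr; omega
  calc _ ≤ ∏ p ∈ m.primeFactors, ((if p < 16 then 256 else 1) * p ^ m.factorization p) :=
        Finset.prod_le_prod' h1
    _ = (∏ p ∈ m.primeFactors, (if p < 16 then 256 else 1)) * m := by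
        rw [Finset.prod_mul_distrib]; congr 1
        exact Nat.prod_factorization_pow_eq_self hm
    _ ≤ 256 ^ 16 * m := by
        gcongr
        rw [← Finset.prod_filter, Finset.prod_const]
        apply Nat.pow_le_pow_right (by norm_num)
        calc _ ≤ #(Finset.range 16) := card_le_card (by
              intro p hp; exact mem_range.2 (mem_filter.1 hp).2)
          _ = 16 := by simp

lemma prod_one_sub_inv_ge (s : Finset ℕ) (hs : ∀ x ∈ s, 2 ≤ x) :
    (1 : ℚ) / (#s + 1) ≤ ∏ x ∈ s, (1 - (x : ℚ)⁻¹) := by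
  induction s using Finset.induction_on_max with
  | empty => simp
  | insert a s ha ih =>
    have hn : a ∉ s := fun h => lt_irrefl _ (ha a h)
    rw [prod_insert hn, card_insert_of_notMem hn]
    have ih := ih (fun x hx => hs x (mem_insert_of_mem hx))
    have hcard : #s + 2 ≤ a := by
      have : s ⊆ Finset.Ico 2 a := fun x hx =>
        Finset.mem_Ico.2 ⟨hs x (mem_insert_of_mem hx), ha x hx⟩
      have h1 := card_le_card this
      have h2 := hs a (mem_insert_self _ _)
      simp at h1; omega
    have hc : ((#s : ℚ) + 2) ≤ a := by exact_mod_cast hcard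
    have h3 : (1 : ℚ) - (a : ℚ)⁻¹ ≥ (#s + 1) / (#s + 2) := by
      have : (a : ℚ)⁻¹ ≤ (#s + 2 : ℚ)⁻¹ := by gcongr
      have h5 : (#s + 1 : ℚ) / (#s + 2) = 1 - (#s + 2 : ℚ)⁻¹ := by field_simp; ring
      linarith
    calc (1 : ℚ) / ((#s + 1 : ℕ) + 1) = (#s + 1) / (#s + 2) * (1 / (#s + 1)) := by
          push_cast; field_simp; ring
      _ ≤ _ := mul_le_mul h3 ih (by positivity) (le_trans (by positivity) h3)

lemma card_primeFactors_le_log (n : ℕ) (hn : n ≠ 0) : #n.primeFactors ≤ Nat.log 2 n := by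
  apply Nat.le_log_of_pow_le (by norm_num)
  calc 2 ^ #n.primeFactors ≤ ∏ p ∈ n.primeFactors, p :=
        Finset.pow_card_le_prod _ _ _ (fun p hp => (Nat.prime_of_mem_primeFactors hp).two_le)
    _ ≤ n := Nat.le_of_dvd (Nat.pos_of_ne_zero hn) (Nat.prod_primeFactors_dvd n)

lemma le_totient_mul_log (n : ℕ) : n ≤ n.totient * (Nat.log 2 n + 1) := by
  rcases eq_or_ne n 0 with rfl | hn
  · simp
  have h1 := Nat.totient_eq_mul_prod_factors n
  have h2 := prod_one_sub_inv_ge n.primeFactors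
    (fun p hp => (Nat.prime_of_mem_primeFactors hp).two_le)
  have h3 : (#n.primeFactors : ℚ) ≤ Nat.log 2 n := by exact_mod_cast card_primeFactors_le_log n hn
  have h4 : (1 : ℚ) / (Nat.log 2 n + 1) ≤ ∏ x ∈ n.primeFactors, (1 - (x : ℚ)⁻¹) :=
    le_trans (by gcongr) h2
  have h5 : (n : ℚ) ≤ n.totient * (Nat.log 2 n + 1) := by
    rw [h1]
    calc (n : ℚ) = n * (1 / (Nat.log 2 n + 1)) * (Nat.log 2 n + 1) := by field_simp
      _ ≤ _ := by gcongr
  exact_mod_cast h5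

lemma sum_inv_order_cube_lt {n : ℕ} [NeZero n] :
    ∑ η ∈ (univ : Finset (ZMod n)).filter (· ≠ 0), ((addOrderOf η : ℝ) ^ 3)⁻¹ < 1 := by
  have hmaps : ∀ η ∈ (univ : Finset (ZMod n)).filter (· ≠ 0), addOrderOf η ∈ Finset.Icc 2 n := by
    intro η hη
    have h0 := (mem_filter.1 hη).2
    have h1 : addOrderOf η ∣ n := by
      apply addOrderOf_dvd_of_nsmul_eq_zero; simp
    have h2 : addOrderOf η ≠ 1 := by simpa [AddMonoid.addOrderOf_eq_one_iff] using h0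
    have h3 : 0 < addOrderOf η := Nat.pos_of_dvd_of_pos h1 (Nat.pos_of_ne_zero (NeZero.ne n))
    exact Finset.mem_Icc.2 ⟨by omega, Nat.le_of_dvd (Nat.pos_of_ne_zero (NeZero.ne n)) h1⟩
  rw [← Finset.sum_fiberwise_of_maps_to hmaps]
  have h1 : ∀ m ∈ Finset.Icc 2 n, ∑ η ∈ (univ : Finset (ZMod n)).filter (· ≠ 0) with
      addOrderOf η = m, ((addOrderOf η : ℝ) ^ 3)⁻¹ ≤ 1 / (m - 1 : ℝ) - 1 / m := by
    intro m hm
    have hm2 : 2 ≤ m := (Finset.mem_Icc.1 hm).1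
    have hmr : (2 : ℝ) ≤ m := by exact_mod_cast hm2
    have hc : #{η ∈ (univ : Finset (ZMod n)).filter (· ≠ 0) | addOrderOf η = m} ≤ m := by
      refine le_trans (card_le_card ?_)
        (IsAddCyclic.card_nsmul_eq_zero_le (α := ZMod n) (n := m) (by omega))
      intro η hη
      have := (mem_filter.1 hη).2
      exact mem_filter.2 ⟨mem_univ _, this ▸ addOrderOf_nsmul_eq_zero η⟩
    calc ∑ η ∈ (univ : Finset (ZMod n)).filter (· ≠ 0) with
        addOrderOf η = m, ((addOrderOf η : ℝ) ^ 3)⁻¹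
        = #{η ∈ (univ : Finset (ZMod n)).filter (· ≠ 0) | addOrderOf η = m} * ((m : ℝ) ^ 3)⁻¹ := by
          rw [← nsmul_eq_mul, ← Finset.sum_const]
          refine Finset.sum_congr rfl fun η hη => ?_
          rw [(mem_filter.1 hη).2]
      _ ≤ m * ((m : ℝ) ^ 3)⁻¹ := by gcongr
      _ = 1 / (m * m : ℝ) := by field_simp
      _ ≤ 1 / ((m - 1) * m : ℝ) := by
          apply one_div_le_one_div_of_le
          · nlinarith
          · nlinarith
      _ = _ := by
          have : (m - 1 : ℝ) ≠ 0 := by linarith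
          field_simp; ring
  refine (Finset.sum_le_sum h1).trans_lt ?_
  have h2 : ∀ k : ℕ, ∑ m ∈ Finset.Icc 2 (k + 1), (1 / ((m : ℝ) - 1) - 1 / m) = 1 - 1 / (k + 1) := by
    intro k
    induction k with
    | zero => simp
    | succ k ih =>
      rw [Finset.sum_Icc_succ_top (by omega), ih]; push_cast; ring
  obtain ⟨k, rfl⟩ : ∃ k, n = k + 1 := ⟨n - 1, by have := NeZero.ne n; omega⟩
  rw [h2]
  have : (0 : ℝ) < 1 / (k + 1) := by positivity
  linarith

/-- A circle-method criterion for twelvefold sums to fill the ideal generated by `D`. -/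
lemma fill_of_decay {n : ℕ} [NeZero n] {ι : Type*} (I : Finset ι) (hI : I.Nonempty)
    (val : ι → ZMod n) (D : ZMod n) (hD : ∀ i ∈ I, D ∣ val i)
    (hF : ∀ ξ : ZMod n, ‖∑ i ∈ I, (ZMod.stdAddChar (ξ * val i) : ℂ)‖ ^ 4 * addOrderOf (ξ * D) ≤
      (#I : ℝ) ^ 4) (j : ZMod n) :
    ∃ w : Fin 12 → ι, (∀ k, w k ∈ I) ∧ ∑ k, val (w k) = D * j := by
  by_contra hcon
  push Not at hcon
  set e : AddChar (ZMod n) ℂ := ZMod.stdAddChar with he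
  set F : ZMod n → ℂ := fun ξ => ∑ i ∈ I, e (ξ * val i) with hFdef
  have hzero : ∑ ξ : ZMod n, F ξ ^ 12 * e (-(ξ * (D * j))) = 0 := by
    have : ∀ ξ, F ξ ^ 12 * e (-(ξ * (D * j))) = ∑ w ∈ Fintype.piFinset fun _ : Fin 12 => I,
        e (ξ * (∑ k, val (w k) - D * j)) := by
      intro ξ
      simp only [hFdef]
      rw [Finset.sum_pow', Finset.sum_mul]
      refine Finset.sum_congr rfl fun w _ => ?_
      rw [mul_sub, sub_eq_add_neg, AddChar.map_add_eq_mul, Finset.mul_sum]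
      congr 1
      exact (map_prod e.toMonoidHom _ _).symm
    simp_rw [this]
    rw [Finset.sum_comm]
    refine Finset.sum_eq_zero fun w hw => ?_
    have hw' := hcon w (fun k => Fintype.mem_piFinset.1 hw k)
    have := AddChar.sum_mulShift (∑ k, val (w k) - D * j) (ZMod.isPrimitive_stdAddChar n)
    rw [if_neg (sub_ne_zero.2 hw')] at this
    simpa using this
  set Z := (univ : Finset (ZMod n)).filter (fun ξ => ξ * D = 0) with hZ
  have hmain : ∑ ξ ∈ Z, F ξ ^ 12 * e (-(ξ * (D * j))) = (#Z : ℂ) * (#I : ℂ) ^ 12 := by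
    rw [← nsmul_eq_mul, ← Finset.sum_const]
    refine Finset.sum_congr rfl fun ξ hξ => ?_
    have h0 := (mem_filter.1 hξ).2
    have h1 : F ξ = #I := by
      simp only [hFdef]
      rw [Finset.sum_congr rfl (g := fun _ => (1 : ℂ))]
      · simp
      · intro i hi
        obtain ⟨c, hc⟩ := hD i hi
        rw [hc, ← mul_assoc, h0, zero_mul, AddChar.map_zero_eq_one]
    rw [h1, ← mul_assoc, h0, zero_mul, neg_zero, AddChar.map_zero_eq_one, mul_one]
  have hIpos : (0 : ℝ) < #I := by exact_mod_cast hI.card_pos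
  have hZpos : (0 : ℝ) < #Z := by
    have : 0 < #Z := card_pos.2 ⟨0, mem_filter.2 ⟨mem_univ _, by simp⟩⟩
    exact_mod_cast this
  have hrest : ‖∑ ξ ∈ univ.filter (fun ξ : ZMod n => ¬ ξ * D = 0),
      F ξ ^ 12 * e (-(ξ * (D * j)))‖ < #Z * (#I : ℝ) ^ 12 := by
    calc _ ≤ ∑ ξ ∈ univ.filter (fun ξ : ZMod n => ¬ ξ * D = 0),
          (#I : ℝ) ^ 12 * ((addOrderOf (ξ * D) : ℝ) ^ 3)⁻¹ := by
          refine (norm_sum_le _ _).trans (Finset.sum_le_sum fun ξ _ => ?_)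
          rw [norm_mul, AddChar.norm_apply, mul_one, norm_pow]
          have hpos : (0 : ℝ) < addOrderOf (ξ * D) := by exact_mod_cast addOrderOf_pos _
          rw [← div_eq_mul_inv, le_div_iff₀ (by positivity)]
          calc ‖F ξ‖ ^ 12 * (addOrderOf (ξ * D) : ℝ) ^ 3
              = (‖F ξ‖ ^ 4 * addOrderOf (ξ * D)) ^ 3 := by ring
            _ ≤ ((#I : ℝ) ^ 4) ^ 3 := by
                gcongr; exact hF ξ
            _ = _ := by ring
      _ ≤ ∑ η ∈ (univ : Finset (ZMod n)).filter (· ≠ 0),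
            (#Z : ℝ) * ((#I : ℝ) ^ 12 * ((addOrderOf η : ℝ) ^ 3)⁻¹) := by
          rw [← Finset.sum_fiberwise_of_maps_to (g := fun ξ => ξ * D)
            (t := (univ : Finset (ZMod n)).filter (· ≠ 0))
            (fun ξ hξ => mem_filter.2 ⟨mem_univ _, (mem_filter.1 hξ).2⟩)]
          refine Finset.sum_le_sum fun η _ => ?_
          rw [Finset.sum_congr rfl (g := fun _ => (#I : ℝ) ^ 12 * ((addOrderOf η : ℝ) ^ 3)⁻¹)
            (fun ξ hξ => by rw [(mem_filter.1 hξ).2]), Finset.sum_const, nsmul_eq_mul]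
          refine mul_le_mul_of_nonneg_right (Nat.cast_le.2 ?_) (by positivity)
          rcases Finset.eq_empty_or_nonempty
            {ξ ∈ univ.filter (fun ξ : ZMod n => ¬ ξ * D = 0) | ξ * D = η} with h | ⟨ξ0, h0⟩
          · rw [h]; simp
          · refine card_le_card_of_injOn (fun ξ => ξ - ξ0) ?_ ?_
            · intro ξ hξ
              refine mem_filter.2 ⟨mem_univ _, ?_⟩
              rw [sub_mul, (mem_filter.1 hξ).2, (mem_filter.1 h0).2, sub_self]
            · intro a _ b _ hab; simpa using hab
      _ = #Z * (#I : ℝ) ^ 12 * ∑ η ∈ (univ : Finset (ZMod n)).filter (· ≠ 0),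
            ((addOrderOf η : ℝ) ^ 3)⁻¹ := by
          rw [Finset.mul_sum]; refine Finset.sum_congr rfl fun _ _ => by ring
      _ < #Z * (#I : ℝ) ^ 12 * 1 := by
          gcongr; exact sum_inv_order_cube_lt
      _ = _ := mul_one _
  have hsplit := Finset.sum_filter_add_sum_filter_not univ (fun ξ : ZMod n => ξ * D = 0)
    (fun ξ => F ξ ^ 12 * e (-(ξ * (D * j))))
  rw [hzero, hmain] at hsplit
  have h5 := congrArg norm (eq_neg_of_add_eq_zero_left hsplit)
  rw [norm_neg] at h5
  rw [← h5] at hrest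
  simp at hrest

lemma mul_eq_zero_iff_order_dvd {n : ℕ} [NeZero n] (a z : ZMod n) :
    a * z = 0 ↔ (addOrderOf a : ZMod n) ∣ z := by
  have h1 : addOrderOf a ∣ n := by
    apply addOrderOf_dvd_of_nsmul_eq_zero; simp
  rw [← ZMod.natCast_zmod_val z, natCast_dvd_natCast_iff h1, addOrderOf_dvd_iff_nsmul_eq_zero,
    nsmul_eq_mul, mul_comm]

lemma card_dvd_sub {m n : ℕ} [NeZero n] (h : m ∣ n) (c : ZMod n) :
    #{x : ZMod n | (m : ZMod n) ∣ x - c} = n / m := by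
  rw [← card_cast_fiber h (ZMod.castHom h (ZMod m) c)]
  congr 1
  ext x
  simp only [mem_filter, mem_univ, true_and]
  rw [natCast_dvd_iff h, map_sub, sub_eq_zero]

lemma double_sum_eq {n : ℕ} [NeZero n] (S : Finset (ZMod n)) (a : ZMod n) :
    ∑ s ∈ S, ∑ s' ∈ S, (ZMod.stdAddChar (a * (s - s')) : ℂ) =
      ((‖∑ s ∈ S, (ZMod.stdAddChar (a * s) : ℂ)‖ ^ 2 : ℝ) : ℂ) := by
  have h := Complex.mul_conj (∑ s ∈ S, (ZMod.stdAddChar (a * s) : ℂ))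
  rw [Complex.normSq_eq_norm_sq] at h
  rw [← h, map_sum, Finset.sum_mul_sum]
  refine Finset.sum_congr rfl fun s _ => Finset.sum_congr rfl fun s' _ => ?_
  rw [mul_sub, sub_eq_add_neg, AddChar.map_add_eq_mul, AddChar.map_neg_eq_conj]

lemma exists_max_card {α β : Type*} [Fintype β] [Nonempty β] (T : Finset α)
    (r : α → β → Prop) [∀ x c, Decidable (r x c)] :
    ∃ c : β, ∀ c', #{x ∈ T | r x c'} ≤ #{x ∈ T | r x c} := by
  obtain ⟨c, -, hc⟩ := Finset.exists_max_image (univ : Finset β)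
    (fun c => #{x ∈ T | r x c}) univ_nonempty
  exact ⟨c, fun c' => hc c' (mem_univ _)⟩

lemma sum_sq_le {n : ℕ} [NeZero n] (S : Finset (ZMod n)) (D0 : ℕ) (b : ZMod n) (Q : ℕ)
    (hS : ∀ s ∈ S, ∀ s' ∈ S, (D0 : ZMod n) ∣ s - s')
    (hQ : ∀ c, #{s ∈ S | ((D0 * addOrderOf (b * D0) : ℕ) : ZMod n) ∣ s - c} ≤ Q) :
    ∑ x : ZMod n, ‖∑ s ∈ S, (ZMod.stdAddChar (b * x * s) : ℂ)‖ ^ 2 ≤ n * (#S * Q) := by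
  set m := addOrderOf (b * D0)
  have h1 : ((∑ x : ZMod n, ‖∑ s ∈ S, (ZMod.stdAddChar (b * x * s) : ℂ)‖ ^ 2 : ℝ) : ℂ) =
      ((n * ∑ s ∈ S, #{s' ∈ S | b * (s - s') = 0} : ℕ) : ℂ) := by
    rw [Complex.ofReal_sum]
    simp_rw [← double_sum_eq]
    rw [Finset.sum_comm, Nat.cast_mul, Nat.cast_sum, Finset.mul_sum]
    refine Finset.sum_congr rfl fun s _ => ?_
    rw [Finset.sum_comm, Finset.card_filter, Nat.cast_sum, Finset.mul_sum]
    refine Finset.sum_congr rfl fun s' _ => ?_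
    have := AddChar.sum_mulShift (b * (s - s')) (ZMod.isPrimitive_stdAddChar n)
    rw [ZMod.card] at this
    rw [Finset.sum_congr rfl (g := fun x => (ZMod.stdAddChar (x * (b * (s - s'))) : ℂ))
      (fun x _ => by congr 1; ring), this]
    split_ifs <;> simp
  have h2 : ∑ x : ZMod n, ‖∑ s ∈ S, (ZMod.stdAddChar (b * x * s) : ℂ)‖ ^ 2 =
      ((n * ∑ s ∈ S, #{s' ∈ S | b * (s - s') = 0} : ℕ) : ℝ) := by exact_mod_cast h1
  rw [h2]
  have h3 : ∑ s ∈ S, #{s' ∈ S | b * (s - s') = 0} ≤ #S * Q := by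
    refine Finset.sum_le_card_nsmul S _ Q fun s hs => le_trans (card_le_card ?_) (hQ s)
    intro s' hs'
    obtain ⟨hs1, hs2⟩ := mem_filter.1 hs'
    refine mem_filter.2 ⟨hs1, ?_⟩
    obtain ⟨z, hz⟩ := hS s hs s' hs1
    rw [hz, ← mul_assoc, mul_eq_zero_iff_order_dvd] at hs2
    obtain ⟨y, hy⟩ := hs2
    refine ⟨-y, ?_⟩
    rw [← neg_sub, hz, hy]; push_cast; ring
  exact_mod_cast Nat.mul_le_mul_left n h3

set_option maxHeartbeats 1000000 in
lemma decay_bound {n : ℕ} [NeZero n] {ι : Type*} (T : Finset ι) (y : ι → ZMod n)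
    (S : Finset (ZMod n)) (D0 D1 : ℕ) (hD0 : D0 ∣ n) (hD1 : D1 ∣ n)
    (hT : ∀ i ∈ T, ∀ j ∈ T, (D1 : ZMod n) ∣ y i - y j)
    (hS : ∀ s ∈ S, ∀ s' ∈ S, (D0 : ZMod n) ∣ s - s')
    (hTm : ∀ m, D1 * m ∣ n → ∀ c, #{i ∈ T | ((D1 * m : ℕ) : ZMod n) ∣ y i - c} ^ 4 * m ^ 2 ≤
      #T ^ 4)
    (hSm : ∀ m, D0 * m ∣ n → ∀ c, #{s ∈ S | ((D0 * m : ℕ) : ZMod n) ∣ s - c} ^ 4 * m ^ 3 ≤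
      #S ^ 4) (ξ : ZMod n) :
    ‖∑ w ∈ (T ×ˢ T) ×ˢ (S ×ˢ S), (ZMod.stdAddChar
      (ξ * ((y w.1.1 - y w.1.2) * (w.2.1 - w.2.2))) : ℂ)‖ ^ 4 *
      addOrderOf (ξ * ((D0 * D1 : ℕ) : ZMod n)) ≤ (#((T ×ˢ T) ×ˢ (S ×ˢ S)) : ℝ) ^ 4 := by
  set m := addOrderOf (ξ * ((D0 * D1 : ℕ) : ZMod n)) with hm
  have hn : 0 < n := Nat.pos_of_ne_zero (NeZero.ne n)
  have hmn : m ∣ n := by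
    apply addOrderOf_dvd_of_nsmul_eq_zero; simp
  have hm0 : 0 < m := addOrderOf_pos _
  have hmD0 : D0 * m ∣ n := by
    obtain ⟨k, hk⟩ := hD0
    have h0 : D0 ≠ 0 := by rintro rfl; simp at hk; omega
    rw [hk]
    apply mul_dvd_mul_left
    apply addOrderOf_dvd_of_nsmul_eq_zero
    have : ((D0 * k : ℕ) : ZMod n) = 0 := by rw [← hk]; simp
    push_cast at this
    rw [nsmul_eq_mul]; push_cast
    linear_combination ξ * D1 * this
  have hmD1 : D1 * m ∣ n := by
    obtain ⟨k, hk⟩ := hD1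
    rw [hk]
    apply mul_dvd_mul_left
    apply addOrderOf_dvd_of_nsmul_eq_zero
    have : ((D1 * k : ℕ) : ZMod n) = 0 := by rw [← hk]; simp
    push_cast at this
    rw [nsmul_eq_mul]; push_cast
    linear_combination ξ * D0 * this
  obtain ⟨cP, hcP⟩ := exists_max_card T (fun i c => ((D1 * m : ℕ) : ZMod n) ∣ y i - c)
  obtain ⟨cQ, hcQ⟩ := exists_max_card S (fun s c => ((D0 * m : ℕ) : ZMod n) ∣ s - c)
  set P := #{i ∈ T | ((D1 * m : ℕ) : ZMod n) ∣ y i - cP} with hP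
  set Q := #{s ∈ S | ((D0 * m : ℕ) : ZMod n) ∣ s - cQ} with hQ
  have hPm : P ^ 4 * m ^ 2 ≤ #T ^ 4 := hTm m hmD1 cP
  have hQm : Q ^ 4 * m ^ 3 ≤ #S ^ 4 := hSm m hmD0 cQ
  set G : ZMod n → ℝ := fun x => ‖∑ s ∈ S, (ZMod.stdAddChar (ξ * (D1 : ZMod n) * x * s) : ℂ)‖ ^ 2 with hG
  have hm' : addOrderOf (ξ * D1 * (D0 : ZMod n)) = m := by
    rw [hm]; congr 1; push_cast; ring
  have hGsum : ∑ x, G x ≤ n * (#S * Q) :=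
    sum_sq_le S D0 (ξ * D1) Q hS (by rw [hm']; exact hcQ)
  have hGper : ∀ x x', (m : ZMod n) ∣ x - x' → G x = G x' := by
    intro x x' ⟨z, hz⟩
    have : (G x : ℂ) = G x' := by
      simp only [hG]
      rw [← double_sum_eq, ← double_sum_eq]
      refine Finset.sum_congr rfl fun s hs => Finset.sum_congr rfl fun s' hs' => ?_
      obtain ⟨σ, hσ⟩ := hS s hs s' hs'
      have h0 : ξ * ((D0 * D1 : ℕ) : ZMod n) * m = 0 :=
        (mul_eq_zero_iff_order_dvd _ _).2 dvd_rfl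
      push_cast at h0
      congr 1
      rw [hσ]
      linear_combination (ξ * D1 * D0 * σ) * hz + σ * z * h0
    exact_mod_cast this
  have key : ∀ j ∈ T, ∑ i ∈ T, ‖∑ s ∈ S, ∑ s' ∈ S,
      (ZMod.stdAddChar (ξ * ((y i - y j) * (s - s'))) : ℂ)‖ ≤ m * P * (#S * Q) := by
    intro j hj
    have : ∀ i : ι, ∃ κ : ZMod n, i ∈ T → y i - y j = D1 * κ := by
      intro i
      by_cases hi : i ∈ T
      · obtain ⟨κ, hκ⟩ := hT i hi j hj; exact ⟨κ, fun _ => hκ⟩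
      · exact ⟨0, fun h => absurd h hi⟩
    choose κ hκ using this
    have e1 : ∀ i ∈ T, ‖∑ s ∈ S, ∑ s' ∈ S,
        (ZMod.stdAddChar (ξ * ((y i - y j) * (s - s'))) : ℂ)‖ = G (κ i) := by
      intro i hi
      have : ∑ s ∈ S, ∑ s' ∈ S,
        (ZMod.stdAddChar (ξ * ((y i - y j) * (s - s'))) : ℂ) = (G (κ i) : ℂ) := by
        simp only [hG]
        rw [← double_sum_eq]
        refine Finset.sum_congr rfl fun s hs => Finset.sum_congr rfl fun s' hs' => ?_
        rw [hκ i hi]; congr 1; ring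
      rw [this, Complex.norm_real, Real.norm_of_nonneg (by positivity)]
    rw [Finset.sum_congr rfl e1]
    have e2 : (n / m : ℕ) * ∑ i ∈ T, G (κ i) ≤ P * ∑ x, G x := by
      calc (n / m : ℕ) * ∑ i ∈ T, G (κ i)
          = ∑ i ∈ T, ∑ x : ZMod n, if (m : ZMod n) ∣ x - κ i then G x else 0 := by
            rw [Finset.mul_sum]
            refine Finset.sum_congr rfl fun i _ => ?_
            rw [← card_dvd_sub hmn (κ i), ← nsmul_eq_mul, ← Finset.sum_const, Finset.sum_filter]
            refine Finset.sum_congr rfl fun x _ => ?_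
            split_ifs with h
            · exact (hGper _ _ h).symm
            · rfl
        _ = ∑ x : ZMod n, #{i ∈ T | (m : ZMod n) ∣ x - κ i} * G x := by
            rw [Finset.sum_comm]
            refine Finset.sum_congr rfl fun x _ => ?_
            rw [← Finset.sum_filter, Finset.sum_const, nsmul_eq_mul]
        _ ≤ ∑ x : ZMod n, P * G x := by
            refine Finset.sum_le_sum fun x _ => ?_
            have hG0 : 0 ≤ G x := by positivity
            refine mul_le_mul_of_nonneg_right (Nat.cast_le.2 ?_) hG0
            rcases Finset.eq_empty_or_nonempty {i ∈ T | (m : ZMod n) ∣ x - κ i} with h | ⟨i0, h0⟩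
            · rw [h]; simp
            · refine le_trans (card_le_card ?_) (hcP (y i0))
              intro i hi
              obtain ⟨hi1, z, hz⟩ := mem_filter.1 hi
              obtain ⟨hi2, z', hz'⟩ := mem_filter.1 h0
              refine mem_filter.2 ⟨hi1, z' - z, ?_⟩
              have k1 := hκ i hi1
              have k2 := hκ i0 hi2
              push_cast
              linear_combination k1 - k2 + D1 * (hz' - hz)
        _ = _ := by rw [Finset.mul_sum]
    have hnm : ((n / m : ℕ) : ℝ) * m = n := by
      exact_mod_cast Nat.div_mul_cancel hmn
    have hnm0 : (0 : ℝ) < (n / m : ℕ) := by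
      exact_mod_cast Nat.div_pos (Nat.le_of_dvd hn hmn) hm0
    refine le_of_mul_le_mul_left ?_ hnm0
    calc ((n / m : ℕ) : ℝ) * ∑ i ∈ T, G (κ i) ≤ P * ∑ x, G x := e2
      _ ≤ P * (n * (#S * Q)) := by gcongr
      _ = _ := by rw [← hnm]; ring
  have hF : ‖∑ w ∈ (T ×ˢ T) ×ˢ (S ×ˢ S), (ZMod.stdAddChar
      (ξ * ((y w.1.1 - y w.1.2) * (w.2.1 - w.2.2))) : ℂ)‖ ≤ #T * (m * P * (#S * Q)) := by
    rw [Finset.sum_product, Finset.sum_product_right]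
    refine (norm_sum_le _ _).trans ?_
    rw [← nsmul_eq_mul]
    refine Finset.sum_le_card_nsmul T _ _ fun j hj => ?_
    refine (norm_sum_le _ _).trans ?_
    simp_rw [Finset.sum_product]
    exact key j hj
  calc _ ≤ (#T * (m * P * (#S * Q)) : ℝ) ^ 4 * m := by gcongr
    _ = (#T : ℝ) ^ 4 * #S ^ 4 * ((P ^ 4 * m ^ 2 : ℕ) : ℝ) * ((Q ^ 4 * m ^ 3 : ℕ) : ℝ) := by
        push_cast; ring
    _ ≤ (#T : ℝ) ^ 4 * #S ^ 4 * ((#T ^ 4 : ℕ) : ℝ) * ((#S ^ 4 : ℕ) : ℝ) := by gcongr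
    _ = _ := by
        simp only [card_product]; push_cast; ring

lemma card_units_sq_le {m n : ℕ} [NeZero n] (h : m ∣ n) (c : ZMod n) :
    #{l : (ZMod n)ˣ | (m : ZMod n) ∣ (l : ZMod n) ^ 2 - c} ≤ 2 * #m.divisors * (n / m) := by
  have : NeZero m := ⟨fun h0 => NeZero.ne n (by simpa [h0] using h)⟩
  rcases Finset.eq_empty_or_nonempty {l : (ZMod n)ˣ | (m : ZMod n) ∣ (l : ZMod n) ^ 2 - c}
    with he | ⟨l0, hl0⟩
  · rw [he]; simp
  set X := univ.filter (fun x : ZMod n => ZMod.castHom h (ZMod m) x ^ 2 = 1) with hX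
  have h1 : #{l : (ZMod n)ˣ | (m : ZMod n) ∣ (l : ZMod n) ^ 2 - c} ≤ #X := by
    refine card_le_card_of_injOn (fun l => ((l * l0⁻¹ : (ZMod n)ˣ) : ZMod n)) ?_ ?_
    · intro l hl
      refine mem_filter.2 ⟨mem_univ _, ?_⟩
      obtain ⟨a, ha⟩ := (mem_filter.1 hl).2
      obtain ⟨b, hb⟩ := (mem_filter.1 hl0).2
      have h2 : (m : ZMod n) ∣ ((l * l0⁻¹ : (ZMod n)ˣ) : ZMod n) ^ 2 - 1 := by
        refine ⟨(a - b) * ((l0⁻¹ : (ZMod n)ˣ) : ZMod n) ^ 2, ?_⟩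
        have h3 : (l0 : ZMod n) * ((l0⁻¹ : (ZMod n)ˣ) : ZMod n) = 1 := by simp
        push_cast
        linear_combination ((l0⁻¹ : (ZMod n)ˣ) : ZMod n) ^ 2 * (ha - hb) +
          ((l0 : ZMod n) * ((l0⁻¹ : (ZMod n)ˣ) : ZMod n) + 1) * h3
      rw [natCast_dvd_iff h, map_sub, map_one, sub_eq_zero, map_pow] at h2
      exact h2
    · intro a _ b _ hab
      have := Units.ext hab
      simpa using this
  have h2 := card_le_mul_card_image (f := ZMod.castHom h (ZMod m)) X (n / m) (by
    intro b _
    rw [← card_cast_fiber h b]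
    apply card_le_card
    intro x hx
    exact mem_filter.2 ⟨mem_univ _, (mem_filter.1 hx).2⟩)
  have h3 : #(X.image (ZMod.castHom h (ZMod m))) ≤ 2 * #m.divisors := by
    refine le_trans (card_le_card ?_) (card_sq_eq_one_le m)
    intro x hx
    obtain ⟨y, hy, rfl⟩ := mem_image.1 hx
    exact mem_filter.2 ⟨mem_univ _, (mem_filter.1 hy).2⟩
  calc _ ≤ #X := h1
    _ ≤ _ := h2
    _ ≤ (n / m) * (2 * #m.divisors) := Nat.mul_le_mul_left _ h3
    _ = _ := by ring

/-- Twelvefold sums `∑ (λ² - μ²)(s - s')` with `λ, μ` and `s, s'` from dense sets fill a large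
ideal. -/
lemma fill {n : ℕ} [NeZero n] (E : ℕ) (S : Finset (ZMod n)) (hS : n ≤ #S * E)
    (L : Finset (ZMod n)ˣ) (hL : n ≤ #L * E ^ 2) :
    ∃ D : ℕ, 0 < D ∧ D ≤ 2 ^ 132 * E ^ 12 ∧ ∀ j : ZMod n, ∃ (l l' : Fin 12 → (ZMod n)ˣ)
      (s s' : Fin 12 → ZMod n), (∀ k, l k ∈ L ∧ l' k ∈ L ∧ s k ∈ S ∧ s' k ∈ S) ∧
      ∑ k, ((l k : ZMod n) ^ 2 - (l' k : ZMod n) ^ 2) * (s k - s' k) = D * j := by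
  have hn : 0 < n := Nat.pos_of_ne_zero (NeZero.ne n)
  have hSpos : 0 < #S := Nat.pos_of_ne_zero (fun h => by simp [h] at hS; omega)
  have hLpos : 0 < #L := Nat.pos_of_ne_zero (fun h => by simp [h] at hL; omega)
  have hne : (n.divisors ×ˢ (univ : Finset (ZMod n))).Nonempty :=
    ⟨(1, 0), mem_product.2 ⟨Nat.one_mem_divisors.2 hn.ne', mem_univ _⟩⟩
  obtain ⟨⟨D0, c0⟩, hd0, hmax0⟩ := Finset.exists_max_image _
    (fun p : ℕ × ZMod n => #{s ∈ S | (p.1 : ZMod n) ∣ s - p.2} ^ 4 * p.1 ^ 3) hne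
  obtain ⟨⟨D1, c1⟩, hd1, hmax1⟩ := Finset.exists_max_image _
    (fun p : ℕ × ZMod n => #(L.filter fun l : (ZMod n)ˣ => (p.1 : ZMod n) ∣ (l : ZMod n) ^ 2 - p.2) ^ 4 * p.1 ^ 2) hne
  have hD0 : D0 ∣ n := (Nat.mem_divisors.1 (mem_product.1 hd0).1).1
  have hD1 : D1 ∣ n := (Nat.mem_divisors.1 (mem_product.1 hd1).1).1
  have hD0p : 0 < D0 := Nat.pos_of_dvd_of_pos hD0 hn
  have hD1p : 0 < D1 := Nat.pos_of_dvd_of_pos hD1 hn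
  simp only at hmax0 hmax1
  set S' := {s ∈ S | (D0 : ZMod n) ∣ s - c0} with hS'
  set T := (L.filter fun l : (ZMod n)ˣ => (D1 : ZMod n) ∣ (l : ZMod n) ^ 2 - c1) with hT
  have hS1 : #S ^ 4 ≤ #S' ^ 4 * D0 ^ 3 := by
    have := hmax0 (1, 0) (mem_product.2 ⟨Nat.one_mem_divisors.2 hn.ne', mem_univ _⟩)
    simpa using this
  have hT1 : #L ^ 4 ≤ #T ^ 4 * D1 ^ 2 := by
    have := hmax1 (1, 0) (mem_product.2 ⟨Nat.one_mem_divisors.2 hn.ne', mem_univ _⟩)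
    simpa using this
  have hS2 : #S' * D0 ≤ n := by
    calc #S' * D0 ≤ n / D0 * D0 := by
          gcongr
          rw [← card_dvd_sub hD0 c0]
          exact card_le_card (fun x hx => mem_filter.2 ⟨mem_univ _, (mem_filter.1 hx).2⟩)
      _ ≤ n := Nat.div_mul_le_self _ _
  have hT2 : #T * D1 ≤ 2 * #D1.divisors * n := by
    calc #T * D1 ≤ 2 * #D1.divisors * (n / D1) * D1 := by
          gcongr
          exact (card_le_card (fun x hx => mem_filter.2 ⟨mem_univ _, (mem_filter.1 hx).2⟩)).trans
            (card_units_sq_le hD1 c1)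
      _ = 2 * #D1.divisors * (n / D1 * D1) := by ring
      _ ≤ _ := by gcongr; exact Nat.div_mul_le_self _ _
  have hD0le : D0 ≤ E ^ 4 := by
    refine Nat.le_of_mul_le_mul_left (?_ : #S ^ 4 * D0 ≤ #S ^ 4 * E ^ 4) (by positivity)
    calc #S ^ 4 * D0 ≤ #S' ^ 4 * D0 ^ 3 * D0 := by gcongr
      _ = (#S' * D0) ^ 4 := by ring
      _ ≤ (#S * E) ^ 4 := Nat.pow_le_pow_left (hS2.trans hS) 4
      _ = _ := by ring
  have hD1le : D1 ≤ 2 ^ 132 * E ^ 8 := by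
    refine Nat.le_of_mul_le_mul_left (?_ : #L ^ 4 * D1 * D1 ≤ #L ^ 4 * D1 * (2 ^ 132 * E ^ 8))
      (by positivity)
    calc #L ^ 4 * D1 * D1 ≤ #T ^ 4 * D1 ^ 2 * D1 * D1 := by gcongr
      _ = (#T * D1) ^ 4 := by ring
      _ ≤ (2 * #D1.divisors * n) ^ 4 := by gcongr
      _ = 16 * #D1.divisors ^ 4 * n ^ 4 := by ring
      _ ≤ 16 * (256 ^ 16 * D1) * (#L * E ^ 2) ^ 4 := by
          gcongr; exact card_divisors_pow_four_le D1 hD1p.ne'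
      _ = _ := by ring
  have hS'ne : S'.Nonempty := by
    rw [← card_pos]; refine Nat.pos_of_ne_zero fun h => ?_
    rw [h] at hS1; simp at hS1; simp [hS1] at hSpos
  have hTne : T.Nonempty := by
    rw [← card_pos]; refine Nat.pos_of_ne_zero fun h => ?_
    rw [h] at hT1; simp at hT1; simp [hT1] at hLpos
  have hdec := decay_bound T (fun l => (l : ZMod n) ^ 2) S' D0 D1 hD0 hD1
    (by
      intro i hi j hj
      have := dvd_sub (mem_filter.1 hi).2 (mem_filter.1 hj).2
      simpa using this)
    (by
      intro i hi j hj
      have := dvd_sub (mem_filter.1 hi).2 (mem_filter.1 hj).2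
      simpa using this)
    (by
      intro m hm c
      have := hmax1 (D1 * m, c) (mem_product.2 ⟨Nat.mem_divisors.2 ⟨hm, hn.ne'⟩, mem_univ _⟩)
      refine Nat.le_of_mul_le_mul_right ?_ (pow_pos hD1p 2)
      refine le_trans ?_ this
      rw [mul_assoc, ← mul_pow, mul_comm m D1]
      gcongr
      exact filter_subset _ _)
    (by
      intro m hm c
      have := hmax0 (D0 * m, c) (mem_product.2 ⟨Nat.mem_divisors.2 ⟨hm, hn.ne'⟩, mem_univ _⟩)
      refine Nat.le_of_mul_le_mul_right ?_ (pow_pos hD0p 3)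
      refine le_trans ?_ this
      rw [mul_assoc, ← mul_pow, mul_comm m D0]
      gcongr
      exact filter_subset _ _)
  refine ⟨D0 * D1, by positivity, ?_, fun j => ?_⟩
  · calc D0 * D1 ≤ E ^ 4 * (2 ^ 132 * E ^ 8) := Nat.mul_le_mul hD0le hD1le
      _ = _ := by ring
  · obtain ⟨w, hw1, hw2⟩ := fill_of_decay ((T ×ˢ T) ×ˢ (S' ×ˢ S'))
      ((hTne.product hTne).product (hS'ne.product hS'ne))
      (fun w => ((w.1.1 : ZMod n) ^ 2 - (w.1.2 : ZMod n) ^ 2) * (w.2.1 - w.2.2))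
      ((D0 * D1 : ℕ) : ZMod n) (by
        intro w hw
        obtain ⟨h1, h2⟩ := mem_product.1 hw
        obtain ⟨h3, h4⟩ := mem_product.1 h1
        obtain ⟨h5, h6⟩ := mem_product.1 h2
        have e1 := dvd_sub (mem_filter.1 h3).2 (mem_filter.1 h4).2
        have e2 := dvd_sub (mem_filter.1 h5).2 (mem_filter.1 h6).2
        rw [sub_sub_sub_cancel_right] at e1 e2
        push_cast
        rw [mul_comm (D0 : ZMod n)]
        exact mul_dvd_mul e1 e2) hdec j
    refine ⟨fun k => (w k).1.1, fun k => (w k).1.2, fun k => (w k).2.1, fun k => (w k).2.2, ?_, hw2⟩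
    intro k
    obtain ⟨h1, h2⟩ := mem_product.1 (hw1 k)
    obtain ⟨h3, h4⟩ := mem_product.1 h1
    obtain ⟨h5, h6⟩ := mem_product.1 h2
    exact ⟨(mem_filter.1 h3).1, (mem_filter.1 h4).1, (mem_filter.1 h5).1, (mem_filter.1 h6).1⟩

/-- Approximate homomorphisms on a finite abelian group are close to homomorphisms. -/
lemma exists_hom_near {G Q : Type*} [AddCommGroup G] [Fintype G] [DecidableEq G] [Group Q]
    (f : G → Q) (bad : ℕ) (hbad : #{x : G × G | f x.1 * f x.2 ≠ f (x.1 + x.2)} = bad)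
    (h10 : 10 * bad ≤ Fintype.card G ^ 2) :
    ∃ φ : G → Q, (∀ s t, φ (s + t) = φ s * φ t) ∧
      4 * (Fintype.card G * #{s : G | f s ≠ φ s}) ≤ 5 * bad := by
  set N := Fintype.card G with hN
  have hNpos : 0 < N := Fintype.card_pos
  have h1 : ∀ s : G, ∃ t0 : G, N * #{t : G | f (s + t) * (f t)⁻¹ ≠ f (s + t0) * (f t0)⁻¹} ≤ 2 * bad := by
    intro s
    have hpairs : #{x : G × G | f (s + x.1) * (f x.1)⁻¹ ≠ f (s + x.2) * (f x.2)⁻¹} ≤ 2 * bad := by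
      set B := univ.filter (fun x : G × G => f x.1 * f x.2 ≠ f (x.1 + x.2)) with hB
      have hsub : univ.filter (fun x : G × G => f (s + x.1) * (f x.1)⁻¹ ≠ f (s + x.2) * (f x.2)⁻¹) ⊆
          univ.filter (fun x : G × G => (x.1, x.2 - x.1) ∈ B) ∪
            univ.filter (fun x : G × G => (s + x.1, x.2 - x.1) ∈ B) := by
        intro x hx
        by_contra hcon
        rw [mem_union, not_or] at hcon
        simp only [hB, mem_filter, mem_univ, true_and, not_not, ne_eq] at hcon hx
        obtain ⟨e1, e2⟩ := hcon
        rw [add_sub_cancel] at e1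
        rw [show s + x.1 + (x.2 - x.1) = s + x.2 by abel] at e2
        apply hx
        rw [← e1, ← e2]; group
      have hc1 : #(univ.filter (fun x : G × G => (x.1, x.2 - x.1) ∈ B)) ≤ #B :=
        card_le_card_of_injOn (fun x => (x.1, x.2 - x.1)) (fun x hx => (mem_filter.1 hx).2) (by
          rintro ⟨a, b⟩ _ ⟨c, d⟩ _ h
          simp only [Prod.mk.injEq] at h
          obtain ⟨rfl, h⟩ := h
          simpa using h)
      have hc2 : #(univ.filter (fun x : G × G => (s + x.1, x.2 - x.1) ∈ B)) ≤ #B :=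
        card_le_card_of_injOn (fun x => (s + x.1, x.2 - x.1)) (fun x hx => (mem_filter.1 hx).2) (by
          rintro ⟨a, b⟩ _ ⟨c, d⟩ _ h
          simp only [Prod.mk.injEq, add_right_inj] at h
          obtain ⟨rfl, h⟩ := h
          simpa using h)
      have := (card_le_card hsub).trans (card_union_le _ _)
      omega
    obtain ⟨t0, -, ht0⟩ := Finset.exists_min_image (univ : Finset G)
      (fun t0 => #{t : G | f (s + t) * (f t)⁻¹ ≠ f (s + t0) * (f t0)⁻¹}) univ_nonempty
    refine ⟨t0, le_trans ?_ hpairs⟩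
    have hσ : #((univ : Finset G).sigma (fun t1 => univ.filter
        (fun t => f (s + t) * (f t)⁻¹ ≠ f (s + t1) * (f t1)⁻¹))) ≤
        #{x : G × G | f (s + x.1) * (f x.1)⁻¹ ≠ f (s + x.2) * (f x.2)⁻¹} := by
      refine card_le_card_of_injOn (fun x => (x.2, x.1)) ?_ ?_
      · rintro ⟨a, b⟩ hx
        exact mem_filter.2 ⟨mem_univ _, (mem_filter.1 (mem_sigma.1 hx).2).2⟩
      · rintro ⟨a, b⟩ _ ⟨c, d⟩ _ h
        simp only [Prod.mk.injEq] at h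
        obtain ⟨rfl, rfl⟩ := h
        rfl
    refine le_trans ?_ hσ
    rw [card_sigma, hN, ← Finset.card_univ, ← smul_eq_mul]
    exact Finset.card_nsmul_le_sum _ _ _ ht0
  choose t0 ht0 using h1
  set φ : G → Q := fun s => f (s + t0 s) * (f (t0 s))⁻¹ with hφ
  set W : G → Finset G := fun s => univ.filter (fun t => f (s + t) * (f t)⁻¹ ≠ φ s) with hW
  have hWle : ∀ s, 5 * #(W s) ≤ N := by
    intro s
    have : N * #(W s) ≤ 2 * bad := ht0 s
    nlinarith
  have hWn : ∀ s t, t ∉ W s → f (s + t) = φ s * f t := by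
    intro s t ht
    simp only [hW, mem_filter, mem_univ, true_and, not_not, ne_eq] at ht
    rw [← ht]; group
  refine ⟨φ, ?_, ?_⟩
  · intro s s'
    have : ∃ t, t ∉ W s' ∪ ((univ.filter (fun t => s' + t ∈ W s)) ∪ W (s + s')) := by
      by_contra hcon
      push Not at hcon
      have h2 : (univ : Finset G) ⊆ _ := fun t _ => hcon t
      have h3 := (card_le_card h2).trans ((card_union_le _ _).trans
        (Nat.add_le_add_left (card_union_le _ _) _))
      have h4 : #(univ.filter (fun t => s' + t ∈ W s)) ≤ #(W s) :=
        card_le_card_of_injOn (fun t => s' + t) (fun x hx => (mem_filter.1 hx).2)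
          (fun a _ b _ h => by simpa using h)
      rw [card_univ] at h3
      have := hWle s
      have := hWle s'
      have := hWle (s + s')
      omega
    obtain ⟨t, ht⟩ := this
    simp only [mem_union, not_or] at ht
    obtain ⟨a1, a2, a3⟩ := ht
    have b1 := hWn _ _ a1
    have b2 := hWn s (s' + t) (fun h => a2 (mem_filter.2 ⟨mem_univ _, h⟩))
    have b3 := hWn _ _ a3
    rw [add_assoc, b2, b1, ← mul_assoc] at b3
    exact (mul_right_cancel b3).symm
  · -- pairs `(s, t)` with `f s ≠ φ s` and `t ∉ W s` are bad
    have h2 : #((univ.filter (fun s => f s ≠ φ s)).sigma (fun s => univ.filter (fun t => t ∉ W s)))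
        ≤ bad := by
      rw [← hbad]
      refine card_le_card_of_injOn (fun x => (x.1, x.2)) ?_ ?_
      · rintro ⟨s, t⟩ hx
        obtain ⟨hx1, hx2⟩ := mem_sigma.1 hx
        refine mem_filter.2 ⟨mem_univ _, fun h => (mem_filter.1 hx1).2 ?_⟩
        have := hWn s t (mem_filter.1 hx2).2
        rw [← h] at this
        exact mul_right_cancel this
      · rintro ⟨a, b⟩ _ ⟨c, d⟩ _ h
        simpa using h
    rw [card_sigma] at h2
    have h3 : ∀ s, 4 * N ≤ 5 * #(univ.filter (fun t => t ∉ W s)) := by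
      intro s
      have h5 : #(W s) + #(univ.filter (fun t => t ∉ W s)) = N := by
        rw [hN, ← card_compl_add_card (W s), add_comm]
        congr 2
        ext t
        simp
      have := hWle s
      omega
    calc 4 * (N * #{s : G | f s ≠ φ s}) = #{s : G | f s ≠ φ s} • (4 * N) := by
          rw [smul_eq_mul]; ring
      _ ≤ ∑ s ∈ univ.filter (fun s => f s ≠ φ s), 5 * #(univ.filter (fun t => t ∉ W s)) :=
          Finset.card_nsmul_le_sum _ _ _ (fun s _ => h3 s)
      _ = 5 * ∑ s ∈ univ.filter (fun s => f s ≠ φ s), #(univ.filter (fun t => t ∉ W s)) := by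
          rw [Finset.mul_sum]
      _ ≤ _ := by gcongr

lemma pow_mem_Cen {R : Type*} [CommRing R] (p : ℕ) (k : ℕ) {x : SpecialLinearGroup (Fin 2) R}
    (hx : x ∈ Cen (p : R)) : x ^ p ^ k ∈ Cen ((p ^ (k + 1) : ℕ) : R) := by
  obtain ⟨⟨a, ha⟩, ⟨b, hb⟩, ⟨c, hc⟩⟩ := hx
  set B : Matrix (Fin 2) (Fin 2) R := !![c, a; b, 0] with hB
  have hxB : (x : Matrix (Fin 2) (Fin 2) R) =
      algebraMap R _ (x 1 1) + (p : Matrix (Fin 2) (Fin 2) R) * B := by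
    ext i j
    fin_cases i <;> fin_cases j <;>
      simp [hB, Matrix.algebraMap_matrix_apply, Matrix.mul_apply,
        Matrix.natCast_apply, ha, hb]
    linear_combination hc
  have h1 : (p : Polynomial R) ∣ (Polynomial.C (x 1 1) + (p : Polynomial R) * Polynomial.X) -
      Polynomial.C (x 1 1) := ⟨Polynomial.X, by ring⟩
  obtain ⟨r, hr⟩ := dvd_sub_pow_of_dvd_sub h1 k
  have h2 := congrArg (Polynomial.aeval B) hr
  simp only [map_sub, map_pow, map_add, map_mul, Polynomial.aeval_C, Polynomial.aeval_X,
    map_natCast] at h2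
  rw [← hxB, sub_eq_iff_eq_add] at h2
  have h3 : ∀ i j, (x ^ p ^ k) i j = (((p : Matrix (Fin 2) (Fin 2) R) ^ (k + 1)) *
      Polynomial.aeval B r + algebraMap R _ (x 1 1) ^ p ^ k) i j := by
    intro i j
    rw [← h2]
    exact congrFun (congrFun (Matrix.SpecialLinearGroup.coe_pow x _) i) j
  have h4 : ∀ i j, (((p : Matrix (Fin 2) (Fin 2) R) ^ (k + 1)) * Polynomial.aeval B r) i j =
      ((p ^ (k + 1) : ℕ) : R) * (Polynomial.aeval B r) i j := by
    intro i j
    rw [← Nat.cast_pow, ← nsmul_eq_mul, Matrix.smul_apply, nsmul_eq_mul]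
  rw [mem_Cen, h3, h3, h3, h3, ← map_pow]
  simp only [Matrix.add_apply, h4]
  refine ⟨⟨Polynomial.aeval B r 0 1, ?_⟩, ⟨Polynomial.aeval B r 1 0, ?_⟩,
    ⟨Polynomial.aeval B r 0 0 - Polynomial.aeval B r 1 1, ?_⟩⟩
  · simp [Matrix.algebraMap_matrix_apply]
  · simp [Matrix.algebraMap_matrix_apply]
  · simp [Matrix.algebraMap_matrix_apply]; ring

lemma card_quotient_Cen_le {d p : ℕ} [NeZero d] (hpd : p ∣ d) :
    Fintype.card (SpecialLinearGroup (Fin 2) (ZMod d) ⧸ Cen (p : ZMod d)) ≤ p ^ 3 := by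
  have : NeZero p := ⟨fun h0 => NeZero.ne d (by simpa [h0] using hpd)⟩
  refine le_trans ?_ (card_SL_le p)
  refine Fintype.card_le_of_injective (fun x => red hpd x.out) ?_
  intro x y hxy
  simp only at hxy
  rw [← QuotientGroup.out_eq' x, ← QuotientGroup.out_eq' y, QuotientGroup.eq]
  have : red hpd (x.out⁻¹ * y.out) = 1 := by rw [map_mul, map_inv, hxy, inv_mul_cancel]
  rw [mem_Cen, natCast_dvd_iff hpd, natCast_dvd_iff hpd, natCast_dvd_iff hpd, map_sub,
    ← red_apply, ← red_apply, ← red_apply, ← red_apply, this]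
  simp

lemma card_range_le {d p l q : ℕ} [NeZero d] [NeZero q] (hp : p.Prime) (hpl : p ^ l ∣ d)
    (hpd : p ∣ d) (hpq : ¬ p ∣ q)
    (φ : ZMod q → SpecialLinearGroup (Fin 2) (ZMod d) ⧸ Cen ((p ^ l : ℕ) : ZMod d))
    (hφ : ∀ s t, φ (s + t) = φ s * φ t) : #(univ.image φ) ≤ p ^ 3 := by
  have h0 : φ 0 = 1 := by
    have := hφ 0 0
    rw [add_zero] at this
    exact left_eq_mul.1 this
  have hn : ∀ (k : ℕ) t, φ (k • t) = φ t ^ k := by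
    intro k t
    induction k with
    | zero => simp [h0]
    | succ k ih => rw [succ_nsmul, hφ, ih, pow_succ]
  have hker : ∀ t, (φ t).out ∈ Cen (p : ZMod d) → φ t = 1 := by
    intro t ht
    have h1 := pow_mem_Cen p l ht
    have h2 : (φ t) ^ p ^ l = 1 := by
      rw [← QuotientGroup.out_eq' (φ t), ← QuotientGroup.mk_pow, QuotientGroup.eq_one_iff]
      refine Cen_mono ?_ h1
      exact Nat.cast_dvd_cast (pow_dvd_pow _ (Nat.le_succ _))
    have h3 : (φ t) ^ q = 1 := by
      rw [← hn]; simp [h0]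
    have hc : Nat.Coprime (p ^ l) q := Nat.Coprime.pow_left _ ((Nat.Prime.coprime_iff_not_dvd hp).2 hpq)
    have := Nat.dvd_gcd (orderOf_dvd_of_pow_eq_one h2) (orderOf_dvd_of_pow_eq_one h3)
    rw [hc] at this
    exact orderOf_eq_one_iff.1 (Nat.dvd_one.1 this)
  refine le_trans ?_ (card_quotient_Cen_le hpd)
  rw [← card_univ]
  refine card_le_card_of_injOn (fun x => ((x.out : SpecialLinearGroup (Fin 2) (ZMod d)) :
    SpecialLinearGroup (Fin 2) (ZMod d) ⧸ Cen (p : ZMod d))) (fun _ _ => mem_univ _) ?_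
  intro x hx y hy hxy
  obtain ⟨s, -, rfl⟩ := mem_image.1 hx
  obtain ⟨t, -, rfl⟩ := mem_image.1 hy
  simp only [QuotientGroup.eq] at hxy
  have hneg : φ (-s) = (φ s)⁻¹ := by
    rw [eq_inv_iff_mul_eq_one, ← hφ, neg_add_cancel, h0]
  have h5 : φ (-s + t) = 1 := by
    rcases Nat.eq_zero_or_pos l with rfl | hl
    · rw [← QuotientGroup.out_eq' (φ (-s + t)), QuotientGroup.eq_one_iff]
      simp [mem_Cen]
    · apply hker
      have e : (φ (-s + t)) = (((φ s).out⁻¹ * (φ t).out :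
          SpecialLinearGroup (Fin 2) (ZMod d)) : _ ⧸ Cen ((p ^ l : ℕ) : ZMod d)) := by
        rw [hφ, hneg, QuotientGroup.mk_mul, QuotientGroup.mk_inv, QuotientGroup.out_eq',
          QuotientGroup.out_eq']
      have e2 : (((φ (-s + t)).out : SpecialLinearGroup (Fin 2) (ZMod d)) :
          _ ⧸ Cen ((p ^ l : ℕ) : ZMod d)) = (((φ s).out⁻¹ * (φ t).out :
          SpecialLinearGroup (Fin 2) (ZMod d)) : _ ⧸ Cen ((p ^ l : ℕ) : ZMod d)) := by
        rw [QuotientGroup.out_eq', e]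
      have e3 := Cen_mono (Nat.cast_dvd_cast (dvd_pow_self p hl.ne')) (QuotientGroup.eq.1 e2)
      have := mul_mem hxy (inv_mem e3)
      simpa [mul_assoc] using this
  rw [hφ, hneg, inv_mul_eq_one] at h5
  exact h5

lemma card_inv_mul_pow_le {G : Type*} [Group G] [DecidableEq G] {A : Finset G} {K : ℕ}
    (hne : A.Nonempty) (hA : #(A ^ 3) ≤ K * #A) (k : ℕ) : #((A⁻¹ * A) ^ k) ≤ K ^ (6 * k) * #A := by
  have hK : 1 ≤ K := by
    rcases Nat.eq_zero_or_pos K with rfl | h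
    · have : 0 < #(A ^ 3) := (hne.pow (n := 3)).card_pos
      omega
    · exact h
  have hlist : ∀ k : ℕ, ((List.finRange (2 * k)).map
      (fun i : Fin (2 * k) => A ^ ((-1 : ℤ) ^ ((i : ℕ) + 1)))).prod = (A⁻¹ * A) ^ k := by
    intro k
    induction k with
    | zero => simp
    | succ k ih =>
      rw [show 2 * (k + 1) = 2 * k + 1 + 1 by ring, List.finRange_succ, List.finRange_succ]
      simp only [List.map_cons, List.map_map, List.prod_cons, Fin.val_zero]
      rw [pow_succ' (A⁻¹ * A), ← ih]
      have : ((fun i : Fin (2 * k + 1 + 1) => A ^ ((-1 : ℤ) ^ ((i : ℕ) + 1))) ∘ Fin.succ ∘ Fin.succ) =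
        (fun i : Fin (2 * k) => A ^ ((-1 : ℤ) ^ ((i : ℕ) + 1))) := by
        funext i
        simp [pow_succ]
      rw [this]
      simp [mul_assoc]
  have hbig : ∀ k, 2 ≤ k → #((A⁻¹ * A) ^ k) ≤ K ^ (6 * k) * #A := by
    intro k hk
    have h1 := Finset.small_alternating_pow_of_small_tripling (A := A) (K := (K : ℝ)) (m := 2 * k)
      (by omega) (by exact_mod_cast hA) (fun i => (-1 : ℤ) ^ ((i : ℕ) + 1)) (fun i => by simp)
    rw [hlist] at h1
    have h2 : #((A⁻¹ * A) ^ k) ≤ K ^ (3 * (2 * k - 2)) * #A := by exact_mod_cast h1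
    exact h2.trans (Nat.mul_le_mul_right _ (Nat.pow_le_pow_right hK (by omega)))
  obtain ⟨a, ha⟩ := hne
  have h1B : (1 : G) ∈ A⁻¹ * A := mem_mul.2 ⟨a⁻¹, inv_mem_inv ha, a, ha, inv_mul_cancel a⟩
  rcases Nat.lt_or_ge k 2 with hk | hk
  · interval_cases k
    · simpa using card_pos.2 ⟨a, ha⟩
    · have h1 : #(A⁻¹ * A) ≤ #(A * A⁻¹ * A) := by
        refine card_le_card_of_injOn (fun x => a * x) (fun x hx => ?_) (fun x _ y _ h => by simpa using h)
        obtain ⟨y, hy, z, hz, rfl⟩ := mem_mul.1 hx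
        have := mul_mem_mul (mul_mem_mul ha hy) hz
        rwa [mul_assoc a y z] at this
      have h2 := Finset.small_alternating_pow_of_small_tripling (A := A) (K := (K : ℝ)) (m := 3)
        (by omega) (by exact_mod_cast hA) (fun i => (-1 : ℤ) ^ (i : ℕ)) (fun i => by simp)
      have h3 : ((List.finRange 3).map (fun i : Fin 3 => A ^ ((-1 : ℤ) ^ (i : ℕ)))).prod =
          A * A⁻¹ * A := by
        simp [List.finRange_succ, mul_assoc]
      rw [h3] at h2
      have h4 : #(A * A⁻¹ * A) ≤ K ^ 3 * #A := by exact_mod_cast h2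
      rw [pow_one]
      exact (h1.trans h4).trans (Nat.mul_le_mul_right _ (Nat.pow_le_pow_right hK (by omega)))
  · exact hbig k hk

/-- Averaging over translates: a large set contains a large part of some translate of
any subgroup, hence its quotient set is dense in every subgroup. -/
lemma card_le_mul_card_hom {G M : Type*} [Group G] [Fintype G] [DecidableEq G] [Group M] [Fintype M]
    (f : M →* G) {A : Finset G} {E N : ℕ} (hN : 0 < N) (hG : Fintype.card G ≤ N) (hA : N ≤ #A * E) :
    Fintype.card M ≤ #{t : M | f t ∈ A⁻¹ * A} * E := by
  have h1 : ∑ g : G, #{t : M | g * f t ∈ A} = Fintype.card M * #A := by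
    simp_rw [Finset.card_filter]
    rw [Finset.sum_comm]
    have : ∀ t : M, ∑ g : G, (if g * f t ∈ A then 1 else 0) = #A := by
      intro t
      rw [← Finset.card_filter]
      refine card_bij (fun g _ => g * f t) (fun g hg => (mem_filter.1 hg).2)
        (fun g _ g' _ h => by simpa using h) (fun a ha => ⟨a * (f t)⁻¹, by simp [ha], by simp⟩)
    rw [Finset.sum_congr rfl (fun t _ => this t), sum_const, card_univ, smul_eq_mul]
  have h2 : ∀ g : G, #{t : M | g * f t ∈ A} ≤ #{t : M | f t ∈ A⁻¹ * A} := by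
    intro g
    rcases (univ.filter (fun t : M => g * f t ∈ A)).eq_empty_or_nonempty with he | ⟨t0, ht0⟩
    · rw [he]; simp
    · refine card_le_card_of_injOn (fun t => t0⁻¹ * t) (fun t ht => ?_)
        (fun x _ y _ h => by simpa using h)
      refine mem_filter.2 ⟨mem_univ _, mem_mul.2 ⟨(g * f t0)⁻¹, inv_mem_inv (mem_filter.1 ht0).2,
        g * f t, (mem_filter.1 ht).2, ?_⟩⟩
      rw [map_mul, map_inv]; group
  have h3 : Fintype.card M * #A ≤ N * #{t : M | f t ∈ A⁻¹ * A} := by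
    rw [← h1]
    refine (Finset.sum_le_card_nsmul _ _ _ (fun g _ => h2 g)).trans ?_
    rw [card_univ, smul_eq_mul]
    exact Nat.mul_le_mul_right _ hG
  refine Nat.le_of_mul_le_mul_left (c := N) ?_ hN
  calc N * Fintype.card M ≤ (#A * E) * Fintype.card M := Nat.mul_le_mul_right _ hA
    _ = (Fintype.card M * #A) * E := by ring
    _ ≤ _ := by rw [← mul_assoc]; exact Nat.mul_le_mul_right _ h3

section fibre
variable {G H : Type*} [Group G] [Group H] [DecidableEq G] [DecidableEq H]

lemma inv_inv_mul_self (A : Finset (G × H)) : (A⁻¹ * A)⁻¹ = A⁻¹ * A := by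
  rw [_root_.mul_inv_rev, inv_inv]

lemma card_snd_fibre_mul_le [Fintype H] {A : Finset (G × H)} (hne : A.Nonempty) (k : ℕ) :
    #{h : H | ((1 : G), h) ∈ (A⁻¹ * A) ^ k} * #(A.image Prod.fst) ≤ #((A⁻¹ * A) ^ (k + 1)) := by
  obtain ⟨a0, ha0⟩ := hne
  have hch : ∀ g : G, ∃ a : G × H, g ∈ A.image Prod.fst → a ∈ A ∧ a.1 = g := by
    intro g
    by_cases hg : g ∈ A.image Prod.fst
    · obtain ⟨a, ha, rfl⟩ := mem_image.1 hg
      exact ⟨a, fun _ => ⟨ha, rfl⟩⟩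
    · exact ⟨a0, fun h => absurd h hg⟩
  choose s hs using hch
  rw [← card_product]
  refine card_le_card_of_injOn (fun x => ((1 : G), x.1) * (a0⁻¹ * s x.2)) ?_ ?_
  · rintro ⟨h, g⟩ hx
    obtain ⟨h1, h2⟩ := mem_product.1 hx
    rw [Finset.mem_coe, pow_succ]
    exact mul_mem_mul (mem_filter.1 h1).2 (mul_mem_mul (inv_mem_inv ha0) (hs g h2).1)
  · rintro ⟨h, g⟩ hx ⟨h', g'⟩ hx' heq
    simp only [Finset.mem_coe, mem_product] at hx hx'
    have e1 := congrArg Prod.fst heq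
    simp only [Prod.fst_mul, one_mul, Prod.fst_inv, mul_right_inj] at e1
    rw [(hs g hx.2).2, (hs g' hx'.2).2] at e1
    subst e1
    have e2 := congrArg Prod.snd heq
    simp only [Prod.snd_mul, mul_left_inj] at e2
    simp only [e2]

/-- Conjugating an element of the fibre over `1` by the set. -/
lemma card_image_snd_le [Fintype H] {A : Finset (G × H)} (hne : A.Nonempty) {k : ℕ} {h : H}
    (hh : ((1 : G), h) ∈ (A⁻¹ * A) ^ k) :
    #(A.image Prod.snd) ≤
      #{M : H | M * h = h * M} * #{h : H | ((1 : G), h) ∈ (A⁻¹ * A) ^ (k + 2)} := by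
  obtain ⟨a0, ha0⟩ := hne
  rw [mul_comm]
  refine (Finset.card_le_mul_card_image_of_maps_to (t := univ.filter fun h : H => ((1 : G), h) ∈ (A⁻¹ * A) ^ (k + 2))
    (f := fun c => (a0.2⁻¹ * c)⁻¹ * h * (a0.2⁻¹ * c)) ?_ #{M : H | M * h = h * M} ?_).trans
      (le_of_eq (mul_comm _ _))
  · intro c hc
    obtain ⟨a, ha, rfl⟩ := mem_image.1 hc
    refine mem_filter.2 ⟨mem_univ _, ?_⟩
    have hb : a0⁻¹ * a ∈ A⁻¹ * A := mul_mem_mul (inv_mem_inv ha0) ha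
    have hb' : (a0⁻¹ * a)⁻¹ ∈ A⁻¹ * A := by
      rw [← inv_inv_mul_self]; exact inv_mem_inv hb
    have := mul_mem_mul (mul_mem_mul hb' hh) hb
    rw [← pow_succ', ← pow_succ] at this
    convert this using 1
    ext <;> simp
  · intro y hy
    rcases ((A.image Prod.snd).filter fun c => (a0.2⁻¹ * c)⁻¹ * h * (a0.2⁻¹ * c) = y).eq_empty_or_nonempty
      with he | ⟨c0, hc0⟩
    · rw [he]; simp
    · refine card_le_card_of_injOn (fun c => a0.2⁻¹ * c * (a0.2⁻¹ * c0)⁻¹) ?_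
        (fun x _ y _ h => by simpa using h)
      intro c hc
      have e1 := (mem_filter.1 hc).2
      have e2 := (mem_filter.1 hc0).2
      refine mem_filter.2 ⟨mem_univ _, ?_⟩
      have e3 : h * (a0.2⁻¹ * c) = (a0.2⁻¹ * c) * y := by rw [← e1]; group
      have e4 : y * (a0.2⁻¹ * c0)⁻¹ = (a0.2⁻¹ * c0)⁻¹ * h := by rw [← e2]; group
      rw [mul_assoc _ _ h, ← e4, ← mul_assoc, ← e3, mul_assoc]

end fibre

lemma card_pow_three_le {q d E : ℕ} [NeZero q] [NeZero d]
    {A : Finset (SpecialLinearGroup (Fin 2) (ZMod q) × SpecialLinearGroup (Fin 2) (ZMod d))}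
    (hE : 2 * #d.divisors ≤ E)
    (hA : ∀ x ∈ A ^ 3, ∀ x' ∈ A ^ 3, x.1 = x'.1 → NearCentral E (x.2⁻¹ * x'.2)) :
    #(A ^ 3) ≤ q ^ 3 * E ^ 5 := by
  have hnc := card_nearCentral_le d E
  refine (Finset.card_le_mul_card_image_of_maps_to (t := univ) (f := Prod.fst) (fun _ _ => mem_univ _)
    (E ^ 5) ?_).trans ?_
  · intro y _
    rcases ((A ^ 3).filter fun x => x.1 = y).eq_empty_or_nonempty with he | ⟨x0, hx0⟩
    · rw [he]; simp
    · refine (card_le_card_of_injOn (t := univ.filter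
        fun h : SpecialLinearGroup (Fin 2) (ZMod d) => NearCentral E h)
        (fun x => x0.2⁻¹ * x.2) (fun x hx => ?_) ?_).trans (hnc.trans ?_)
      · refine mem_filter.2 ⟨mem_univ _, hA _ (mem_filter.1 hx0).1 _ (mem_filter.1 hx).1 ?_⟩
        rw [(mem_filter.1 hx0).2, (mem_filter.1 hx).2]
      · intro x hx x' hx' h
        refine Prod.ext ?_ (by simpa using h)
        rw [(mem_filter.1 hx).2, (mem_filter.1 hx').2]
      · calc 2 * #d.divisors ^ 2 * E ^ 3 ≤ (2 * #d.divisors) ^ 2 * E ^ 3 :=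
            Nat.mul_le_mul_right _ (by nlinarith)
          _ ≤ E ^ 2 * E ^ 3 := Nat.mul_le_mul_right _ (Nat.pow_le_pow_left hE 2)
          _ = E ^ 5 := by ring
  · rw [card_univ, mul_comm]
    exact Nat.mul_le_mul_right _ (card_SL_le q)

lemma nearCentral_of_mem_pow {q d E : ℕ} [NeZero q] [NeZero d]
    {A : Finset (SpecialLinearGroup (Fin 2) (ZMod q) × SpecialLinearGroup (Fin 2) (ZMod d))}
    (hne : A.Nonempty) (hE : 2 * #d.divisors ≤ E)
    (h1 : q ^ 3 ≤ #(A.image Prod.fst) * E) (h2 : d ^ 3 ≤ #(A.image Prod.snd) * E)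
    (hA : ∀ x ∈ A ^ 3, ∀ x' ∈ A ^ 3, x.1 = x'.1 → NearCentral E (x.2⁻¹ * x'.2))
    {k : ℕ} {h : SpecialLinearGroup (Fin 2) (ZMod d)} (hh : (1, h) ∈ (A⁻¹ * A) ^ k) :
    NearCentral (E ^ (36 * k + 115)) h := by
  have hA3 := card_pow_three_le hE hA
  have hfst : #(A.image Prod.fst) ≤ #A := card_image_le
  have hE1 : 1 ≤ E := by
    have : 0 < #d.divisors := card_pos.2 ⟨1, Nat.one_mem_divisors.2 (NeZero.ne d)⟩
    omega
  have hK : #(A ^ 3) ≤ E ^ 6 * #A := by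
    calc #(A ^ 3) ≤ q ^ 3 * E ^ 5 := hA3
      _ ≤ (#A * E) * E ^ 5 := Nat.mul_le_mul_right _ (h1.trans (Nat.mul_le_mul_right _ hfst))
      _ = _ := by ring
  have hAle : #A ≤ #(A ^ 3) := card_le_card_pow (by norm_num)
  have hB := card_inv_mul_pow_le hne hK (k + 3)
  have hF := card_snd_fibre_mul_le hne (k + 2)
  have hC := card_image_snd_le hne hh
  set C := #{M : SpecialLinearGroup (Fin 2) (ZMod d) | M * h = h * M}
  set F := #{h : SpecialLinearGroup (Fin 2) (ZMod d) |
    ((1 : SpecialLinearGroup (Fin 2) (ZMod q)), h) ∈ (A⁻¹ * A) ^ (k + 2)}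
  set A1 := #(A.image Prod.fst)
  have hA1 : 0 < A1 := card_pos.2 (hne.image _)
  refine nearCentral_of_centralizer h (Nat.le_of_mul_le_mul_left (c := A1) ?_ hA1)
  calc A1 * d ^ 3 ≤ A1 * ((C * F) * E) :=
        Nat.mul_le_mul_left _ (h2.trans (Nat.mul_le_mul_right _ hC))
    _ = (F * A1) * (C * E) := by ring
    _ ≤ ((E ^ 6) ^ (6 * (k + 3)) * #A) * (C * E) := Nat.mul_le_mul_right _ (hF.trans hB)
    _ ≤ ((E ^ 6) ^ (6 * (k + 3)) * ((A1 * E) * E ^ 5)) * (C * E) := by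
        refine Nat.mul_le_mul_right _ (Nat.mul_le_mul_left _ (hAle.trans (hA3.trans ?_)))
        exact Nat.mul_le_mul_right _ h1
    _ = A1 * (E ^ (36 * k + 115) * C) := by
        rw [← pow_mul]; ring

section unipotent
variable {R : Type*} [CommRing R]

/-- Upper unipotent elements. -/
def upper : Multiplicative R →* SpecialLinearGroup (Fin 2) R where
  toFun t := ⟨!![1, t.toAdd; 0, 1], by simp [Matrix.det_fin_two]⟩
  map_one' := SL_ext (by simp) (by simp) (by simp) (by simp)
  map_mul' s t := by
    refine Subtype.ext (show (!![1, (s * t).toAdd; 0, 1] : Matrix (Fin 2) (Fin 2) R) = !![1, s.toAdd; 0, 1] * !![1, t.toAdd; 0, 1] from ?_)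
    simp [add_comm]

/-- Lower unipotent elements. -/
def lower : Multiplicative R →* SpecialLinearGroup (Fin 2) R where
  toFun t := ⟨!![1, 0; t.toAdd, 1], by simp [Matrix.det_fin_two]⟩
  map_one' := SL_ext (by simp) (by simp) (by simp) (by simp)
  map_mul' s t := by
    refine Subtype.ext (show (!![1, 0; (s * t).toAdd, 1] : Matrix (Fin 2) (Fin 2) R) = !![1, 0; s.toAdd, 1] * !![1, 0; t.toAdd, 1] from ?_)
    simp

/-- Diagonal elements. -/
def diag : Rˣ →* SpecialLinearGroup (Fin 2) R where
  toFun l := ⟨!![(l : R), 0; 0, ((l⁻¹ : Rˣ) : R)], by simp [Matrix.det_fin_two]⟩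
  map_one' := SL_ext (by simp) (by simp) (by simp) (by simp)
  map_mul' s t := by
    refine Subtype.ext (show (!![((s * t : Rˣ) : R), 0; 0, (((s * t)⁻¹ : Rˣ) : R)] : Matrix (Fin 2) (Fin 2) R) = !![(s : R), 0; 0, ((s⁻¹ : Rˣ) : R)] * !![(t : R), 0; 0, ((t⁻¹ : Rˣ) : R)] from ?_)
    simp [mul_comm]

lemma coe_upper (t : R) : (upper (.ofAdd t) : Matrix (Fin 2) (Fin 2) R) = !![1, t; 0, 1] := rfl

lemma coe_lower (t : R) : (lower (.ofAdd t) : Matrix (Fin 2) (Fin 2) R) = !![1, 0; t, 1] := rfl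

lemma coe_diag (l : Rˣ) :
    (diag l : Matrix (Fin 2) (Fin 2) R) = !![(l : R), 0; 0, ((l⁻¹ : Rˣ) : R)] := rfl

lemma diag_conj_upper (l : Rˣ) (t : R) :
    diag l * upper (.ofAdd t) * (diag l)⁻¹ = upper (.ofAdd ((l : R) ^ 2 * t)) := by
  rw [mul_inv_eq_iff_eq_mul]
  have h := l.mul_inv
  apply SL_ext <;> rw [SL_mul, SL_mul, coe_diag, coe_upper, coe_upper] <;> simp
  linear_combination (-(l : R) * t) * h

lemma diag_conj_lower (l : Rˣ) (t : R) :
    (diag l)⁻¹ * lower (.ofAdd t) * diag l = lower (.ofAdd ((l : R) ^ 2 * t)) := by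
  rw [mul_assoc, inv_mul_eq_iff_eq_mul]
  have h := l.mul_inv
  apply SL_ext <;> rw [SL_mul, SL_mul, coe_diag, coe_lower, coe_lower] <;> simp
  linear_combination (-(l : R) * t) * h

end unipotent

lemma pow_ofFn_mem {G : Type*} [Group G] [DecidableEq G] {B : Finset G} {r n : ℕ} (f : Fin n → G)
    (hf : ∀ i, f i ∈ B ^ r) : (List.ofFn f).prod ∈ B ^ (r * n) := by
  induction n with
  | zero => simp
  | succ n ih =>
    rw [List.ofFn_succ, List.prod_cons, Nat.mul_succ, add_comm, pow_add]
    exact mul_mem_mul (hf 0) (ih _ fun i => hf _)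

lemma mem_pow_of_sum {R G : Type*} [CommRing R] [Group G] [DecidableEq G] {B : Finset G}
    (hinv : B⁻¹ = B) (u : Multiplicative R →* G) (c : Rˣ →* G)
    (hconj : ∀ (l : Rˣ) (t : R), c l * u (.ofAdd t) * (c l)⁻¹ = u (.ofAdd ((l : R) ^ 2 * t)))
    {S : Finset R} (hS : ∀ t ∈ S, u (.ofAdd t) ∈ B) {L : Finset Rˣ} (hL : ∀ l ∈ L, c l ∈ B)
    {m : ℕ} {x : R} (h : ∃ (l l' : Fin m → Rˣ) (s s' : Fin m → R),
      (∀ k, l k ∈ L ∧ l' k ∈ L ∧ s k ∈ S ∧ s' k ∈ S) ∧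
      ∑ k, ((l k : R) ^ 2 - (l' k : R) ^ 2) * (s k - s' k) = x) :
    u (.ofAdd x) ∈ B ^ (8 * m) := by
  obtain ⟨l, l', s, s', hmem, rfl⟩ := h
  have hBi : ∀ {x}, x ∈ B → x⁻¹ ∈ B := fun {x} hx => by rw [← hinv]; exact inv_mem_inv hx
  have hprod : u (.ofAdd (∑ k, ((l k : R) ^ 2 - (l' k : R) ^ 2) * (s k - s' k))) = (List.ofFn fun k =>
      u (.ofAdd (((l k : R) ^ 2 - (l' k : R) ^ 2) * (s k - s' k)))).prod := by
    rw [ofAdd_sum, ← List.prod_ofFn, map_list_prod, List.map_ofFn]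
    rfl
  rw [hprod]
  refine pow_ofFn_mem (r := 8) _ (fun k => ?_)
  have e : u (.ofAdd (((l k : R) ^ 2 - (l' k : R) ^ 2) * (s k - s' k))) =
      c (l k) * u (.ofAdd (s k)) * (u (.ofAdd (s' k)))⁻¹ * (c (l k))⁻¹ *
        c (l' k) * u (.ofAdd (s' k)) * (u (.ofAdd (s k)))⁻¹ * (c (l' k))⁻¹ := by
    have e1 : c (l k) * u (.ofAdd (s k)) * (u (.ofAdd (s' k)))⁻¹ * (c (l k))⁻¹ *
        c (l' k) * u (.ofAdd (s' k)) * (u (.ofAdd (s k)))⁻¹ * (c (l' k))⁻¹ =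
        (c (l k) * u (.ofAdd (s k)) * (c (l k))⁻¹) * (c (l k) * u (.ofAdd (s' k)) * (c (l k))⁻¹)⁻¹ *
        ((c (l' k) * u (.ofAdd (s' k)) * (c (l' k))⁻¹) *
          (c (l' k) * u (.ofAdd (s k)) * (c (l' k))⁻¹)⁻¹) := by group
    rw [e1, hconj, hconj, hconj, hconj, ← map_inv u, ← map_inv u, ← map_mul u, ← map_mul u, ← map_mul u,
      ← ofAdd_neg, ← ofAdd_neg, ← ofAdd_add, ← ofAdd_add, ← ofAdd_add]
    congr 2
    ring
  rw [e]
  obtain ⟨h1, h2, h3, h4⟩ := hmem k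
  simp only [pow_succ, pow_zero, one_mul]
  exact mul_mem_mul (mul_mem_mul (mul_mem_mul (mul_mem_mul (mul_mem_mul (mul_mem_mul (mul_mem_mul
    (hL _ h1) (hS _ h3)) (hBi (hS _ h4))) (hBi (hL _ h1))) (hL _ h2)) (hS _ h4)) (hBi (hS _ h3)))
    (hBi (hL _ h2))

lemma mem_pow_of_fill_aux {n E : ℕ} [NeZero n] {G : Type*} [Group G] [DecidableEq G] {B : Finset G}
    {N : ℕ} (hN : 2 ^ 132 * E ^ 12 ≤ N)
    (hinv : B⁻¹ = B) (u : Multiplicative (ZMod n) →* G) (c : (ZMod n)ˣ →* G)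
    (hconj : ∀ (l : (ZMod n)ˣ) (t : ZMod n),
      c l * u (.ofAdd t) * (c l)⁻¹ = u (.ofAdd ((l : ZMod n) ^ 2 * t)))
    (S : Finset (ZMod n)) (hS : ∀ t ∈ S, u (.ofAdd t) ∈ B) (L : Finset (ZMod n)ˣ)
    (hL : ∀ l ∈ L, c l ∈ B) (hSE : n ≤ #S * E) (hLE : n ≤ #L * E ^ 2) :
    ∃ D, 0 < D ∧ D ≤ N ∧
      ∀ j : ZMod n, u (.ofAdd ((D : ZMod n) * j)) ∈ B ^ (8 * 12) := by
  have h := fill E S hSE L hLE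
  refine Exists.imp (fun D hD => ?_) h
  refine ⟨hD.1, hD.2.1.trans hN, fun j => ?_⟩
  have h2 := hD.2.2 j
  refine mem_pow_of_sum hinv u c hconj hS hL ?_
  exact h2

lemma mem_pow_of_fill {q E : ℕ} [NeZero q] {A : Finset (SpecialLinearGroup (Fin 2) (ZMod q))}
    (hA : q ^ 3 ≤ #A * E) (hq : q ≤ q.totient * E)
    {s N : ℕ} (hs : s = 8 * 12) (hN : 2 ^ 132 * E ^ 12 ≤ N)
    (u : Multiplicative (ZMod q) →* SpecialLinearGroup (Fin 2) (ZMod q))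
    (c : (ZMod q)ˣ →* SpecialLinearGroup (Fin 2) (ZMod q))
    (hconj : ∀ l t, c l * u (.ofAdd t) * (c l)⁻¹ = u (.ofAdd ((l : ZMod q) ^ 2 * t))) :
    ∃ D, 0 < D ∧ D ≤ N ∧
      ∀ j : ZMod q, u (.ofAdd ((D : ZMod q) * j)) ∈ (A⁻¹ * A) ^ s := by
  have hq3 : 0 < q ^ 3 := pow_pos (NeZero.pos q) 3
  have hS := card_le_mul_card_hom u hq3 (card_SL_le q) hA
  have hL := card_le_mul_card_hom c hq3 (card_SL_le q) hA
  have hinv : (A⁻¹ * A)⁻¹ = A⁻¹ * A := by rw [_root_.mul_inv_rev, inv_inv]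
  set B := A⁻¹ * A with hB
  have hSe : #{t : Multiplicative (ZMod q) | u t ∈ B} ≤
      #{t : ZMod q | u (.ofAdd t) ∈ B} :=
    card_le_card_of_injOn Multiplicative.toAdd
      (fun t ht => mem_filter.2 ⟨mem_univ _, (mem_filter.1 ht).2⟩)
      (fun x _ y _ h => Multiplicative.toAdd.injective h)
  rw [Fintype.card_multiplicative, ZMod.card] at hS
  rw [ZMod.card_units_eq_totient] at hL
  have hL' : q ≤ #{l : (ZMod q)ˣ | c l ∈ B} * E ^ 2 := by
    calc q ≤ q.totient * E := hq
      _ ≤ (_ * E) * E := Nat.mul_le_mul_right _ hL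
      _ = _ := by rw [pow_two, mul_assoc]
  rw [hs]
  exact mem_pow_of_fill_aux hN hinv u c hconj _ (fun t ht => (mem_filter.1 ht).2) _
    (fun l hl => (mem_filter.1 hl).2) (hS.trans (Nat.mul_le_mul_right _ hSe)) hL'

lemma card_le_of_mostly_mem {ι : Type*} [Fintype ι] {Q : ι → Type*} [∀ i, Fintype (Q i)]
    (X : Finset (∀ i, Q i)) (I : ∀ i, Finset (Q i)) (a r : ι → ℕ) (N : ℕ)
    (hX : ∀ x ∈ X, ∏ i with x i ∉ I i, a i ≤ N) (ha : ∀ i, Fintype.card (Q i) ≤ a i ^ 3)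
    (hI : ∀ i, #(I i) ≤ r i ^ 3) (hr : ∀ i, 1 ≤ r i) :
    #X ≤ 2 ^ Fintype.card ι * (N ^ 3 * (∏ i, r i) ^ 3) := by
  set PP : Finset (Finset ι) := univ.filter fun P => ∏ i ∈ P, a i ≤ N with hPP
  have hsub : X ⊆ PP.biUnion fun P => Fintype.piFinset fun i => if i ∈ P then univ else I i := by
    intro x hx
    refine mem_biUnion.2 ⟨univ.filter fun i => x i ∉ I i, mem_filter.2 ⟨mem_univ _, hX x hx⟩, ?_⟩
    refine Fintype.mem_piFinset.2 fun i => ?_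
    by_cases h : x i ∈ I i <;> simp [h]
  refine (card_le_card hsub).trans ((card_biUnion_le_card_mul _ _ (N ^ 3 * (∏ i, r i) ^ 3)
    fun P hP => ?_).trans (Nat.mul_le_mul_right _ ?_))
  · rw [Fintype.card_piFinset]
    have hP' := (mem_filter.1 hP).2
    calc ∏ i, #(if i ∈ P then univ else I i) ≤ ∏ i, ((if i ∈ P then a i ^ 3 else 1) * r i ^ 3) := by
          refine prod_le_prod' fun i _ => ?_
          split_ifs with h
          · exact (ha i).trans (Nat.le_mul_of_pos_right _ (pow_pos (hr i) 3))
          · simpa using hI i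
      _ = (∏ i ∈ P, a i) ^ 3 * (∏ i, r i) ^ 3 := by
          rw [prod_mul_distrib, prod_ite_mem, univ_inter, prod_pow, prod_pow]
      _ ≤ _ := Nat.mul_le_mul_right _ (Nat.pow_le_pow_left hP' 3)
  · exact (card_le_univ _).trans (by simp)

/-- Weighted families of approximate homomorphisms are mostly close to homomorphisms. -/
lemma exists_typical {ι J : Type*} [Fintype ι] [AddCommGroup J] [Fintype J] {Q : ι → Type*}
    [∀ i, Group (Q i)] [∀ i, Fintype (Q i)] (F : ∀ i, J → Q i) (w : ι → ℝ) (hw : ∀ i, 0 ≤ w i)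
    {W : ℝ} (hW : 0 < W) (hF : ∀ s t, ∑ i with F i s * F i t ≠ F i (s + t), w i ≤ W) :
    ∃ (φ : ∀ i, J → Q i) (T : Finset J), (∀ i s t, φ i (s + t) = φ i s * φ i t) ∧
      Fintype.card J < 2 * #T ∧ ∀ j ∈ T, ∑ i with F i j ≠ φ i j, w i ≤ 13 * W := by
  set n : ℝ := (Fintype.card J : ℝ) with hn
  have hn0 : 0 < n := by rw [hn]; exact_mod_cast Fintype.card_pos
  set bad : ι → ℕ := fun i => #{x : J × J | F i x.1 * F i x.2 ≠ F i (x.1 + x.2)} with hbad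
  have hex : ∀ i, ∃ φ : J → Q i, (∀ s t, φ (s + t) = φ s * φ t) ∧
      (10 * bad i ≤ Fintype.card J ^ 2 →
        4 * (Fintype.card J * #{s | F i s ≠ φ s}) ≤ 5 * bad i) := by
    intro i
    by_cases h : 10 * bad i ≤ Fintype.card J ^ 2
    · obtain ⟨φ, h1, h2⟩ := exists_hom_near (F i) (bad i) rfl h
      exact ⟨φ, h1, fun _ => h2⟩
    · exact ⟨fun _ => 1, by simp, fun h' => absurd h' h⟩
  choose φ hφ hφ2 using hex
  have hsum : ∑ i, w i * bad i ≤ W * n ^ 2 := by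
    calc ∑ i, w i * bad i = ∑ i, ∑ x : J × J, (if F i x.1 * F i x.2 ≠ F i (x.1 + x.2) then w i else 0) := by
          refine sum_congr rfl fun i _ => ?_
          rw [← sum_filter, sum_const, nsmul_eq_mul, mul_comm]
      _ = ∑ x : J × J, ∑ i with F i x.1 * F i x.2 ≠ F i (x.1 + x.2), w i := by
          rw [sum_comm]
          exact sum_congr rfl fun x _ => by rw [sum_filter]
      _ ≤ ∑ x : J × J, W := sum_le_sum fun x _ => hF _ _
      _ = W * n ^ 2 := by
          rw [sum_const, card_univ, Fintype.card_prod, nsmul_eq_mul]; push_cast; rw [← hn]; ring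
  set good : Finset ι := univ.filter fun i => 10 * bad i ≤ Fintype.card J ^ 2 with hgood
  have hng : ∑ i with ¬ 10 * bad i ≤ Fintype.card J ^ 2, w i ≤ 10 * W := by
    have : (∑ i with ¬ 10 * bad i ≤ Fintype.card J ^ 2, w i) * n ^ 2 ≤ 10 * W * n ^ 2 := by
      calc _ ≤ ∑ i with ¬ 10 * bad i ≤ Fintype.card J ^ 2, 10 * (w i * bad i) := by
            rw [sum_mul]
            refine sum_le_sum fun i hi => ?_
            have h1 := (mem_filter.1 hi).2
            have h2 : n ^ 2 ≤ 10 * (bad i : ℝ) := by rw [hn]; exact_mod_cast (not_le.1 h1).le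
            nlinarith [hw i]
        _ ≤ ∑ i, 10 * (w i * bad i) :=
            sum_le_sum_of_subset_of_nonneg (filter_subset _ _) fun i _ _ =>
              mul_nonneg (by norm_num) (mul_nonneg (hw i) (Nat.cast_nonneg _))
        _ ≤ _ := by rw [← mul_sum]; nlinarith
    exact le_of_mul_le_mul_right this (by positivity)
  set S : J → ℝ := fun j => ∑ i ∈ good with F i j ≠ φ i j, w i with hS
  have hSsum : 4 * ∑ j, S j ≤ 5 * W * n := by
    have h1 : ∑ j, S j = ∑ i ∈ good, w i * #{s | F i s ≠ φ i s} := by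
      simp only [hS, sum_filter]
      rw [sum_comm]
      refine sum_congr rfl fun i _ => ?_
      rw [← sum_filter, sum_const, nsmul_eq_mul, mul_comm]
    have h2 : 4 * (∑ j, S j) * n ≤ 5 * W * n * n := by
      rw [h1]
      calc _ = ∑ i ∈ good, w i * (4 * (n * #{s | F i s ≠ φ i s})) := by
            rw [mul_sum, sum_mul]; exact sum_congr rfl fun i _ => by ring
        _ ≤ ∑ i ∈ good, w i * (5 * bad i) := by
            refine sum_le_sum fun i hi => mul_le_mul_of_nonneg_left ?_ (hw i)
            have := hφ2 i (mem_filter.1 hi).2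
            rw [hn]; exact_mod_cast this
        _ ≤ ∑ i, w i * (5 * bad i) :=
            sum_le_sum_of_subset_of_nonneg (filter_subset _ _) fun i _ _ =>
              mul_nonneg (hw i) (by positivity)
        _ = 5 * ∑ i, w i * bad i := by rw [mul_sum]; exact sum_congr rfl fun i _ => by ring
        _ ≤ _ := by nlinarith
    exact le_of_mul_le_mul_right h2 hn0
  have hS0 : ∀ j, 0 ≤ S j := fun j => sum_nonneg fun i _ => hw i
  refine ⟨φ, univ.filter fun j => S j ≤ 3 * W, hφ, ?_, fun j hj => ?_⟩
  · have h1 : #{j | S j ≤ 3 * W} + #{j | ¬ S j ≤ 3 * W} = Fintype.card J := by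
      rw [card_filter_add_card_filter_not, card_univ]
    have h2 : 3 * W * (#{j | ¬ S j ≤ 3 * W} : ℝ) ≤ ∑ j, S j := by
      calc _ = ∑ j with ¬ S j ≤ 3 * W, 3 * W := by rw [sum_const, nsmul_eq_mul, mul_comm]
        _ ≤ ∑ j with ¬ S j ≤ 3 * W, S j := sum_le_sum fun j hj => (not_le.1 (mem_filter.1 hj).2).le
        _ ≤ _ := sum_le_sum_of_subset_of_nonneg (filter_subset _ _) fun j _ _ => hS0 j
    have h3 : 12 * (#{j | ¬ S j ≤ 3 * W} : ℝ) ≤ 5 * n := by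
      have : W * (12 * (#{j | ¬ S j ≤ 3 * W} : ℝ)) ≤ W * (5 * n) := by linarith
      exact le_of_mul_le_mul_left this hW
    rw [hn] at h3
    have h4 : 12 * #{j | ¬ S j ≤ 3 * W} ≤ 5 * Fintype.card J := by exact_mod_cast h3
    have h5 : 0 < Fintype.card J := Fintype.card_pos
    omega
  · have hj' := (mem_filter.1 hj).2
    calc ∑ i with F i j ≠ φ i j, w i
        ≤ S j + ∑ i with ¬ 10 * bad i ≤ Fintype.card J ^ 2, w i := by
          rw [← sum_filter_add_sum_filter_not (univ.filter fun i => F i j ≠ φ i j)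
            (fun i => 10 * bad i ≤ Fintype.card J ^ 2)]
          refine add_le_add (le_of_eq (sum_congr ?_ fun _ _ => rfl))
            (sum_le_sum_of_subset_of_nonneg ?_ fun i _ _ => hw i)
          · rw [filter_filter, filter_filter]
            exact filter_congr fun i _ => and_comm
          · exact filter_subset_filter _ (subset_univ _)
      _ ≤ _ := by linarith

lemma NearCentral.prod_le {d b M : ℕ} [NeZero d] (hd : d = b * b) {h : SpecialLinearGroup (Fin 2) (ZMod d)}
    (hh : NearCentral M h) :
    ∏ p ∈ b.primeFactors with h ∉ Cen ((p ^ b.factorization p : ℕ) : ZMod d), p ^ b.factorization p ≤ M := by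
  obtain ⟨m, hm, hdm, hc⟩ := hh
  have hd0 : d ≠ 0 := NeZero.ne d
  have hb0 : b ≠ 0 := by rintro rfl; simp at hd; exact hd0 hd
  have hm0 : 0 < m := Nat.pos_of_dvd_of_pos hm (Nat.pos_of_ne_zero hd0)
  have hdiv : ∏ p ∈ b.primeFactors with h ∉ Cen ((p ^ b.factorization p : ℕ) : ZMod d),
      p ^ b.factorization p ∣ d / m := by
    refine Finset.prod_dvd_of_isRelPrime ?_ (fun p hp => ?_)
    · intro p hp p' hp' hne
      rw [Function.onFun, ← Nat.coprime_iff_isRelPrime]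
      exact Nat.Coprime.pow _ _ ((Nat.coprime_primes
        (Nat.prime_of_mem_primeFactors (mem_filter.1 hp).1)
        (Nat.prime_of_mem_primeFactors (mem_filter.1 hp').1)).2 hne)
    · have hp' := mem_filter.1 hp
      have pp := Nat.prime_of_mem_primeFactors hp'.1
      rw [pp.pow_dvd_iff_le_factorization (Nat.div_pos (Nat.le_of_dvd (Nat.pos_of_ne_zero hd0) hm) hm0).ne',
        Nat.factorization_div hm]
      by_contra hcon
      apply hp'.2
      refine Cen_mono ?_ hc
      refine Nat.cast_dvd_cast ?_
      rw [pp.pow_dvd_iff_le_factorization hm0.ne']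
      have h1 : d.factorization p = b.factorization p + b.factorization p := by
        rw [hd, Nat.factorization_mul hb0 hb0]; rfl
      simp only [Finsupp.coe_tsub, Pi.sub_apply] at hcon
      omega
  have hpos : 0 < d / m := Nat.div_pos (Nat.le_of_dvd (Nat.pos_of_ne_zero hd0) hm) hm0
  refine (Nat.le_of_dvd hpos hdiv).trans ?_
  exact Nat.div_le_of_le_mul (by linarith [mul_comm M m])

lemma natCast_dvd_of_forall_prime_pow {d b : ℕ} [NeZero d] (hb : b ∣ d) {x : ZMod d}
    (hx : ∀ p ∈ b.primeFactors, ((p ^ b.factorization p : ℕ) : ZMod d) ∣ x) : (b : ZMod d) ∣ x := by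
  have hb0 : b ≠ 0 := fun h => NeZero.ne d (by simpa [h] using hb)
  rw [← ZMod.natCast_zmod_val x, natCast_dvd_natCast_iff hb, Nat.dvd_iff_prime_pow_dvd_dvd]
  intro p k pp hk
  rcases Nat.eq_zero_or_pos k with rfl | hk0
  · simp
  have hpb : p ∣ b := (dvd_pow_self p hk0.ne').trans hk
  have := hx p (Nat.mem_primeFactors.2 ⟨pp, hpb, hb0⟩)
  rw [← ZMod.natCast_zmod_val x, natCast_dvd_natCast_iff ((Nat.ordProj_dvd b p).trans hb)] at this
  exact (pow_dvd_pow p ((pp.pow_dvd_iff_le_factorization hb0).1 hk)).trans this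

lemma mem_Cen_of_forall_prime_pow {d b : ℕ} [NeZero d] (hb : b ∣ d)
    {h : SpecialLinearGroup (Fin 2) (ZMod d)}
    (hx : ∀ p ∈ b.primeFactors, h ∈ Cen ((p ^ b.factorization p : ℕ) : ZMod d)) :
    h ∈ Cen (b : ZMod d) :=
  ⟨natCast_dvd_of_forall_prime_pow hb fun p hp => (hx p hp).1,
    natCast_dvd_of_forall_prime_pow hb fun p hp => (hx p hp).2.1,
    natCast_dvd_of_forall_prime_pow hb fun p hp => (hx p hp).2.2⟩

lemma two_pow_card_primeFactors_le {n : ℕ} (hn : n ≠ 0) : 2 ^ #n.primeFactors ≤ #n.divisors := by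
  rw [Nat.card_divisors hn, ← Finset.prod_const]
  refine prod_le_prod' fun p hp => ?_
  have : 0 < n.factorization p :=
    (Nat.prime_of_mem_primeFactors hp).factorization_pos_of_dvd hn (Nat.dvd_of_mem_primeFactors hp)
  omega

lemma prod_filter_notMem_image_le {ι J : Type*} [Fintype ι] [Fintype J] {Q : ι → Type*}
    (F φ : ∀ i, J → Q i) (a : ι → ℕ) (j : J) {N : ℕ} (h : ∏ i with F i j ≠ φ i j, a i ≤ N)
    (ha : ∀ i, 1 ≤ a i) : ∏ i with F i j ∉ univ.image (φ i), a i ≤ N := by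
  refine le_trans (prod_le_prod_of_subset_of_one_le' ?_ fun p _ _ => ha p) h
  intro p hp
  refine mem_filter.2 ⟨mem_univ _, fun h => (mem_filter.1 hp).2 ?_⟩
  exact mem_image.2 ⟨j, mem_univ _, h.symm⟩

lemma card_classes_le {q d b M E : ℕ} [NeZero q] [NeZero d] (hd : d = b * b) (hcop : q.Coprime d)
    (hM : 2 ≤ M) (hτ : 2 * #d.divisors ≤ E) (hrad : ∏ p ∈ d.primeFactors, p ≤ E)
    (f : ZMod q → SpecialLinearGroup (Fin 2) (ZMod d))
    (hf : ∀ s t, NearCentral M (f s * f t * (f (s + t))⁻¹)) :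
    #(univ.image fun j => (f j : SpecialLinearGroup (Fin 2) (ZMod d) ⧸ Cen (b : ZMod d))) ≤
      E ^ 10 * M ^ 81 := by
  have hd0 : d ≠ 0 := NeZero.ne d
  have hb0 : b ≠ 0 := by rintro rfl; simp at hd; exact hd0 hd
  have hbd : b ∣ d := ⟨b, hd⟩
  set m : ℕ → ℕ := fun p => p ^ b.factorization p with hm
  have hmd : ∀ p, m p ∣ d := fun p => (Nat.ordProj_dvd b p).trans hbd
  have hpm : ∀ p : b.primeFactors, 1 ≤ m p := fun p =>
    Nat.pos_of_dvd_of_pos (hmd p) (Nat.pos_of_ne_zero hd0)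
  set F : ∀ p : b.primeFactors, ZMod q → SpecialLinearGroup (Fin 2) (ZMod d) ⧸
    Cen ((m p : ℕ) : ZMod d) := fun p j => (f j : _) with hF
  have hlogM : 0 < Real.log M := Real.log_pos (by exact_mod_cast hM)
  have key : ∀ P : Finset b.primeFactors, ∏ p ∈ P, (m p) = ∏ p ∈ P.map (Function.Embedding.subtype _), m p :=
    fun P => by rw [prod_map]; rfl
  have hw : ∀ P : Finset b.primeFactors,
      ∑ p ∈ P, Real.log (m p) = Real.log ((∏ p ∈ P, m p : ℕ) : ℝ) := by
    intro P
    rw [Nat.cast_prod, Real.log_prod]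
    exact fun p _ => Nat.cast_ne_zero.2 (Nat.one_le_iff_ne_zero.1 (hpm p))
  have hFe : ∀ p s t, F p s * F p t = F p (s + t) ↔
      f s * f t * (f (s + t))⁻¹ ∈ Cen ((m p : ℕ) : ZMod d) := by
    intro p s t
    rw [← mul_inv_eq_one]
    exact QuotientGroup.eq_one_iff (f s * f t * (f (s + t))⁻¹)
  obtain ⟨φ, T, hφ, hT, hTP⟩ := exists_typical F (fun p => Real.log (m p))
    (fun p => Real.log_nonneg (by exact_mod_cast hpm p)) hlogM (by
      intro s t
      rw [hw]
      refine Real.log_le_log (by exact_mod_cast prod_pos fun p _ => hpm p) (by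
        refine Nat.cast_le.2 (le_trans (le_of_eq ?_) ((hf s t).prod_le hd))
        rw [key]
        refine prod_congr ?_ fun _ _ => rfl
        ext p
        simp only [mem_map, mem_filter, mem_univ, true_and, Function.Embedding.coe_subtype,
          Subtype.exists, exists_and_right, exists_eq_right, ne_eq, hFe, exists_prop, m]))
  have hpf : d.primeFactors = b.primeFactors := by
    rw [hd, Nat.primeFactors_mul hb0 hb0, union_self]
  set cls : ZMod q → SpecialLinearGroup (Fin 2) (ZMod d) ⧸ Cen (b : ZMod d) := fun j => (f j : _)
    with hcls
  have hX' : #(T.image fun j => fun p => F p j) ≤ E ^ 4 * M ^ 39 := by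
    refine (card_le_of_mostly_mem _ (fun p => univ.image (φ p)) (fun p => m p) (fun p => (p : ℕ))
      (M ^ 13) ?_ (fun p => card_quotient_Cen_le (hmd p)) (fun p => ?_) (fun p => ?_)).trans ?_
    · intro x hx
      obtain ⟨j, hj, rfl⟩ := mem_image.1 hx
      have h1 := hTP j hj
      rw [hw, show (13 : ℝ) * Real.log M = Real.log ((M ^ 13 : ℕ) : ℝ) by push_cast; rw [Real.log_pow]; norm_num,
        Real.log_le_log_iff (by exact_mod_cast prod_pos fun p _ => hpm p) (by positivity),
        Nat.cast_le] at h1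
      convert prod_filter_notMem_image_le F φ _ j h1 hpm
    · have pp := Nat.prime_of_mem_primeFactors p.2
      have hpd : (p : ℕ) ∣ d := (Nat.dvd_of_mem_primeFactors p.2).trans hbd
      exact card_range_le pp (hmd p) hpd
        (fun hpq => pp.not_dvd_one (by rw [← hcop]; exact Nat.dvd_gcd hpq hpd)) _ (hφ p)
    · exact (Nat.prime_of_mem_primeFactors p.2).one_lt.le
    · have h1 : 2 ^ Fintype.card b.primeFactors ≤ E := by
        rw [Fintype.card_coe, ← hpf]
        have := two_pow_card_primeFactors_le hd0
        omega
      have h2 : ∏ p : b.primeFactors, (p : ℕ) ≤ E := by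
        rw [prod_coe_sort b.primeFactors (fun p => p), ← hpf]; exact hrad
      calc _ ≤ E * ((M ^ 13) ^ 3 * E ^ 3) := by gcongr
        _ = E ^ 4 * M ^ 39 := by ring
  have hX : #(T.image cls) ≤ E ^ 4 * M ^ 39 := by
    refine le_trans (card_le_card_of_injOn (fun x => fun p : b.primeFactors => (x.out : SpecialLinearGroup (Fin 2) (ZMod d) ⧸ Cen ((m p : ℕ) : ZMod d))) ?_ ?_) hX'
    · intro x hx
      obtain ⟨j, hj, rfl⟩ := mem_image.1 (mem_coe.1 hx)
      refine mem_coe.2 (mem_image.2 ⟨j, hj, ?_⟩)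
      funext p
      refine QuotientGroup.eq.2 (Cen_mono (Nat.cast_dvd_cast (Nat.ordProj_dvd b p)) ?_)
      exact QuotientGroup.eq.1 (QuotientGroup.out_eq' (cls j)).symm
    · intro x _ y _ hxy
      rw [← QuotientGroup.out_eq' x, ← QuotientGroup.out_eq' y, QuotientGroup.eq]
      exact mem_Cen_of_forall_prime_pow hbd fun p hp => QuotientGroup.eq.1 (congrFun hxy ⟨p, hp⟩)
  set Z : Finset (SpecialLinearGroup (Fin 2) (ZMod d) ⧸ Cen (b : ZMod d)) :=
    (univ.filter fun h : SpecialLinearGroup (Fin 2) (ZMod d) => NearCentral M h).image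
      (QuotientGroup.mk) with hZ
  have hZc : #Z ≤ E ^ 2 * M ^ 3 := by
    refine card_image_le.trans ((card_nearCentral_le d M).trans (Nat.mul_le_mul_right _ ?_))
    nlinarith
  have hsub : univ.image cls ⊆ Z⁻¹ * T.image cls * T.image cls := by
    intro x hx
    obtain ⟨j, -, rfl⟩ := mem_image.1 hx
    have hex : ∃ i ∈ T, j - i ∈ T := by
      by_contra! hcon
      have h1 : Disjoint T (T.image fun i => j - i) := by
        rw [disjoint_left]
        intro a ha ha'
        obtain ⟨i, hi, rfl⟩ := mem_image.1 ha'
        exact hcon i hi ha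
      have h2 := card_le_univ (T ∪ T.image fun i => j - i)
      rw [card_union_of_disjoint h1, card_image_of_injective _ sub_right_injective] at h2
      omega
    obtain ⟨i, hi, hi'⟩ := hex
    have h1 := hf i (j - i)
    rw [add_sub_cancel] at h1
    have h2 : cls j = ((f i * f (j - i) * (f j)⁻¹ : SpecialLinearGroup (Fin 2) (ZMod d)) :
        SpecialLinearGroup (Fin 2) (ZMod d) ⧸ Cen (b : ZMod d))⁻¹ * cls i * cls (j - i) := by
      have : f j = (f i * f (j - i) * (f j)⁻¹)⁻¹ * f i * f (j - i) := by group
      exact congrArg (QuotientGroup.mk (s := Cen (b : ZMod d))) this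
    rw [h2]
    exact mul_mem_mul (mul_mem_mul (inv_mem_inv (mem_image.2 ⟨_, mem_filter.2 ⟨mem_univ _, h1⟩, rfl⟩))
      (mem_image_of_mem _ hi)) (mem_image_of_mem _ hi')
  calc #(univ.image cls) ≤ _ := card_le_card hsub
    _ ≤ #Z * #(T.image cls) * #(T.image cls) := by
        refine card_mul_le.trans (Nat.mul_le_mul_right _ (card_mul_le.trans ?_))
        rw [card_inv]
    _ ≤ (E ^ 2 * M ^ 3) * (E ^ 4 * M ^ 39) * (E ^ 4 * M ^ 39) := by gcongr
    _ = _ := by ring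

lemma card_natCast_mul_eq_le {q D : ℕ} [NeZero q] (hD : 0 < D) (x : ZMod q) :
    #{a : ZMod q | (D : ZMod q) * a = x} ≤ D := by
  by_cases h : ∃ a0 : ZMod q, (D : ZMod q) * a0 = x
  · obtain ⟨a0, rfl⟩ := h
    refine le_trans (card_le_card_of_injOn (t := univ.filter fun a : ZMod q => D • a = 0) (fun a => a - a0) ?_ ?_)
      (IsAddCyclic.card_nsmul_eq_zero_le hD)
    · intro a ha
      have := (mem_filter.1 (mem_coe.1 ha)).2
      refine mem_coe.2 (mem_filter.2 ⟨mem_univ _, ?_⟩)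
      rw [nsmul_eq_mul, mul_sub, this, sub_self]
    · exact fun a _ b _ hab => sub_left_injective hab
  · rw [filter_eq_empty_iff.2 fun a _ ha => h ⟨a, ha⟩]; simp

lemma card_factorizations_le {q D D' : ℕ} [NeZero q] (hD : 0 < D) (hD' : 0 < D')
    (g : SpecialLinearGroup (Fin 2) (ZMod q)) :
    #{w : ZMod q × (ZMod q)ˣ × ZMod q | upper (.ofAdd ((D : ZMod q) * w.1)) *
      lower (.ofAdd ((D' : ZMod q) * (w.2.1 : ZMod q))) * upper (.ofAdd ((D : ZMod q) * w.2.2)) = g} ≤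
      (D * D') * (D * D') * D' := by
  have hDD : 0 < D * D' := Nat.mul_pos hD hD'
  have hent : ∀ w : ZMod q × (ZMod q)ˣ × ZMod q, upper (.ofAdd ((D : ZMod q) * w.1)) *
      lower (.ofAdd ((D' : ZMod q) * (w.2.1 : ZMod q))) * upper (.ofAdd ((D : ZMod q) * w.2.2)) = g →
      (D' : ZMod q) * (w.2.1 : ZMod q) = g 1 0 ∧
      ((D * D' : ℕ) : ZMod q) * w.1 = (g 0 0 - 1) * ((w.2.1⁻¹ : (ZMod q)ˣ) : ZMod q) ∧
      ((D * D' : ℕ) : ZMod q) * w.2.2 = (g 1 1 - 1) * ((w.2.1⁻¹ : (ZMod q)ˣ) : ZMod q) := by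
    rintro ⟨a, b, c⟩ rfl
    simp only [SL_mul, coe_upper, coe_lower]
    have hb := b.mul_inv
    push_cast
    refine ⟨by simp, ?_, ?_⟩
    · simp
      linear_combination (-(D : ZMod q) * D' * a) * hb
    · simp
      linear_combination (-(D : ZMod q) * D' * c) * hb
  set S := univ.filter fun w : ZMod q × (ZMod q)ˣ × ZMod q => upper (.ofAdd ((D : ZMod q) * w.1)) *
      lower (.ofAdd ((D' : ZMod q) * (w.2.1 : ZMod q))) * upper (.ofAdd ((D : ZMod q) * w.2.2)) = g with hS
  have hSm : ∀ {w}, w ∈ S → _ := fun {w} hw => hent w (mem_filter.1 hw).2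
  refine (card_le_mul_card_image (f := fun w => w.2.1) S ((D * D') * (D * D')) ?_).trans
    (Nat.mul_le_mul_left _ ?_)
  · intro b _
    refine le_trans (card_le_card_of_injOn (t := (univ.filter fun a : ZMod q =>
        ((D * D' : ℕ) : ZMod q) * a = (g 0 0 - 1) * ((b⁻¹ : (ZMod q)ˣ) : ZMod q)) ×ˢ
      (univ.filter fun a : ZMod q =>
        ((D * D' : ℕ) : ZMod q) * a = (g 1 1 - 1) * ((b⁻¹ : (ZMod q)ˣ) : ZMod q)))
      (fun w => (w.1, w.2.2)) ?_ ?_) ?_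
    · intro w hw
      obtain ⟨hw1, rfl⟩ := mem_filter.1 (mem_coe.1 hw)
      obtain ⟨-, h2, h3⟩ := hSm hw1
      exact mem_coe.2 (mem_product.2 ⟨mem_filter.2 ⟨mem_univ _, h2⟩, mem_filter.2 ⟨mem_univ _, h3⟩⟩)
    · intro w hw w' hw' hww
      have e1 := (mem_filter.1 (mem_coe.1 hw)).2
      have e2 := (mem_filter.1 (mem_coe.1 hw')).2
      simp only [Prod.mk.injEq] at hww
      exact Prod.ext hww.1 (Prod.ext (e1.trans e2.symm) hww.2)
    · rw [card_product]
      exact Nat.mul_le_mul (card_natCast_mul_eq_le hDD _) (card_natCast_mul_eq_le hDD _)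
  · refine le_trans (card_le_card_of_injOn (t := univ.filter fun a : ZMod q =>
      (D' : ZMod q) * a = g 1 0) (fun b => (b : ZMod q)) ?_ ?_) (card_natCast_mul_eq_le hD' (g 1 0))
    · intro b hb
      obtain ⟨w, hw, rfl⟩ := mem_image.1 (mem_coe.1 hb)
      exact mem_coe.2 (mem_filter.2 ⟨mem_univ _, (hSm hw).1⟩)
    · exact fun x _ y _ h => Units.ext h

lemma exists_mem_pow_fst_eq {G H : Type*} [Group G] [Group H] [DecidableEq G] [DecidableEq H] (A : Finset (G × H)) {k : ℕ} {g : G}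
    (hg : g ∈ ((A.image Prod.fst)⁻¹ * A.image Prod.fst) ^ k) :
    ∃ z ∈ (A⁻¹ * A) ^ k, z.1 = g := by
  have : ((A⁻¹ * A) ^ k).image (MonoidHom.fst G H) =
      ((A.image Prod.fst)⁻¹ * A.image Prod.fst) ^ k := by
    rw [image_pow, image_mul, image_inv]
    rfl
  rw [← this] at hg
  obtain ⟨z, hz, rfl⟩ := mem_image.1 hg
  exact ⟨z, hz, rfl⟩

lemma exists_lift {q d b M E : ℕ} [NeZero q] [NeZero d] (hd : d = b * b) (hcop : q.Coprime d)
    (hM : 2 ≤ M) (hτ : 2 * #d.divisors ≤ E) (hrad : ∏ p ∈ d.primeFactors, p ≤ E)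
    (A : Finset (SpecialLinearGroup (Fin 2) (ZMod q) × SpecialLinearGroup (Fin 2) (ZMod d)))
    {r : ℕ} (hA : ∀ h, (1, h) ∈ (A⁻¹ * A) ^ (r + r + r) → NearCentral M h)
    (u : Multiplicative (ZMod q) →* SpecialLinearGroup (Fin 2) (ZMod q)) (D : ℕ)
    (hu : ∀ j : ZMod q, u (.ofAdd ((D : ZMod q) * j)) ∈
      ((A.image Prod.fst)⁻¹ * A.image Prod.fst) ^ r) :
    ∃ z : ZMod q → SpecialLinearGroup (Fin 2) (ZMod q) × SpecialLinearGroup (Fin 2) (ZMod d),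
      (∀ j, z j ∈ (A⁻¹ * A) ^ r ∧ (z j).1 = u (.ofAdd ((D : ZMod q) * j))) ∧
      #(univ.image fun j => ((z j).2 : SpecialLinearGroup (Fin 2) (ZMod d) ⧸ Cen (b : ZMod d))) ≤
        E ^ 10 * M ^ 81 := by
  choose z hz hz1 using fun j => exists_mem_pow_fst_eq A (hu j)
  refine ⟨z, fun j => ⟨hz j, hz1 j⟩, card_classes_le hd hcop hM hτ hrad (fun j => (z j).2) fun s t => ?_⟩
  refine hA _ ?_
  have h1 : ((1, (z s).2 * (z t).2 * ((z (s + t)).2)⁻¹) :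
      SpecialLinearGroup (Fin 2) (ZMod q) × SpecialLinearGroup (Fin 2) (ZMod d)) =
      z s * z t * (z (s + t))⁻¹ := by
    refine Prod.ext ?_ rfl
    simp only [Prod.fst_mul, Prod.fst_inv, hz1]
    rw [mul_add, ofAdd_add, map_mul u, mul_inv_cancel]
  rw [h1, pow_add, pow_add]
  refine mul_mem_mul (mul_mem_mul (hz s) (hz t)) ?_
  have := inv_mem_inv (hz (s + t))
  rwa [← inv_pow, inv_inv_mul_self] at this

lemma card_mul_card_le_of_lift {G H Ω : Type*} [Group G] [Fintype G] [Group H] [Fintype H] [Fintype Ω]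
    (N : Subgroup H) [N.Normal] (S : Finset (G × H))
    (hS : ∀ a ∈ S, ∀ a' ∈ S, ((a.2 : H) : H ⧸ N) = a'.2 → a = a') (ω : Ω → G × H) {μ R : ℕ}
    (hμ : ∀ g, #{w | (ω w).1 = g} ≤ μ) (hR : #(univ.image fun w => ((ω w).2 : H ⧸ N)) ≤ R)
    (Z : Finset H) (hZ : ∀ a ∈ S, ∀ a' ∈ S, ∀ w w', (a * ω w).1 = (a' * ω w').1 →
      (a * ω w).2⁻¹ * (a' * ω w').2 ∈ Z) :
    #S * Fintype.card Ω ≤ μ * (Fintype.card G * #Z * R) := by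
  set T : Finset ((G × H) × Ω) := S ×ˢ univ with hT
  set X : Finset (G × H) := T.image fun p => p.1 * ω p.2 with hX
  have hXc : #X ≤ Fintype.card G * #Z := by
    have h1 : #X ≤ #Z * #(X.image Prod.fst) := by
      refine card_le_mul_card_image (f := Prod.fst) X #Z ?_
      intro g hg
      obtain ⟨y, hy, rfl⟩ := mem_image.1 hg
      obtain ⟨⟨a, w⟩, haw, rfl⟩ := mem_image.1 hy
      refine card_le_card_of_injOn (fun x => (a * ω w).2⁻¹ * x.2) ?_ ?_
      · intro x hx
        obtain ⟨hx1, hx2⟩ := mem_filter.1 (mem_coe.1 hx)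
        obtain ⟨⟨a', w'⟩, haw', rfl⟩ := mem_image.1 hx1
        exact hZ a (mem_product.1 haw).1 a' (mem_product.1 haw').1 w w' hx2.symm
      · intro x hx x' hx' hxx
        have e1 := (mem_filter.1 (mem_coe.1 hx)).2
        have e2 := (mem_filter.1 (mem_coe.1 hx')).2
        exact Prod.ext (e1.trans e2.symm) (mul_left_cancel hxx)
    rw [mul_comm]
    exact h1.trans (Nat.mul_le_mul_left _ (card_le_univ _))
  set f : (G × H) × Ω → (G × H) × (H ⧸ N) := fun p => (p.1 * ω p.2, ((ω p.2).2 : H ⧸ N)) with hf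
  have h2 : #T ≤ μ * #(T.image f) := by
    refine card_le_mul_card_image (f := f) T μ ?_
    intro y hy
    obtain ⟨⟨a, w⟩, haw, rfl⟩ := mem_image.1 hy
    refine le_trans (card_le_card_of_injOn (fun p => p.2) ?_ ?_) (hμ (ω w).1)
    all_goals
      have key : ∀ p ∈ T.filter (fun p => f p = f (a, w)), p.1 = a ∧ (ω p.2).1 = (ω w).1 := by
        intro p hp
        obtain ⟨hp1, hp2⟩ := mem_filter.1 hp
        simp only [hf, Prod.mk.injEq] at hp2
        have e : p.1 = a := by
          refine hS _ (mem_product.1 hp1).1 _ (mem_product.1 haw).1 ?_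
          have := congrArg (fun x : G × H => ((x.2 : H) : H ⧸ N)) hp2.1
          simp only [Prod.snd_mul, QuotientGroup.mk_mul] at this
          rw [hp2.2] at this
          exact mul_right_cancel this
        refine ⟨e, ?_⟩
        have := congrArg Prod.fst hp2.1
        rw [e] at this
        exact mul_left_cancel this
    · intro p hp
      exact mem_coe.2 (mem_filter.2 ⟨mem_univ _, (key p (mem_coe.1 hp)).2⟩)
    · intro p hp p' hp' hpp
      exact Prod.ext ((key p (mem_coe.1 hp)).1.trans (key p' (mem_coe.1 hp')).1.symm) hpp
  have h3 : T.image f ⊆ X ×ˢ univ.image fun w => ((ω w).2 : H ⧸ N) := by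
    intro y hy
    obtain ⟨p, hp, rfl⟩ := mem_image.1 hy
    exact mem_product.2 ⟨mem_image_of_mem _ hp, mem_image_of_mem _ (mem_univ _)⟩
  have h4 := card_le_card h3
  rw [card_product] at h4
  rw [hT, card_product, card_univ] at h2
  exact h2.trans (Nat.mul_le_mul_left _ (h4.trans (Nat.mul_le_mul hXc hR)))

/-- A set of representatives for the classes of a set of pairs modulo a normal subgroup. -/
lemma exists_section {G H : Type*} [Group H] (N : Subgroup H) (A : Finset (G × H)) :
    ∃ S ⊆ A, (∀ a ∈ S, ∀ a' ∈ S, ((a.2 : H) : H ⧸ N) = a'.2 → a = a') ∧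
      ∀ a ∈ A, ∃ a' ∈ S, ((a.2 : H) : H ⧸ N) = a'.2 := by
  choose g hg using fun y : A.image (fun a => ((a.2 : H) : H ⧸ N)) => mem_image.1 y.2
  refine ⟨univ.image g, ?_, ?_, ?_⟩
  · intro a ha
    obtain ⟨y, -, rfl⟩ := mem_image.1 ha
    exact (hg y).1
  · intro a ha a' ha' h
    obtain ⟨y, -, rfl⟩ := mem_image.1 ha
    obtain ⟨y', -, rfl⟩ := mem_image.1 ha'
    rw [(hg y).2, (hg y').2] at h
    rw [Subtype.ext h]
  · intro a ha
    exact ⟨g ⟨_, mem_image_of_mem _ ha⟩, mem_image_of_mem _ (mem_univ _),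
      (hg ⟨_, mem_image_of_mem _ ha⟩).2.symm⟩

lemma exists_section_SL {q d b E : ℕ} [NeZero q] [NeZero d] (hd : d = b * b)
    (hE : 2 * #d.divisors ≤ E)
    (A : Finset (SpecialLinearGroup (Fin 2) (ZMod q) × SpecialLinearGroup (Fin 2) (ZMod d)))
    (h2 : d ^ 3 ≤ #(A.image Prod.snd) * E) :
    ∃ S ⊆ A, (∀ a ∈ S, ∀ a' ∈ S,
      ((a.2 : SpecialLinearGroup (Fin 2) (ZMod d)) : _ ⧸ Cen (b : ZMod d)) = a'.2 → a = a') ∧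
      b ^ 3 ≤ #S * E ^ 2 := by
  obtain ⟨S, hSA, hS, hcov⟩ := exists_section (Cen (b : ZMod d)) A
  refine ⟨S, hSA, hS, ?_⟩
  have hd0 : d ≠ 0 := NeZero.ne d
  have hb0 : 0 < b := Nat.pos_of_ne_zero (by rintro rfl; simp at hd; exact hd0 hd)
  have hbd : b ∣ d := ⟨b, hd⟩
  have hdb : d / b = b := by rw [hd]; exact Nat.mul_div_cancel _ hb0
  have hC := card_Cen_le hbd
  rw [hdb] at hC
  have hτ : 2 * #b.divisors ≤ E := by
    have := card_le_card (Nat.divisors_subset_of_dvd hd0 hbd)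
    omega
  set C := univ.filter fun g : SpecialLinearGroup (Fin 2) (ZMod d) => g ∈ Cen (b : ZMod d)
  have hsub : A.image Prod.snd ⊆ image₂ (fun a c => a.2 * c) S C := by
    intro y hy
    obtain ⟨a, ha, rfl⟩ := mem_image.1 hy
    obtain ⟨a', ha', h⟩ := hcov a ha
    exact mem_image₂.2 ⟨a', ha', a'.2⁻¹ * a.2,
      mem_filter.2 ⟨mem_univ _, QuotientGroup.eq.1 h.symm⟩, mul_inv_cancel_left _ _⟩
  have h3 : #(A.image Prod.snd) ≤ #S * #C := (card_le_card hsub).trans (card_image₂_le _ _ _)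
  have h4 : b ^ 3 * b ^ 3 ≤ (#S * E ^ 2) * b ^ 3 := by
    calc b ^ 3 * b ^ 3 = d ^ 3 := by rw [hd]; ring
      _ ≤ #S * #C * E := h2.trans (Nat.mul_le_mul_right _ h3)
      _ ≤ #S * (E * b ^ 3) * E :=
        Nat.mul_le_mul_right _ (Nat.mul_le_mul_left _ (hC.trans (Nat.mul_le_mul_right _ hτ)))
      _ = _ := by ring
  exact Nat.le_of_mul_le_mul_right h4 (pow_pos hb0 3)

lemma exists_not_nearCentral_aux {q d b E k r s : ℕ} [NeZero q] [NeZero d] (hd : d = b * b)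
    (hcop : q.Coprime d) (hτ : 2 * #d.divisors ≤ E) (hrad : ∏ p ∈ d.primeFactors, p ≤ E)
    (hq : q ≤ q.totient * E) (hr : r ≠ 0) (hs : s = 8 * 12)
    (A : Finset (SpecialLinearGroup (Fin 2) (ZMod q) × SpecialLinearGroup (Fin 2) (ZMod d)))
    (h1 : q ^ 3 ≤ #(A.image Prod.fst) * E) (h2 : d ^ 3 ≤ #(A.image Prod.snd) * E)
    (hr1 : ∀ h, (1, h) ∈ (A⁻¹ * A) ^ (s + s + s) → NearCentral (E ^ r) h)
    (hk : ∀ h, (1, h) ∈ (A⁻¹ * A) ^ ((s + s + s) + 1 + (s + s + s)) →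
      NearCentral (E ^ k) h) :
    b ^ 3 ≤ E ^ (725 + 3 * k + 3 * (10 + r * 81)) := by
  have hτ0 : 0 < #d.divisors := card_pos.2 ⟨1, Nat.one_mem_divisors.2 (NeZero.ne d)⟩
  have hE2 : 2 ≤ E := by omega
  have hq0 : 0 < q := NeZero.pos q
  have hM : 2 ≤ E ^ r := hE2.trans (Nat.le_self_pow hr E)
  obtain ⟨P, hP⟩ : ∃ P, P = E ^ 144 := ⟨_, rfl⟩
  have hPE : 2 ^ 132 * E ^ 12 ≤ P := by
    calc 2 ^ 132 * E ^ 12 ≤ E ^ 132 * E ^ 12 := Nat.mul_le_mul_right _ (Nat.pow_le_pow_left hE2 _)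
      _ = P := by rw [← pow_add, hP]
  obtain ⟨D, hD0, hDb, hDu⟩ := mem_pow_of_fill h1 hq hs hPE upper diag diag_conj_upper
  obtain ⟨D', hD0', hDb', hDl⟩ := mem_pow_of_fill h1 hq hs hPE lower (diag.comp invMonoidHom) (by
    intro l t
    simpa using diag_conj_lower l t)
  obtain ⟨zu, hzu, hcu⟩ := exists_lift hd hcop hM hτ hrad A hr1 upper D hDu
  obtain ⟨zl, hzl, hcl⟩ := exists_lift hd hcop hM hτ hrad A hr1 lower D' hDl
  obtain ⟨S, hSA, hS, hSc⟩ := exists_section_SL hd hτ A h2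
  set ω : ZMod q × (ZMod q)ˣ × ZMod q →
    SpecialLinearGroup (Fin 2) (ZMod q) × SpecialLinearGroup (Fin 2) (ZMod d) :=
    fun w => zu w.1 * zl (w.2.1 : ZMod q) * zu w.2.2 with hω
  have hωB : ∀ w, ω w ∈ (A⁻¹ * A) ^ (s + s + s) := by
    intro w
    rw [pow_add, pow_add]
    exact mul_mem_mul (mul_mem_mul (hzu _).1 (hzl _).1) (hzu _).1
  have hω1 : ∀ w, (ω w).1 = upper (.ofAdd ((D : ZMod q) * w.1)) *
      lower (.ofAdd ((D' : ZMod q) * (w.2.1 : ZMod q))) * upper (.ofAdd ((D : ZMod q) * w.2.2)) := by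
    intro w
    simp only [hω, Prod.fst_mul, (hzu _).2, (hzl _).2]
  set Cu := univ.image fun j => ((zu j).2 : SpecialLinearGroup (Fin 2) (ZMod d) ⧸ Cen (b : ZMod d))
  set Cl := univ.image fun j => ((zl j).2 : SpecialLinearGroup (Fin 2) (ZMod d) ⧸ Cen (b : ZMod d))
  set R := E ^ 10 * (E ^ r) ^ 81 with hR
  have hωR : #(univ.image fun w => ((ω w).2 : SpecialLinearGroup (Fin 2) (ZMod d) ⧸ Cen (b : ZMod d))) ≤
      R * R * R := by
    have hsub : (univ.image fun w => ((ω w).2 :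
        SpecialLinearGroup (Fin 2) (ZMod d) ⧸ Cen (b : ZMod d))) ⊆ Cu * Cl * Cu := by
      intro x hx
      obtain ⟨w, -, rfl⟩ := mem_image.1 hx
      exact mul_mem_mul (mul_mem_mul (mem_image_of_mem _ (mem_univ _)) (mem_image_of_mem _ (mem_univ _)))
        (mem_image_of_mem _ (mem_univ _))
    exact (card_le_card hsub).trans (card_mul_le.trans
      (Nat.mul_le_mul (card_mul_le.trans (Nat.mul_le_mul hcu hcl)) hcu))
  have hpig := card_mul_card_le_of_lift (Cen (b : ZMod d)) S hS ω
    (μ := (D * D') * (D * D') * D') (fun g => by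
      simp only [hω1]
      exact card_factorizations_le hD0 hD0' g) hωR
    (univ.filter fun h : SpecialLinearGroup (Fin 2) (ZMod d) => NearCentral (E ^ k) h) (by
      intro a ha a' ha' w w' hw
      refine mem_filter.2 ⟨mem_univ _, hk _ ?_⟩
      have e : ((1, (a * ω w).2⁻¹ * (a' * ω w').2) :
          SpecialLinearGroup (Fin 2) (ZMod q) × SpecialLinearGroup (Fin 2) (ZMod d)) =
          (ω w)⁻¹ * (a⁻¹ * a') * ω w' := by
        have e1 : (ω w)⁻¹ * (a⁻¹ * a') * ω w' = (a * ω w)⁻¹ * (a' * ω w') := by group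
        rw [e1]
        refine Prod.ext ?_ rfl
        rw [Prod.fst_mul, Prod.fst_inv, hw, inv_mul_cancel]
      rw [e, pow_add, pow_add _ _ 1, pow_one]
      refine mul_mem_mul (mul_mem_mul ?_ (mul_mem_mul (inv_mem_inv (hSA ha)) (hSA ha'))) (hωB w')
      have := inv_mem_inv (hωB w)
      rwa [← inv_pow, inv_inv_mul_self] at this)
  have hcard : Fintype.card (ZMod q × (ZMod q)ˣ × ZMod q) = q * (q.totient * q) := by
    rw [Fintype.card_prod, Fintype.card_prod, ZMod.card, ZMod.card_units_eq_totient]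
  rw [hcard] at hpig
  set Z := univ.filter fun h : SpecialLinearGroup (Fin 2) (ZMod d) => NearCentral (E ^ k) h
  have hZ : #Z ≤ E ^ 2 * (E ^ k) ^ 3 := by
    refine (card_nearCentral_le d (E ^ k)).trans (Nat.mul_le_mul_right _ ?_)
    nlinarith
  have hG := card_SL_le q
  have hμ : (D * D') * (D * D') * D' ≤ (P * P) * (P * P) * P :=
    Nat.mul_le_mul (Nat.mul_le_mul (Nat.mul_le_mul hDb hDb') (Nat.mul_le_mul hDb hDb')) hDb'
  have hmain : #S * q ^ 3 ≤ (((P * P) * (P * P) * P) * ((E ^ 2 * (E ^ k) ^ 3) * (R * R * R)) * E) * q ^ 3 := by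
    calc #S * q ^ 3 = #S * (q * (q * q)) := by ring
      _ ≤ #S * (q * ((q.totient * E) * q)) :=
          Nat.mul_le_mul_left _ (Nat.mul_le_mul_left _ (Nat.mul_le_mul_right _ hq))
      _ = (#S * (q * (q.totient * q))) * E := by ring
      _ ≤ (((P * P) * (P * P) * P) * (q ^ 3 * (E ^ 2 * (E ^ k) ^ 3) * (R * R * R))) * E :=
          Nat.mul_le_mul_right _ (hpig.trans (Nat.mul_le_mul hμ
            (Nat.mul_le_mul_right _ (Nat.mul_le_mul hG hZ))))
      _ = _ := by ring
  have hS' := Nat.le_of_mul_le_mul_right hmain (pow_pos hq0 3)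
  refine hSc.trans ((Nat.mul_le_mul_right _ hS').trans (le_of_eq ?_))
  rw [hR, hP]
  generalize hx : E ^ k = x
  generalize hy : E ^ r = y
  have hE : E ^ (725 + 3 * k + 3 * (10 + r * 81)) = E ^ 144 * E ^ 144 * E ^ 144 * E ^ 144 * E ^ 144 *
    E ^ 5 * x ^ 3 * (E ^ 10 * y ^ 81) ^ 3 := by
    rw [← hx, ← hy, ← pow_mul, ← pow_mul, ← pow_add E 10, ← pow_mul, ← pow_add, ← pow_add, ← pow_add, ← pow_add,
      ← pow_add, ← pow_add, ← pow_add]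
    congr 1
    ring
  rw [hE]
  generalize E ^ 144 = w
  generalize E ^ 10 * y ^ 81 = v
  ring

/-- In a large subset of `SL₂(ℤ/q) × SL₂(ℤ/d)` with `q`, `d` coprime, the graph structure is broken
in a non-central way. -/
lemma exists_not_nearCentral : ∃ K : ℕ, ∀ (q d b E : ℕ) [NeZero q] [NeZero d], d = b * b →
    q.Coprime d → 2 * #d.divisors ≤ E → ∏ p ∈ d.primeFactors, p ≤ E → q ≤ q.totient * E →
    E ^ K < d → ∀ A : Finset (SpecialLinearGroup (Fin 2) (ZMod q) × SpecialLinearGroup (Fin 2) (ZMod d)),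
    q ^ 3 ≤ #(A.image Prod.fst) * E → d ^ 3 ≤ #(A.image Prod.snd) * E →
    ∃ x ∈ A ^ 3, ∃ x' ∈ A ^ 3, x.1 = x'.1 ∧ ¬ NearCentral E (x.2⁻¹ * x'.2) := by
  obtain ⟨s, hs⟩ : ∃ s : ℕ, s = 8 * 12 := ⟨_, rfl⟩
  obtain ⟨k, hk⟩ : ∃ k : ℕ, k = 36 * ((s + s + s) + 1 + (s + s + s)) + 115 :=
    ⟨_, rfl⟩
  obtain ⟨r, hr⟩ : ∃ r : ℕ, r = 36 * (s + s + s) + 115 := ⟨_, rfl⟩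
  refine ⟨725 + 3 * k + 3 * (10 + r * 81), ?_⟩
  intro q d b E _ _ hd hcop hτ hrad hq hK A h1 h2
  by_contra! hcon
  have hne : A.Nonempty := by
    rw [nonempty_iff_ne_empty]
    rintro rfl
    simp only [image_empty, card_empty, zero_mul, nonpos_iff_eq_zero] at h2
    exact NeZero.ne d (pow_eq_zero_iff (by norm_num) |>.1 h2)
  have hb := exists_not_nearCentral_aux (k := k) (r := r) hd hcop hτ hrad hq (by omega) hs A h1 h2
    (fun h hh => hr ▸ nearCentral_of_mem_pow hne hτ h1 h2 hcon hh)
    (fun h hh => hk ▸ nearCentral_of_mem_pow hne hτ h1 h2 hcon hh)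
  have hb2 : d ≤ b ^ 3 := by
    rw [hd, pow_succ, pow_two]
    refine Nat.le_mul_of_pos_right _ (Nat.pos_of_ne_zero ?_)
    rintro rfl
    exact NeZero.ne d (by simpa using hd)
  exact absurd (hb2.trans hb) (not_le.2 hK)

lemma exists_card_linear_form_le {n : ℕ} [NeZero n] (A B C : ZMod n) :
    ∃ c, c ∣ n ∧ (c : ZMod n) ∣ A ∧ (c : ZMod n) ∣ B ∧ (c : ZMod n) ∣ C ∧
      #{t : ZMod n × ZMod n × ZMod n | A * t.1 + B * t.2.1 + C * t.2.2 = 0} ≤ n ^ 2 * c := by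
  set f : ZMod n × ZMod n × ZMod n →+ ZMod n :=
    { toFun := fun t => A * t.1 + B * t.2.1 + C * t.2.2
      map_zero' := by simp
      map_add' := fun x y => by simp; ring } with hf
  set r := Nat.card f.range with hr
  have hrn : r ∣ n := by
    have := AddSubgroup.card_addSubgroup_dvd_card f.range
    rwa [Nat.card_zmod] at this
  have hn : 0 < n := NeZero.pos n
  have hr0 : 0 < r := Nat.pos_of_dvd_of_pos hrn hn
  obtain ⟨c, hc⟩ := hrn
  have hdvd : ∀ t, (c : ZMod n) ∣ f t := by
    intro t
    have h1 : r • (⟨f t, t, rfl⟩ : f.range) = 0 := by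
      rw [hr]; exact card_nsmul_eq_zero'
    have h2 : (r : ZMod n) * f t = 0 := by
      rw [← nsmul_eq_mul]; exact congrArg Subtype.val h1
    rw [natCast_dvd_iff (Dvd.intro_left r hc.symm)]
    exact cast_eq_zero_of_mul hc.symm h2
  refine ⟨c, Dvd.intro_left r hc.symm, ?_, ?_, ?_, ?_⟩
  · simpa [hf] using hdvd (1, 0, 0)
  · simpa [hf] using hdvd (0, 1, 0)
  · simpa [hf] using hdvd (0, 0, 1)
  · have h1 : Nat.card f.ker * r = n ^ 3 := by
      rw [hr, ← AddSubgroup.index_ker, AddSubgroup.card_mul_index, Nat.card_prod, Nat.card_prod, Nat.card_zmod]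
      ring
    have h2 : #{t : ZMod n × ZMod n × ZMod n | A * t.1 + B * t.2.1 + C * t.2.2 = 0} = Nat.card f.ker := by
      rw [Nat.card_eq_fintype_card, ← Fintype.card_coe]
      exact Fintype.card_congr (Equiv.subtypeEquivRight fun t => by simp [AddMonoidHom.mem_ker, hf])
    rw [h2]
    refine Nat.le_of_mul_le_mul_right (c := r) (le_of_eq ?_) hr0
    calc _ = n ^ 3 := h1
      _ = n ^ 2 * n := by ring
      _ = _ := by nth_rewrite 2 [hc]; ring

/-- Traceless matrices, parametrised by three entries. -/
def tl {R : Type*} [CommRing R] (t : R × R × R) : Matrix (Fin 2) (Fin 2) R := !![t.1, t.2.1; t.2.2, -t.1]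

lemma tl_sub {R : Type*} [CommRing R] (t t' : R × R × R) : tl (t - t') = tl t - tl t' := by
  ext i j; fin_cases i <;> fin_cases j <;> simp [tl]; ring

lemma card_commutant_le {n : ℕ} [NeZero n] (B : Matrix (Fin 2) (Fin 2) (ZMod n)) {u v w : ZMod n}
    (h : u * (B 0 0 - B 1 1) + v * B 0 1 + w * B 1 0 = 1) :
    #{t : ZMod n × ZMod n × ZMod n | B * tl t = tl t * B} ≤ n * 2 := by
  have hkey : ∀ t : ZMod n × ZMod n × ZMod n, B * tl t = tl t * B →
      2 * t.1 = (u * (2 * t.1) + v * t.2.1 + w * t.2.2) * (B 0 0 - B 1 1) ∧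
      t.2.1 = (u * (2 * t.1) + v * t.2.1 + w * t.2.2) * B 0 1 ∧
      t.2.2 = (u * (2 * t.1) + v * t.2.1 + w * t.2.2) * B 1 0 := by
    rintro ⟨t, p, q⟩ ht
    have h0 := congrFun (congrFun ht 0) 0
    have h1 := congrFun (congrFun ht 0) 1
    have h2 := congrFun (congrFun ht 1) 0
    simp [tl, Matrix.mul_apply, Fin.sum_univ_two] at h0 h1 h2 ⊢
    refine ⟨?_, ?_, ?_⟩
    · linear_combination (-(2 * t)) * h - v * h1 + w * h2
    · linear_combination (-p) * h + u * h1 - w * h0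
    · linear_combination (-q) * h - u * h2 + v * h0
  refine (card_le_mul_card_image (f := fun t => u * (2 * t.1) + v * t.2.1 + w * t.2.2) _ 2 ?_).trans ?_
  · intro s _
    refine le_trans (card_le_card_of_injOn (t := univ.filter fun t : ZMod n =>
      ((2 : ℕ) : ZMod n) * t = s * (B 0 0 - B 1 1)) (fun t => t.1) ?_ ?_)
      (card_natCast_mul_eq_le two_pos _)
    · intro t ht
      obtain ⟨h1, rfl⟩ := mem_filter.1 (mem_coe.1 ht)
      refine mem_coe.2 (mem_filter.2 ⟨mem_univ _, ?_⟩)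
      rw [Nat.cast_two]
      exact (hkey t (mem_filter.1 h1).2).1
    · intro t ht t' ht' htt
      obtain ⟨h1, h2⟩ := mem_filter.1 (mem_coe.1 ht)
      obtain ⟨h1', h2'⟩ := mem_filter.1 (mem_coe.1 ht')
      have k := (hkey t (mem_filter.1 h1).2).2
      have k' := (hkey t' (mem_filter.1 h1').2).2
      rw [h2] at k
      rw [h2'] at k'
      exact Prod.ext htt (Prod.ext (k.1.trans k'.1.symm) (k.2.trans k'.2.symm))
  · rw [mul_comm]
    exact Nat.mul_le_mul_right _ ((card_le_univ _).trans (by rw [ZMod.card]))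

lemma trace_tl_mul {R : Type*} [CommRing R] (t : R × R × R) (N : Matrix (Fin 2) (Fin 2) R) :
    (tl t * N).trace = (N 0 0 - N 1 1) * t.1 + N 1 0 * t.2.1 + N 0 1 * t.2.2 := by
  rw [Matrix.trace_fin_two, Matrix.mul_apply, Matrix.mul_apply, Fin.sum_univ_two, Fin.sum_univ_two]
  simp [tl]; ring

lemma trace_commutator_eq_zero {R : Type*} [CommRing R] {B₁ B₂ T₁ T₂ h₁ h₂ k₁ k₂ : Matrix (Fin 2) (Fin 2) R}
    (e₁ : k₁ * h₁ = 1) (e₂ : h₂ * k₂ = 1) (c₁ : k₁ * B₁ = B₁ * k₁) (c₂ : k₂ * B₂ = B₂ * k₂)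
    (h : (B₁ * T₁ - T₁ * B₁) * h₂ + h₁ * (B₂ * T₂ - T₂ * B₂) = 0) :
    (T₂ * (k₂ * (B₁ * B₂ - B₂ * B₁))).trace = 0 := by
  have h1 : k₁ * (B₁ * T₁ - T₁ * B₁) + (B₂ * T₂ - T₂ * B₂) * k₂ = 0 := by
    calc _ = k₁ * (B₁ * T₁ - T₁ * B₁) * (h₂ * k₂) + (k₁ * h₁) * ((B₂ * T₂ - T₂ * B₂) * k₂) := by
          rw [e₁, e₂, mul_one, one_mul]
      _ = k₁ * ((B₁ * T₁ - T₁ * B₁) * h₂ + h₁ * (B₂ * T₂ - T₂ * B₂)) * k₂ := by noncomm_ring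
      _ = 0 := by rw [h]; simp
  have h2 : (B₁ * (k₁ * (B₁ * T₁ - T₁ * B₁))).trace = 0 := by
    have : B₁ * (k₁ * (B₁ * T₁ - T₁ * B₁)) = B₁ * (k₁ * B₁ * T₁) - (B₁ * k₁ * T₁) * B₁ := by noncomm_ring
    rw [this, Matrix.trace_sub, c₁, Matrix.trace_mul_comm (B₁ * k₁ * T₁), sub_self]
  have h3 : (B₁ * ((B₂ * T₂ - T₂ * B₂) * k₂)).trace = 0 := by
    have := congrArg (fun M => (B₁ * M).trace) h1
    simp only [mul_add, Matrix.trace_add, h2, zero_add, mul_zero, Matrix.trace_zero] at this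
    exact this
  have h4 : B₁ * ((B₂ * T₂ - T₂ * B₂) * k₂) = (B₁ * B₂) * (T₂ * k₂) - (B₁ * T₂) * (B₂ * k₂) := by noncomm_ring
  have h5 : T₂ * (k₂ * (B₁ * B₂ - B₂ * B₁)) = (T₂ * k₂) * (B₁ * B₂) - T₂ * ((k₂ * B₂) * B₁) := by noncomm_ring
  rw [h5, Matrix.trace_sub, Matrix.trace_mul_comm _ (B₁ * B₂), c₂]
  rw [h4, Matrix.trace_sub] at h3
  rw [← h3, ← mul_assoc T₂, Matrix.trace_mul_comm _ B₁, mul_assoc B₁ T₂]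

lemma exists_card_solutions_le {n : ℕ} [NeZero n] (B₁ B₂ : Matrix (Fin 2) (Fin 2) (ZMod n))
    (h₁ h₂ : SpecialLinearGroup (Fin 2) (ZMod n)) (c₁ : (h₁ : Matrix (Fin 2) (Fin 2) (ZMod n)) * B₁ = B₁ * h₁)
    (c₂ : (h₂ : Matrix (Fin 2) (Fin 2) (ZMod n)) * B₂ = B₂ * h₂) {u v w : ZMod n}
    (h : u * (B₁ 0 0 - B₁ 1 1) + v * B₁ 0 1 + w * B₁ 1 0 = 1) :
    ∃ c, c ∣ n ∧ (∀ i j, (c : ZMod n) ∣ 2 * (B₁ * B₂ - B₂ * B₁) i j) ∧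
      #{t : (ZMod n × ZMod n × ZMod n) × (ZMod n × ZMod n × ZMod n) |
        (B₁ * tl t.1 - tl t.1 * B₁) * h₂ + h₁ * (B₂ * tl t.2 - tl t.2 * B₂) = 0} ≤ 2 * n ^ 3 * c := by
  have inv_comm : ∀ (g : SpecialLinearGroup (Fin 2) (ZMod n)) (B : Matrix (Fin 2) (Fin 2) (ZMod n)),
      (g : Matrix (Fin 2) (Fin 2) (ZMod n)) * B = B * g →
      ((g⁻¹ : SpecialLinearGroup (Fin 2) (ZMod n)) : Matrix (Fin 2) (Fin 2) (ZMod n)) * B = B * (g⁻¹ : SpecialLinearGroup (Fin 2) (ZMod n)) := by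
    intro g B hB
    have e : ((g⁻¹ : SpecialLinearGroup (Fin 2) (ZMod n)) : Matrix (Fin 2) (Fin 2) (ZMod n)) * g = 1 :=
      congrArg Subtype.val (inv_mul_cancel g)
    have e' : (g : Matrix (Fin 2) (Fin 2) (ZMod n)) * (g⁻¹ : SpecialLinearGroup (Fin 2) (ZMod n)) = 1 :=
      congrArg Subtype.val (mul_inv_cancel g)
    generalize ((g⁻¹ : SpecialLinearGroup (Fin 2) (ZMod n)) : Matrix (Fin 2) (Fin 2) (ZMod n)) = k at *
    calc k * B = k * B * (g * k) := by rw [e', mul_one]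
      _ = k * (B * g) * k := by noncomm_ring
      _ = (k * g) * B * k := by rw [← hB]; noncomm_ring
      _ = B * k := by rw [e, one_mul]
  have e₁ : ((h₁⁻¹ : SpecialLinearGroup (Fin 2) (ZMod n)) : Matrix (Fin 2) (Fin 2) (ZMod n)) * h₁ = 1 :=
    congrArg Subtype.val (inv_mul_cancel h₁)
  have e₂ : (h₂ : Matrix (Fin 2) (Fin 2) (ZMod n)) * (h₂⁻¹ : SpecialLinearGroup (Fin 2) (ZMod n)) = 1 :=
    congrArg Subtype.val (mul_inv_cancel h₂)
  have d₁ := inv_comm h₁ B₁ c₁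
  have d₂ := inv_comm h₂ B₂ c₂
  generalize ((h₁⁻¹ : SpecialLinearGroup (Fin 2) (ZMod n)) : Matrix (Fin 2) (Fin 2) (ZMod n)) = k₁ at *
  generalize ((h₂⁻¹ : SpecialLinearGroup (Fin 2) (ZMod n)) : Matrix (Fin 2) (Fin 2) (ZMod n)) = k₂ at *
  set N := k₂ * (B₁ * B₂ - B₂ * B₁) with hN
  obtain ⟨c, hcn, hA, hB, hC, hcard⟩ := exists_card_linear_form_le (N 0 0 - N 1 1) (N 1 0) (N 0 1)
  have htr : N.trace = 0 := by
    rw [hN, mul_sub, Matrix.trace_sub, ← mul_assoc, ← mul_assoc, d₂, mul_assoc B₂, Matrix.trace_mul_comm B₂,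
      mul_assoc, sub_self]
  rw [Matrix.trace_fin_two] at htr
  refine ⟨c, hcn, ?_, ?_⟩
  · have h2N : ∀ i j, (c : ZMod n) ∣ 2 * N i j := by
      intro i j
      fin_cases i <;> fin_cases j
      · have : 2 * N 0 0 = N 0 0 - N 1 1 := by linear_combination htr
        simpa [this] using hA
      · exact hC.mul_left 2
      · exact hB.mul_left 2
      · have : 2 * N 1 1 = -(N 0 0 - N 1 1) := by linear_combination htr
        rw [← dvd_neg] at hA
        exact this ▸ hA
    have hM : B₁ * B₂ - B₂ * B₁ = (h₂ : Matrix (Fin 2) (Fin 2) (ZMod n)) * N := by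
      rw [hN, ← mul_assoc, e₂, one_mul]
    intro i j
    rw [hM, Matrix.mul_apply, Fin.sum_univ_two, mul_add]
    refine dvd_add ?_ ?_
    · rw [mul_left_comm]; exact (h2N 0 j).mul_left _
    · rw [mul_left_comm]; exact (h2N 1 j).mul_left _
  · have hfib := card_commutant_le B₁ h
    refine (card_le_mul_card_image (f := Prod.snd) _ (n * 2) ?_).trans (le_trans (b := (n * 2) * (n ^ 2 * c)) ?_ ?_)
    · intro s hs
      obtain ⟨s₀, hs₀, rfl⟩ := mem_image.1 hs
      have hs₀' := (mem_filter.1 hs₀).2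
      refine le_trans (card_le_card_of_injOn (fun t => t.1 - s₀.1) ?_ ?_) hfib
      · intro t ht
        obtain ⟨ht1, ht2⟩ := mem_filter.1 (mem_coe.1 ht)
        have ht1' := (mem_filter.1 ht1).2
        refine mem_coe.2 (mem_filter.2 ⟨mem_univ _, ?_⟩)
        rw [ht2] at ht1'
        have h1 : (B₁ * tl t.1 - tl t.1 * B₁) * h₂ = (B₁ * tl s₀.1 - tl s₀.1 * B₁) * h₂ :=
          add_right_cancel (ht1'.trans hs₀'.symm)
        have h2 : B₁ * tl t.1 - tl t.1 * B₁ = B₁ * tl s₀.1 - tl s₀.1 * B₁ := by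
          have := congrArg (· * k₂) h1
          simpa only [mul_assoc, e₂, mul_one] using this
        rw [tl_sub, ← sub_eq_zero]
        rw [← sub_eq_zero] at h2
        rw [← h2]; noncomm_ring
      · intro t ht t' ht' htt
        exact Prod.ext (sub_left_injective htt) ((mem_filter.1 (mem_coe.1 ht)).2.trans (mem_filter.1 (mem_coe.1 ht')).2.symm)
    · refine Nat.mul_le_mul_left _ (le_trans (card_le_card ?_) hcard)
      intro s hs
      obtain ⟨t, ht, rfl⟩ := mem_image.1 hs
      have := trace_commutator_eq_zero e₁ e₂ d₁ d₂ (mem_filter.1 ht).2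
      rw [trace_tl_mul] at this
      exact mem_filter.2 ⟨mem_univ _, this⟩
    · exact le_of_eq (by ring)

lemma isUnit_intCast_of_forall_prime {n : ℕ} {x : ℤ} (h : ∀ p : ℕ, p.Prime → p ∣ n → ¬ (p : ℤ) ∣ x) :
    IsUnit ((x : ℤ) : ZMod n) := by
  rw [ZMod.coe_int_isUnit_iff_isCoprime, Int.isCoprime_iff_gcd_eq_one]
  by_contra hne
  obtain ⟨p, hp, h1, h2⟩ := Nat.Prime.not_coprime_iff_dvd.1 (show ¬ Nat.Coprime n x.natAbs from hne)
  exact h p hp h1 (Int.natCast_dvd.2 h2)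

/-- A primitive binary quadratic form represents a unit modulo `n`. -/
lemma exists_isUnit_form {n : ℕ} (hn : n ≠ 0) (a b c : ℕ) (h : ∀ p : ℕ, p.Prime → p ∣ n → ¬ (p ∣ a ∧ p ∣ b ∧ p ∣ c)) :
    ∃ x y : ℤ, IsUnit (((c * x ^ 2 - a * (x * y) - b * y ^ 2 : ℤ)) : ZMod n) := by
  have key : ∀ (s : Finset ℕ) (p : ℕ), p.Prime → (∀ r ∈ s, r.Prime) → ((p : ℤ) ∣ ((∏ r ∈ s, r : ℕ) : ℤ) ↔ p ∈ s) := by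
    intro s p hp hs
    rw [Int.natCast_dvd_natCast, hp.prime.dvd_finsetProd_iff]
    constructor
    · rintro ⟨r, hr, hpr⟩
      rwa [(Nat.prime_dvd_prime_iff_eq hp (hs r hr)).1 hpr]
    · exact fun h => ⟨p, h, dvd_rfl⟩
  set sx := n.primeFactors.filter fun p => p ∣ c ∧ ¬ p ∣ b with hsx
  set sy := n.primeFactors.filter fun p => ¬ p ∣ c with hsy
  refine ⟨((∏ r ∈ sx, r : ℕ) : ℤ), ((∏ r ∈ sy, r : ℕ) : ℤ), isUnit_intCast_of_forall_prime fun p hp hpn hdvd => ?_⟩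
  have hx := key sx p hp fun r hr => Nat.prime_of_mem_primeFactors (mem_filter.1 hr).1
  have hy := key sy p hp fun r hr => Nat.prime_of_mem_primeFactors (mem_filter.1 hr).1
  generalize ((∏ r ∈ sx, r : ℕ) : ℤ) = x at *
  generalize ((∏ r ∈ sy, r : ℕ) : ℤ) = y at *
  have hpm : p ∈ n.primeFactors := Nat.mem_primeFactors.2 ⟨hp, hpn, hn⟩
  have hpp : Prime (p : ℤ) := Nat.prime_iff_prime_int.1 hp
  by_cases hc : p ∣ c
  · have hy' : ¬ (p : ℤ) ∣ y := by rw [hy]; simp [hsy, hc]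
    have hc' := Int.natCast_dvd_natCast.2 hc
    by_cases hb : p ∣ b
    · have hx' : ¬ (p : ℤ) ∣ x := by rw [hx]; simp [hsx, hb]
      have hb' := Int.natCast_dvd_natCast.2 hb
      have : (p : ℤ) ∣ a * (x * y) := by
        have e : (a : ℤ) * (x * y) = c * x ^ 2 - b * y ^ 2 - (c * x ^ 2 - a * (x * y) - b * y ^ 2) := by ring
        rw [e]
        exact dvd_sub (dvd_sub (hc'.mul_right _) (hb'.mul_right _)) hdvd
      rcases hpp.dvd_or_dvd this with h1 | h1
      · exact h p hp hpn ⟨Int.natCast_dvd_natCast.1 h1, hb, hc⟩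
      · exact (hpp.dvd_or_dvd h1).elim hx' hy'
    · have hx' : (p : ℤ) ∣ x := by rw [hx]; exact mem_filter.2 ⟨hpm, hc, hb⟩
      have : (p : ℤ) ∣ b * y ^ 2 := by
        have e : (b : ℤ) * y ^ 2 = x * (c * x - a * y) - (c * x ^ 2 - a * (x * y) - b * y ^ 2) := by ring
        rw [e]
        exact dvd_sub (hx'.mul_right _) hdvd
      rcases hpp.dvd_or_dvd this with h1 | h1
      · exact hb (Int.natCast_dvd_natCast.1 h1)
      · exact hy' (hpp.dvd_of_dvd_pow h1)
  · have hx' : ¬ (p : ℤ) ∣ x := by rw [hx]; simp [hsx, hc]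
    have hy' : (p : ℤ) ∣ y := by rw [hy]; exact mem_filter.2 ⟨hpm, hc⟩
    have : (p : ℤ) ∣ c * x ^ 2 := by
      have e : (c : ℤ) * x ^ 2 = y * (a * x + b * y) + (c * x ^ 2 - a * (x * y) - b * y ^ 2) := by ring
      rw [e]
      exact dvd_add (hy'.mul_right _) hdvd
    rcases hpp.dvd_or_dvd this with h1 | h1
    · exact hc (Int.natCast_dvd_natCast.1 h1)
    · exact hx' (hpp.dvd_of_dvd_pow h1)

/-- Conjugation of a matrix by an element of `SL₂`. -/
def cj {R : Type*} [CommRing R] (α : SpecialLinearGroup (Fin 2) R) (B : Matrix (Fin 2) (Fin 2) R) :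
    Matrix (Fin 2) (Fin 2) R :=
  ((α⁻¹ : SpecialLinearGroup (Fin 2) R) : Matrix (Fin 2) (Fin 2) R) * B * (α : Matrix (Fin 2) (Fin 2) R)

lemma coe_mul_cj {R : Type*} [CommRing R] (α : SpecialLinearGroup (Fin 2) R) (B : Matrix (Fin 2) (Fin 2) R) :
    (α : Matrix (Fin 2) (Fin 2) R) * cj α B = B * (α : Matrix (Fin 2) (Fin 2) R) := by
  have : (α : Matrix (Fin 2) (Fin 2) R) * ((α⁻¹ : SpecialLinearGroup (Fin 2) R) : Matrix (Fin 2) (Fin 2) R) = 1 :=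
    congrArg Subtype.val (mul_inv_cancel α)
  rw [cj, ← mul_assoc, ← mul_assoc, this, one_mul]

lemma trace_cj {R : Type*} [CommRing R] (α : SpecialLinearGroup (Fin 2) R) (B : Matrix (Fin 2) (Fin 2) R) :
    (cj α B).trace = B.trace := by
  have : (α : Matrix (Fin 2) (Fin 2) R) * ((α⁻¹ : SpecialLinearGroup (Fin 2) R) : Matrix (Fin 2) (Fin 2) R) = 1 :=
    congrArg Subtype.val (mul_inv_cancel α)
  rw [cj, Matrix.trace_mul_comm, ← mul_assoc, this, one_mul]

lemma cj_mul_cj {R : Type*} [CommRing R] (α : SpecialLinearGroup (Fin 2) R) (B C : Matrix (Fin 2) (Fin 2) R) :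
    cj α B * cj α C = cj α (B * C) := by
  rw [cj, mul_assoc, coe_mul_cj, cj]; noncomm_ring

lemma cj_sub {R : Type*} [CommRing R] (α : SpecialLinearGroup (Fin 2) R) (B C : Matrix (Fin 2) (Fin 2) R) :
    cj α (B - C) = cj α B - cj α C := by
  simp only [cj, mul_sub, sub_mul]

lemma cj_cj {R : Type*} [CommRing R] (α β : SpecialLinearGroup (Fin 2) R) (B : Matrix (Fin 2) (Fin 2) R) :
    cj β (cj α B) = cj (α * β) B := by
  simp only [cj, _root_.mul_inv_rev, Matrix.SpecialLinearGroup.coe_mul]; noncomm_ring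

lemma exists_isUnit_form_of_primitive {n : ℕ} [NeZero n] {a b c u v w : ZMod n} (h : u * a + v * b + w * c = 1) :
    ∃ x y : ZMod n, IsUnit (c * x ^ 2 - a * (x * y) - b * y ^ 2) := by
  obtain ⟨x, y, hxy⟩ := exists_isUnit_form (NeZero.ne n) a.val b.val c.val (by
    rintro p hp hpn ⟨ha, hb, hc⟩
    have : Fact p.Prime := ⟨hp⟩
    have h1 := congrArg (ZMod.castHom hpn (ZMod p)) h
    have k : ∀ z : ZMod n, p ∣ z.val → ZMod.castHom hpn (ZMod p) z = 0 := by
      intro z hz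
      rw [← ZMod.natCast_zmod_val z, map_natCast]
      exact (ZMod.natCast_eq_zero_iff _ _).2 hz
    rw [map_add, map_add, map_mul, map_mul, map_mul, k a ha, k b hb, k c hc, map_one] at h1
    simp at h1)
  refine ⟨x, y, ?_⟩
  push_cast at hxy
  simpa only [ZMod.natCast_zmod_val] using hxy

/-- Few conjugates of a primitive matrix commute with it. -/
lemma card_conj_commute_le {n : ℕ} [NeZero n] (B : Matrix (Fin 2) (Fin 2) (ZMod n)) {u v w : ZMod n}
    (h : u * (B 0 0 - B 1 1) + v * B 0 1 + w * B 1 0 = 1) :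
    #{α : SpecialLinearGroup (Fin 2) (ZMod n) | B * cj α B = cj α B * B} ≤ 2 * n ^ 2 := by
  obtain ⟨x, y, hQ⟩ := exists_isUnit_form_of_primitive h
  set zc : Matrix (Fin 2) (Fin 2) (ZMod n) → ZMod n := fun C => u * (C 0 0 - C 1 1) + v * C 0 1 + w * C 1 0 with hzc
  set xc : Matrix (Fin 2) (Fin 2) (ZMod n) → ZMod n := fun C => C 1 1 - zc C * B 1 1 with hxc
  have hC : ∀ C : Matrix (Fin 2) (Fin 2) (ZMod n), B * C = C * B →
      C 0 0 = xc C + zc C * B 0 0 ∧ C 0 1 = zc C * B 0 1 ∧ C 1 0 = zc C * B 1 0 ∧ C 1 1 = xc C + zc C * B 1 1 := by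
    intro C hBC
    have h0 := congrFun (congrFun hBC 0) 0
    have h1 := congrFun (congrFun hBC 0) 1
    have h2 := congrFun (congrFun hBC 1) 0
    simp only [Matrix.mul_apply, Fin.sum_univ_two] at h0 h1 h2
    simp only [hxc, hzc]
    refine ⟨?_, ?_, ?_, by ring⟩
    · linear_combination (-(C 0 0 - C 1 1)) * h - v * h1 + w * h2
    · linear_combination (-(C 0 1)) * h + u * h1 - w * h0
    · linear_combination (-(C 1 0)) * h - u * h2 + v * h0
  set Q := B 1 0 * x ^ 2 - (B 0 0 - B 1 1) * (x * y) - B 0 1 * y ^ 2 with hQdef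
  set W : SpecialLinearGroup (Fin 2) (ZMod n) → ZMod n × ZMod n :=
    fun α => (α 0 0 * x + α 0 1 * y, α 1 0 * x + α 1 1 * y) with hW
  set s : SpecialLinearGroup (Fin 2) (ZMod n) → Fin 2 → ZMod n := fun α i =>
    α i 0 * (B 0 0 * x + B 0 1 * y) + α i 1 * (B 1 0 * x + B 1 1 * y) with hs
  have main : ∀ α : SpecialLinearGroup (Fin 2) (ZMod n), B * cj α B = cj α B * B →
      IsUnit (zc (cj α B)) ∧
      Q * zc (cj α B) = (W α).1 * (B 1 0 * (W α).1 + B 1 1 * (W α).2) - (W α).2 * (B 0 0 * (W α).1 + B 0 1 * (W α).2) ∧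
      2 * xc (cj α B) = B.trace - zc (cj α B) * B.trace ∧
      zc (cj α B) * s α 0 = B 0 0 * (W α).1 + B 0 1 * (W α).2 - xc (cj α B) * (W α).1 ∧
      zc (cj α B) * s α 1 = B 1 0 * (W α).1 + B 1 1 * (W α).2 - xc (cj α B) * (W α).2 := by
    intro α hα
    obtain ⟨e00, e01, e10, e11⟩ := hC _ hα
    have htr := trace_cj α B
    have hmul := coe_mul_cj α B
    have hdet := SL_det α
    have hunit : IsUnit (zc (cj α B)) := by
      set C := cj α B with hCdef
      have hB : B = cj α⁻¹ C := by
        rw [hCdef, cj_cj, mul_inv_cancel]; simp [cj]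
      have hCe : C = xc C • (1 : Matrix (Fin 2) (Fin 2) (ZMod n)) + zc C • B := by
        ext i j; fin_cases i <;> fin_cases j <;> simp [e00, e01, e10, e11]
      have hcj1 : cj α⁻¹ (1 : Matrix (Fin 2) (Fin 2) (ZMod n)) = 1 := by
        rw [cj, mul_one]; exact congrArg Subtype.val (inv_mul_cancel α⁻¹)
      have hB2 : B = xc C • (1 : Matrix (Fin 2) (Fin 2) (ZMod n)) + zc C • cj α⁻¹ B := by
        have : cj α⁻¹ C = xc C • cj α⁻¹ (1 : Matrix (Fin 2) (Fin 2) (ZMod n)) + zc C • cj α⁻¹ B := by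
          nth_rewrite 1 [hCe]; simp only [cj, mul_add, add_mul, mul_smul_comm, smul_mul_assoc]
        rw [hcj1] at this
        exact hB.trans this
      generalize cj α⁻¹ B = D at hB2
      generalize xc C = x₀ at hB2
      generalize zc C = z₀ at hB2 ⊢
      have b00 := congrFun (congrFun hB2 0) 0
      have b01 := congrFun (congrFun hB2 0) 1
      have b10 := congrFun (congrFun hB2 1) 0
      have b11 := congrFun (congrFun hB2 1) 1
      simp at b00 b01 b10 b11
      refine IsUnit.of_mul_eq_one (u * (D 0 0 - D 1 1) + v * D 0 1 + w * D 1 0) ?_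
      linear_combination h - u * b00 + u * b11 - v * b01 - w * b10
    have m00 := congrFun (congrFun hmul 0) 0
    have m01 := congrFun (congrFun hmul 0) 1
    have m10 := congrFun (congrFun hmul 1) 0
    have m11 := congrFun (congrFun hmul 1) 1
    simp only [Matrix.mul_apply, Fin.sum_univ_two] at m00 m01 m10 m11
    rw [e00, e10] at m00 m10
    rw [e01, e11] at m01 m11
    rw [Matrix.trace_fin_two, Matrix.trace_fin_two, e00, e11] at htr
    rw [Matrix.trace_fin_two]
    generalize zc (cj α B) = z₀ at *
    generalize xc (cj α B) = x₀ at *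
    simp only [hW, hs]
    have s0 : z₀ * (α 0 0 * (B 0 0 * x + B 0 1 * y) + α 0 1 * (B 1 0 * x + B 1 1 * y)) =
        B 0 0 * (α 0 0 * x + α 0 1 * y) + B 0 1 * (α 1 0 * x + α 1 1 * y) - x₀ * (α 0 0 * x + α 0 1 * y) := by
      linear_combination x * m00 + y * m01
    have s1 : z₀ * (α 1 0 * (B 0 0 * x + B 0 1 * y) + α 1 1 * (B 1 0 * x + B 1 1 * y)) =
        B 1 0 * (α 0 0 * x + α 0 1 * y) + B 1 1 * (α 1 0 * x + α 1 1 * y) - x₀ * (α 1 0 * x + α 1 1 * y) := by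
      linear_combination x * m10 + y * m11
    refine ⟨hunit, ?_, by linear_combination htr, s0, s1⟩
    rw [hQdef]
    linear_combination (α 0 0 * x + α 0 1 * y) * s1 - (α 1 0 * x + α 1 1 * y) * s0 -
      z₀ * (B 1 0 * x ^ 2 - (B 0 0 - B 1 1) * (x * y) - B 0 1 * y ^ 2) * hdet
  refine (card_le_mul_card_image (f := W) _ 2 ?_).trans (Nat.mul_le_mul_left _ ((card_le_univ _).trans ?_))
  · intro w₀ hw₀
    obtain ⟨α₀, hα₀, rfl⟩ := mem_image.1 hw₀
    have m₀ := main α₀ (mem_filter.1 hα₀).2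
    have hz : ∀ α, B * cj α B = cj α B * B → W α = W α₀ → zc (cj α B) = zc (cj α₀ B) := by
      intro α hα hWα
      have m := (main α hα).2.1
      rw [hWα, ← m₀.2.1] at m
      exact hQ.mul_left_cancel m
    refine le_trans (card_le_card_of_injOn (t := univ.filter fun t : ZMod n =>
      ((2 : ℕ) : ZMod n) * t = B.trace - zc (cj α₀ B) * B.trace) (fun α => xc (cj α B)) ?_ ?_)
      (card_natCast_mul_eq_le two_pos _)
    · intro α hα
      obtain ⟨h1, h2⟩ := mem_filter.1 (mem_coe.1 hα)
      refine mem_coe.2 (mem_filter.2 ⟨mem_univ _, ?_⟩)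
      rw [Nat.cast_two, ← hz α (mem_filter.1 h1).2 h2]
      exact (main α (mem_filter.1 h1).2).2.2.1
    · intro α hα β hβ hαβ
      obtain ⟨h1, h2⟩ := mem_filter.1 (mem_coe.1 hα)
      obtain ⟨h1', h2'⟩ := mem_filter.1 (mem_coe.1 hβ)
      have mα := main α (mem_filter.1 h1).2
      have mβ := main β (mem_filter.1 h1').2
      have z₁ := hz α (mem_filter.1 h1).2 h2
      have z₂ := hz β (mem_filter.1 h1').2 h2'
      have hx : xc (cj α B) = xc (cj β B) := hαβ
      have hWW : W α = W β := h2.trans h2'.symm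
      rw [z₁, hx, hWW] at mα
      rw [z₂] at mβ
      have s0 : s α 0 = s β 0 := m₀.1.mul_left_cancel (mα.2.2.2.1.trans mβ.2.2.2.1.symm)
      have s1 : s α 1 = s β 1 := m₀.1.mul_left_cancel (mα.2.2.2.2.trans mβ.2.2.2.2.symm)
      have w0 := congrArg Prod.fst hWW
      have w1 := congrArg Prod.snd hWW
      simp only [hW, hs] at s0 s1 w0 w1
      refine SL_ext ?_ ?_ ?_ ?_ <;> refine hQ.mul_left_cancel ?_ <;> rw [hQdef]
      · linear_combination (B 1 0 * x + B 1 1 * y) * w0 - y * s0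
      · linear_combination x * s0 - (B 0 0 * x + B 0 1 * y) * w0
      · linear_combination (B 1 0 * x + B 1 1 * y) * w1 - y * s1
      · linear_combination x * s1 - (B 0 0 * x + B 0 1 * y) * w1
  · rw [Fintype.card_prod, ZMod.card, sq]

lemma map_cj {R S : Type*} [CommRing R] [CommRing S] (φ : R →+* S) (α : SpecialLinearGroup (Fin 2) R)
    (B : Matrix (Fin 2) (Fin 2) R) : (cj α B).map φ = cj (SpecialLinearGroup.map φ α) (B.map φ) := by
  rw [cj, cj, Matrix.map_mul, Matrix.map_mul, ← map_inv]
  rfl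

lemma natCast_dvd_of_dvd_two_mul {n c : ℕ} [NeZero n] (hc : c ∣ n) {x : ZMod n} (h : (c : ZMod n) ∣ 2 * x) :
    ((c / c.gcd 2 : ℕ) : ZMod n) ∣ x := by
  have hd : c / c.gcd 2 ∣ n := (Nat.div_dvd_of_dvd (Nat.gcd_dvd_left c 2)).trans hc
  rw [← ZMod.natCast_zmod_val x] at h ⊢
  rw [natCast_dvd_natCast_iff hd]
  have h' : (c : ZMod n) ∣ ((2 * x.val : ℕ) : ZMod n) := by push_cast; exact h
  rw [natCast_dvd_natCast_iff hc] at h'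
  have hg : 0 < c.gcd 2 := Nat.gcd_pos_of_pos_right _ two_pos
  have hco : Nat.Coprime (c / c.gcd 2) (2 / c.gcd 2) := Nat.coprime_div_gcd_div_gcd hg
  refine hco.dvd_of_dvd_mul_left (Nat.dvd_of_mul_dvd_mul_left hg ?_)
  rw [← mul_assoc, Nat.mul_div_cancel' (Nat.gcd_dvd_left c 2), Nat.mul_div_cancel' (Nat.gcd_dvd_right c 2)]
  exact h'

lemma card_conj_commute_mod_le {n c : ℕ} [NeZero n] (hc : c ∣ n) (B : Matrix (Fin 2) (Fin 2) (ZMod n)) {u v w : ZMod n}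
    (h : u * (B 0 0 - B 1 1) + v * B 0 1 + w * B 1 0 = 1) :
    #{α : SpecialLinearGroup (Fin 2) (ZMod n) | ∀ i j, (c : ZMod n) ∣ 2 * (B * cj α B - cj α B * B) i j} * c
      ≤ 4 * n ^ 3 := by
  set d := c / c.gcd 2 with hd
  have hdc : c.gcd 2 * d = c := Nat.mul_div_cancel' (Nat.gcd_dvd_left c 2)
  have hg2 : c.gcd 2 ≤ 2 := Nat.gcd_le_right _ two_pos
  have hdn : d ∣ n := (Dvd.intro_left _ hdc).trans hc
  have : NeZero d := ⟨fun h0 => NeZero.ne n (by simpa [h0] using hdn)⟩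
  set φ := ZMod.castHom hdn (ZMod d) with hφ
  have hB : φ u * ((B.map φ) 0 0 - (B.map φ) 1 1) + φ v * (B.map φ) 0 1 + φ w * (B.map φ) 1 0 = 1 := by
    simp only [Matrix.map_apply, ← map_sub, ← map_mul, ← map_add, h, map_one]
  have h1 : #{α : SpecialLinearGroup (Fin 2) (ZMod n) | ∀ i j, (c : ZMod n) ∣ 2 * (B * cj α B - cj α B * B) i j} ≤
      (n / d) ^ 3 * (2 * d ^ 2) := by
    refine (card_le_mul_card_image (f := red hdn) _ ((n / d) ^ 3) ?_).trans (Nat.mul_le_mul_left _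
      (le_trans (card_le_card ?_) (card_conj_commute_le (B.map φ) hB)))
    · intro a _
      exact (card_le_card (filter_subset_filter _ (subset_univ _))).trans (card_red_fiber_le hdn a)
    · intro a ha
      obtain ⟨α, hα, rfl⟩ := mem_image.1 ha
      refine mem_filter.2 ⟨mem_univ _, ?_⟩
      have hα' := (mem_filter.1 hα).2
      rw [← sub_eq_zero, show cj (red hdn α) (B.map φ) = (cj α B).map φ from (map_cj φ α B).symm,
        ← Matrix.map_mul, ← Matrix.map_mul, ← Matrix.map_sub _ (fun a b => map_sub φ a b)]
      ext i j
      exact (natCast_dvd_iff hdn _).1 (natCast_dvd_of_dvd_two_mul hc (hα' i j))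
  calc _ ≤ (n / d) ^ 3 * (2 * d ^ 2) * (2 * d) := Nat.mul_le_mul h1 (by rw [← hdc]; exact Nat.mul_le_mul_right _ hg2)
    _ = 4 * (n / d * d) ^ 3 := by ring
    _ = _ := by rw [Nat.div_mul_cancel hdn]

lemma sum_commutator_le {n : ℕ} [NeZero n] (B : Matrix (Fin 2) (Fin 2) (ZMod n)) {u v w : ZMod n}
    (h : u * (B 0 0 - B 1 1) + v * B 0 1 + w * B 1 0 = 1)
    (c : SpecialLinearGroup (Fin 2) (ZMod n) → SpecialLinearGroup (Fin 2) (ZMod n) → ℕ)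
    (hc : ∀ α β, c α β ∣ n)
    (hdvd : ∀ α β i j, (c α β : ZMod n) ∣ 2 * (cj α B * cj β B - cj β B * cj α B) i j) :
    ∑ α, ∑ β, c α β ≤ 4 * #n.divisors * n ^ 6 := by
  have hconj : ∀ α β i j, (c α β : ZMod n) ∣ 2 * (B * cj (β * α⁻¹) B - cj (β * α⁻¹) B * B) i j := by
    intro α β
    set M := cj α B * cj β B - cj β B * cj α B with hM
    have : B * cj (β * α⁻¹) B - cj (β * α⁻¹) B * B = cj α⁻¹ M := by
      have hB : cj α⁻¹ (cj α B) = B := by rw [cj_cj, mul_inv_cancel]; simp [cj]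
      rw [hM, cj_sub, ← cj_mul_cj, ← cj_mul_cj, hB, cj_cj]
    intro i j
    rw [this]
    have hm : ∀ i j, (c α β : ZMod n) ∣ 2 * M i j := hdvd α β
    simp only [cj, Matrix.mul_apply, Fin.sum_univ_two]
    obtain ⟨m00, h00⟩ := hm 0 0
    obtain ⟨m01, h01⟩ := hm 0 1
    obtain ⟨m10, h10⟩ := hm 1 0
    obtain ⟨m11, h11⟩ := hm 1 1
    generalize ((α⁻¹⁻¹ : SpecialLinearGroup (Fin 2) (ZMod n)) : Matrix (Fin 2) (Fin 2) (ZMod n)) = P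
    generalize ((α⁻¹ : SpecialLinearGroup (Fin 2) (ZMod n)) : Matrix (Fin 2) (Fin 2) (ZMod n)) = Q
    refine ⟨(P i 0 * m00 + P i 1 * m10) * Q 0 j + (P i 0 * m01 + P i 1 * m11) * Q 1 j, ?_⟩
    linear_combination P i 0 * Q 0 j * h00 + P i 1 * Q 0 j * h10 + P i 0 * Q 1 j * h01 + P i 1 * Q 1 j * h11
  have h1 : ∀ α, ∑ β, c α β ≤ ∑ e ∈ n.divisors, 4 * n ^ 3 := by
    intro α
    rw [← sum_fiberwise_of_maps_to (s := univ) (t := n.divisors) (g := c α)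
      (fun β _ => Nat.mem_divisors.2 ⟨hc α β, NeZero.ne n⟩)]
    refine sum_le_sum fun e he => ?_
    have hen := (Nat.mem_divisors.1 he).1
    refine le_trans ?_ (card_conj_commute_mod_le hen B h)
    rw [sum_congr rfl (fun β hβ => (mem_filter.1 hβ).2), sum_const, smul_eq_mul]
    refine Nat.mul_le_mul_right _ (card_le_card_of_injOn (fun β => β * α⁻¹) ?_ (fun _ _ _ _ h => mul_right_cancel h))
    intro β hβ
    refine mem_coe.2 (mem_filter.2 ⟨mem_univ _, ?_⟩)
    have := hconj α β
    rwa [(mem_filter.1 (mem_coe.1 hβ)).2] at this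
  calc _ ≤ ∑ α : SpecialLinearGroup (Fin 2) (ZMod n), ∑ e ∈ n.divisors, 4 * n ^ 3 := sum_le_sum fun α _ => h1 α
    _ = Fintype.card (SpecialLinearGroup (Fin 2) (ZMod n)) * (#n.divisors * (4 * n ^ 3)) := by
      rw [sum_const, sum_const, smul_eq_mul, smul_eq_mul, card_univ]
    _ ≤ n ^ 3 * (#n.divisors * (4 * n ^ 3)) := Nat.mul_le_mul_right _ (card_SL_le n)
    _ = _ := by ring

/-- On average over conjugations, the linearised equation has few solutions. -/
lemma sum_card_solutions_le {n : ℕ} [NeZero n] (B : Matrix (Fin 2) (Fin 2) (ZMod n)) {u v w : ZMod n}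
    (h : u * (B 0 0 - B 1 1) + v * B 0 1 + w * B 1 0 = 1) (g : SpecialLinearGroup (Fin 2) (ZMod n))
    (hg : (g : Matrix (Fin 2) (Fin 2) (ZMod n)) * B = B * (g : Matrix (Fin 2) (Fin 2) (ZMod n))) :
    ∑ α : SpecialLinearGroup (Fin 2) (ZMod n), ∑ β : SpecialLinearGroup (Fin 2) (ZMod n),
      #{t : (ZMod n × ZMod n × ZMod n) × (ZMod n × ZMod n × ZMod n) |
        (cj α B * tl t.1 - tl t.1 * cj α B) * cj β (g : Matrix (Fin 2) (Fin 2) (ZMod n)) +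
          cj α (g : Matrix (Fin 2) (Fin 2) (ZMod n)) * (cj β B * tl t.2 - tl t.2 * cj β B) = 0} ≤ 8 * #n.divisors * n ^ 9 := by
  have hprim : ∀ α : SpecialLinearGroup (Fin 2) (ZMod n), ∃ u v w : ZMod n,
      u * (cj α B 0 0 - cj α B 1 1) + v * cj α B 0 1 + w * cj α B 1 0 = 1 := by
    intro α
    have hmul := coe_mul_cj α B
    have hdet := SL_det α
    have m00 := congrFun (congrFun hmul 0) 0
    have m01 := congrFun (congrFun hmul 0) 1
    have m10 := congrFun (congrFun hmul 1) 0
    have m11 := congrFun (congrFun hmul 1) 1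
    simp only [Matrix.mul_apply, Fin.sum_univ_two] at m00 m01 m10 m11
    generalize cj α B = C at *
    refine ⟨u * (α 0 0 * α 1 1 + α 0 1 * α 1 0) - v * (α 0 0 * α 0 1) + w * (α 1 0 * α 1 1),
      -2 * u * (α 0 0 * α 1 0) + v * α 0 0 ^ 2 - w * α 1 0 ^ 2,
      2 * u * (α 0 1 * α 1 1) - v * α 0 1 ^ 2 + w * α 1 1 ^ 2, ?_⟩
    linear_combination h + (u * (B 0 0 - B 1 1) + v * B 0 1 + w * B 1 0) * hdet +
      u * (α 1 1 * m00 - α 1 0 * m01 + α 0 1 * m10 - α 0 0 * m11) + v * (α 0 0 * m01 - α 0 1 * m00) +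
      w * (α 1 1 * m10 - α 1 0 * m11)
  have hcoe : ∀ α : SpecialLinearGroup (Fin 2) (ZMod n), cj α (g : Matrix (Fin 2) (Fin 2) (ZMod n)) =
      ((α⁻¹ * g * α : SpecialLinearGroup (Fin 2) (ZMod n)) : Matrix (Fin 2) (Fin 2) (ZMod n)) := fun α => rfl
  have hcomm : ∀ α : SpecialLinearGroup (Fin 2) (ZMod n),
      ((α⁻¹ * g * α : SpecialLinearGroup (Fin 2) (ZMod n)) : Matrix (Fin 2) (Fin 2) (ZMod n)) * cj α B =
      cj α B * ((α⁻¹ * g * α : SpecialLinearGroup (Fin 2) (ZMod n)) : Matrix (Fin 2) (Fin 2) (ZMod n)) := by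
    intro α
    rw [← hcoe, cj_mul_cj, cj_mul_cj, hg]
  have key : ∀ α β : SpecialLinearGroup (Fin 2) (ZMod n), ∃ c, c ∣ n ∧
      (∀ i j, (c : ZMod n) ∣ 2 * (cj α B * cj β B - cj β B * cj α B) i j) ∧
      #{t : (ZMod n × ZMod n × ZMod n) × (ZMod n × ZMod n × ZMod n) |
        (cj α B * tl t.1 - tl t.1 * cj α B) * cj β (g : Matrix (Fin 2) (Fin 2) (ZMod n)) +
          cj α (g : Matrix (Fin 2) (Fin 2) (ZMod n)) * (cj β B * tl t.2 - tl t.2 * cj β B) = 0} ≤ 2 * n ^ 3 * c := by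
    intro α β
    obtain ⟨u', v', w', h'⟩ := hprim α
    obtain ⟨c, h1, h2, h3⟩ := exists_card_solutions_le _ _ _ _ (hcomm α) (hcomm β) h'
    refine ⟨c, h1, h2, ?_⟩
    rw [hcoe, hcoe]
    exact h3
  choose c hc1 hc2 hc3 using key
  calc _ ≤ ∑ α : SpecialLinearGroup (Fin 2) (ZMod n), ∑ β : SpecialLinearGroup (Fin 2) (ZMod n), 2 * n ^ 3 * c α β :=
        sum_le_sum fun α _ => sum_le_sum fun β _ => hc3 α β
    _ = 2 * n ^ 3 * ∑ α, ∑ β, c α β := by simp only [mul_sum]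
    _ ≤ 2 * n ^ 3 * (4 * #n.divisors * n ^ 6) := Nat.mul_le_mul_left _ (sum_commutator_le B h c hc1 hc2)
    _ = _ := by ring

/-- The linearisation of a product of two conjugates along perturbations of the conjugating elements. -/
def lin {R : Type*} [CommRing R] (B G : Matrix (Fin 2) (Fin 2) R) (α β : SpecialLinearGroup (Fin 2) R)
    (z₁ z₂ : Matrix (Fin 2) (Fin 2) R) : Matrix (Fin 2) (Fin 2) R :=
  (cj α B * z₁ - z₁ * cj α B) * cj β G + cj α G * (cj β B * z₂ - z₂ * cj β B)

lemma map_lin {R S : Type*} [CommRing R] [CommRing S] (φ : R →+* S) (B G : Matrix (Fin 2) (Fin 2) R)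
    (α β : SpecialLinearGroup (Fin 2) R) (z₁ z₂ : Matrix (Fin 2) (Fin 2) R) :
    (lin B G α β z₁ z₂).map φ = lin (B.map φ) (G.map φ) (SpecialLinearGroup.map φ α) (SpecialLinearGroup.map φ β)
      (z₁.map φ) (z₂.map φ) := by
  simp only [lin, ← map_cj]
  rw [Matrix.map_add _ (map_add φ), Matrix.map_mul, Matrix.map_mul, Matrix.map_sub _ (map_sub φ),
    Matrix.map_sub _ (map_sub φ), Matrix.map_mul, Matrix.map_mul, Matrix.map_mul, Matrix.map_mul]

lemma cj_eq_add {R : Type*} [CommRing R] (k : SpecialLinearGroup (Fin 2) R) (Z B : Matrix (Fin 2) (Fin 2) R) (s g y : R)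
    (hk : (k : Matrix (Fin 2) (Fin 2) R) = 1 + y • Z) (h0 : g * y * y = 0) :
    cj k (s • (1 : Matrix (Fin 2) (Fin 2) R) + g • B) = s • (1 : Matrix (Fin 2) (Fin 2) R) + g • B + (g * y) • (B * Z - Z * B) := by
  set C := s • (1 : Matrix (Fin 2) (Fin 2) R) + g • B with hC
  have h1 : (k : Matrix (Fin 2) (Fin 2) R) * (C + (g * y) • (B * Z - Z * B)) = C * (k : Matrix (Fin 2) (Fin 2) R) := by
    have e : y • (Z * ((g * y) • (B * Z - Z * B))) = 0 := by
      rw [Matrix.mul_smul, smul_smul, mul_comm y, h0, zero_smul]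
    have e2 : y • (C * Z - Z * C) = (g * y) • (B * Z - Z * B) := by
      rw [hC, add_mul, mul_add, smul_mul_assoc, smul_mul_assoc, Matrix.mul_smul, Matrix.mul_smul, one_mul, mul_one,
        add_sub_add_left_eq_sub, ← smul_sub, smul_smul, mul_comm y]
    rw [hk, add_mul, mul_add, one_mul, smul_mul_assoc, mul_add, smul_add, e, add_zero, ← e2,
      smul_sub, one_mul, mul_add C, Matrix.mul_smul C, mul_one]
    abel
  have h2 : ((k⁻¹ : SpecialLinearGroup (Fin 2) R) : Matrix (Fin 2) (Fin 2) R) * (k : Matrix (Fin 2) (Fin 2) R) = 1 :=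
    congrArg Subtype.val (inv_mul_cancel k)
  rw [cj, mul_assoc, ← h1, ← mul_assoc, h2, one_mul]

lemma smul_lin_eq_zero {R : Type*} [CommRing R] {k₁ k₂ α β : SpecialLinearGroup (Fin 2) R}
    {Z₁ Z₂ B G : Matrix (Fin 2) (Fin 2) R} {s g y : R} (hG : G = s • (1 : Matrix (Fin 2) (Fin 2) R) + g • B)
    (hk₁ : (k₁ : Matrix (Fin 2) (Fin 2) R) = 1 + y • Z₁) (hk₂ : (k₂ : Matrix (Fin 2) (Fin 2) R) = 1 + y • Z₂)
    (h0 : g * y * y = 0) (h : cj (α * k₁) G * cj (β * k₂) G = cj α G * cj β G) :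
    (g * y) • lin B G α β Z₁ Z₂ = 0 := by
  have hcj : ∀ γ : SpecialLinearGroup (Fin 2) R, cj γ G = s • (1 : Matrix (Fin 2) (Fin 2) R) + g • cj γ B := by
    intro γ
    have h2 : ((γ⁻¹ : SpecialLinearGroup (Fin 2) R) : Matrix (Fin 2) (Fin 2) R) * (γ : Matrix (Fin 2) (Fin 2) R) = 1 :=
      congrArg Subtype.val (inv_mul_cancel γ)
    simp only [hG, cj, mul_add, add_mul, Matrix.mul_smul, smul_mul_assoc, mul_one, h2]
  have h0' : (g * y) * (g * y) = 0 := by linear_combination g * h0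
  rw [← cj_cj, ← cj_cj, hcj α, hcj β, cj_eq_add k₁ Z₁ _ s g y hk₁ h0, cj_eq_add k₂ Z₂ _ s g y hk₂ h0] at h
  rw [lin, hcj α, hcj β]
  generalize s • (1 : Matrix (Fin 2) (Fin 2) R) + g • cj α B = P at *
  generalize s • (1 : Matrix (Fin 2) (Fin 2) R) + g • cj β B = Q at *
  generalize cj α B * Z₁ - Z₁ * cj α B = D₁ at *
  generalize cj β B * Z₂ - Z₂ * cj β B = D₂ at *
  rw [add_mul, mul_add, mul_add, smul_mul_assoc, smul_mul_assoc, Matrix.mul_smul, Matrix.mul_smul, smul_smul, h0', zero_smul,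
    add_zero, add_assoc, add_eq_left, ← smul_add] at h
  rw [← h, add_comm]

lemma exists_eq_one_add {n y : ℕ} [NeZero n] (hy : y ∣ n) (k : SpecialLinearGroup (Fin 2) (ZMod n))
    (hk : red hy k = 1) : ∃ Z : Matrix (Fin 2) (Fin 2) (ZMod n),
      (k : Matrix (Fin 2) (Fin 2) (ZMod n)) = 1 + (y : ZMod n) • Z := by
  have : ∀ i j, ∃ z, (k : Matrix (Fin 2) (Fin 2) (ZMod n)) i j - (1 : Matrix (Fin 2) (Fin 2) (ZMod n)) i j = (y : ZMod n) * z := by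
    intro i j
    refine (natCast_dvd_iff hy _).2 ?_
    have h1 := congrArg (fun g : SpecialLinearGroup (Fin 2) (ZMod y) => g i j) hk
    simp only [red_apply] at h1
    have e : ZMod.castHom hy (ZMod y) ((1 : Matrix (Fin 2) (Fin 2) (ZMod n)) i j) =
        (1 : Matrix (Fin 2) (Fin 2) (ZMod y)) i j := by
      rw [Matrix.one_apply, Matrix.one_apply]; split_ifs <;> simp only [map_one, map_zero]
    rw [map_sub, e]
    exact sub_eq_zero.2 h1
  choose Z hZ using this
  refine ⟨Matrix.of Z, ?_⟩
  ext i j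
  rw [Matrix.add_apply, Matrix.smul_apply, smul_eq_mul, Matrix.of_apply, ← hZ]; ring

lemma map_eq_tl {n y n' : ℕ} [NeZero n] (hn' : y * n' ∣ n) (hny : n' ∣ y)
    (k : SpecialLinearGroup (Fin 2) (ZMod n)) {Z : Matrix (Fin 2) (Fin 2) (ZMod n)}
    (hk : (k : Matrix (Fin 2) (Fin 2) (ZMod n)) = 1 + (y : ZMod n) • Z) :
    Z.map (ZMod.castHom ((Dvd.intro_left y rfl).trans hn') (ZMod n')) =
      tl (ZMod.castHom ((Dvd.intro_left y rfl).trans hn') (ZMod n') (Z 0 0),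
        ZMod.castHom ((Dvd.intro_left y rfl).trans hn') (ZMod n') (Z 0 1),
        ZMod.castHom ((Dvd.intro_left y rfl).trans hn') (ZMod n') (Z 1 0)) := by
  obtain ⟨r, hr⟩ := hn'
  have hd := SL_det k
  rw [hk] at hd
  simp at hd
  have h1 : (y : ZMod n) * (Z 0 0 + Z 1 1 + y * (Z 0 0 * Z 1 1 - Z 0 1 * Z 1 0)) = 0 := by linear_combination hd
  have h2 := cast_eq_zero_of_mul (g := y) (k := n' * r) (by rw [← mul_assoc, hr]) h1
  rw [← natCast_dvd_iff] at h2
  have hdn : n' ∣ n := ⟨y * r, by rw [hr]; ring⟩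
  have h3 : (n' : ZMod n) ∣ Z 0 0 + Z 1 1 := by
    have e1 : (n' : ZMod n) ∣ ((n' * r : ℕ) : ZMod n) := Nat.cast_dvd_cast (Dvd.intro _ rfl)
    have e2 : (n' : ZMod n) ∣ (y : ZMod n) := Nat.cast_dvd_cast hny
    exact (dvd_add_left (e2.mul_right _)).1 (e1.trans h2)
  rw [natCast_dvd_iff hdn, map_add] at h3
  ext i j
  fin_cases i <;> fin_cases j <;> simp [tl]
  simpa using eq_neg_of_add_eq_zero_right h3

lemma le_card_ker_red {n y : ℕ} [NeZero n] (hyn : y ∣ n) (hy : ∀ p : ℕ, p.Prime → p ∣ n → p ∣ y) :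
    (n / y) ^ 3 ≤ #{k : SpecialLinearGroup (Fin 2) (ZMod n) | red hyn k = 1} := by
  set φ := ZMod.castHom hyn (ZMod y) with hφ
  have hunit : ∀ x : ZMod n, φ x = 1 → IsUnit x := by
    intro x hx
    have := isUnit_intCast_of_forall_prime (n := n) (x := (x.val : ℤ)) (by
      intro p hp hpn hpx
      have hpx' : p ∣ x.val := Int.natCast_dvd_natCast.1 hpx
      have : Fact p.Prime := ⟨hp⟩
      have hpy := hy p hp hpn
      have h1 := congrArg (ZMod.castHom hpy (ZMod p)) hx
      rw [← ZMod.natCast_zmod_val x, map_natCast, map_natCast, map_one,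
        (ZMod.natCast_eq_zero_iff _ _).2 hpx'] at h1
      exact zero_ne_one h1)
    simpa using this
  set S := (univ.filter fun x : ZMod n => φ x = 1) ×ˢ ((univ.filter fun x : ZMod n => φ x = 0) ×ˢ
    (univ.filter fun x : ZMod n => φ x = 0)) with hS
  have hcard : #S = (n / y) ^ 3 := by
    rw [hS, card_product, card_product, card_cast_fiber, card_cast_fiber]; ring
  rw [← hcard]
  have hdet : ∀ t : ZMod n × ZMod n × ZMod n, t ∈ S →
      (!![t.1, t.2.1; t.2.2, t.1⁻¹ * (1 + t.2.1 * t.2.2)] : Matrix (Fin 2) (Fin 2) (ZMod n)).det = 1 := by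
    intro t ht
    have ht1 := (mem_filter.1 (mem_product.1 ht).1).2
    rw [Matrix.det_fin_two_of]
    linear_combination (1 + t.2.1 * t.2.2) * ZMod.mul_inv_of_unit _ (hunit _ ht1)
  have hex : ∀ t : ZMod n × ZMod n × ZMod n, ∃ k : SpecialLinearGroup (Fin 2) (ZMod n), t ∈ S →
      k 0 0 = t.1 ∧ k 0 1 = t.2.1 ∧ k 1 0 = t.2.2 ∧ k 1 1 = t.1⁻¹ * (1 + t.2.1 * t.2.2) := by
    intro t
    by_cases ht : t ∈ S
    · exact ⟨⟨_, hdet t ht⟩, fun _ => ⟨rfl, rfl, rfl, rfl⟩⟩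
    · exact ⟨1, fun h => absurd h ht⟩
  choose f hf using hex
  refine card_le_card_of_injOn f ?_ ?_
  · intro t ht
    have ht' := mem_coe.1 ht
    obtain ⟨f0, f1, f2, f3⟩ := hf t ht'
    have h1 := (mem_filter.1 (mem_product.1 ht').1).2
    have h2 := (mem_filter.1 (mem_product.1 (mem_product.1 ht').2).1).2
    have h3 := (mem_filter.1 (mem_product.1 (mem_product.1 ht').2).2).2
    refine mem_coe.2 (mem_filter.2 ⟨mem_univ _, ?_⟩)
    have e : φ (t.1⁻¹ * (1 + t.2.1 * t.2.2)) = 1 := by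
      have := congrArg φ (ZMod.mul_inv_of_unit _ (hunit _ h1))
      rw [map_mul, h1, one_mul, map_one] at this
      rw [map_mul, map_add, map_mul, h2, h3, this, map_one]; ring
    refine SL_ext ?_ ?_ ?_ ?_ <;> rw [red_apply]
    · rw [f0]; exact h1
    · rw [f1]; exact h2
    · rw [f2]; exact h3
    · rw [f3]; exact e
  · intro t ht t' ht' htt
    obtain ⟨f0, f1, f2, -⟩ := hf t (mem_coe.1 ht)
    obtain ⟨g0, g1, g2, -⟩ := hf t' (mem_coe.1 ht')
    rw [htt] at f0 f1 f2
    exact Prod.ext (f0.symm.trans g0) (Prod.ext (f1.symm.trans g1) (f2.symm.trans g2))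

lemma red_eq_red_of {n y n' : ℕ} [NeZero n] (hn' : y * n' ∣ n)
    {k k₀ : SpecialLinearGroup (Fin 2) (ZMod n)} {Z Z₀ : Matrix (Fin 2) (Fin 2) (ZMod n)}
    (hk : (k : Matrix (Fin 2) (Fin 2) (ZMod n)) = 1 + (y : ZMod n) • Z)
    (hk₀ : (k₀ : Matrix (Fin 2) (Fin 2) (ZMod n)) = 1 + (y : ZMod n) • Z₀)
    (h : Z.map (ZMod.castHom ((Dvd.intro_left y rfl).trans hn') (ZMod n')) =
      Z₀.map (ZMod.castHom ((Dvd.intro_left y rfl).trans hn') (ZMod n'))) : red hn' k = red hn' k₀ := by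
  ext i j
  rw [red_apply, red_apply, ← sub_eq_zero, ← map_sub, ← natCast_dvd_iff, hk, hk₀]
  have h1 : (n' : ZMod n) ∣ Z i j - Z₀ i j := by
    rw [natCast_dvd_iff ((Dvd.intro_left y rfl).trans hn'), map_sub, sub_eq_zero]
    exact congrFun (congrFun h i) j
  rw [Matrix.add_apply, Matrix.add_apply, add_sub_add_left_eq_sub, Matrix.smul_apply, Matrix.smul_apply, ← smul_sub,
    smul_eq_mul, Nat.cast_mul]
  exact mul_dvd_mul_left _ h1

/-- Perturbing two conjugating elements inside a congruence subgroup, the product of the conjugates takes a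
given value at most as often as the linearised equation has solutions. -/
lemma card_perturb_le {n g y n' : ℕ} [NeZero n] [NeZero n'] (hX : g * y * n' ∣ n) (hyn : y ∣ n) (hn' : y * n' ∣ n)
    (hny : n' ∣ y) (hn'n : n' ∣ n)
    (h α β : SpecialLinearGroup (Fin 2) (ZMod n)) {B : Matrix (Fin 2) (Fin 2) (ZMod n)} {s : ZMod n}
    (hB : (h : Matrix (Fin 2) (Fin 2) (ZMod n)) = s • (1 : Matrix (Fin 2) (Fin 2) (ZMod n)) + (g : ZMod n) • B) :
    #{r : SpecialLinearGroup (Fin 2) (ZMod n) × SpecialLinearGroup (Fin 2) (ZMod n) |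
        (red hyn r.1 = 1 ∧ red hyn r.2 = 1) ∧
        red hX ((α * r.1)⁻¹ * h * (α * r.1) * ((β * r.2)⁻¹ * h * (β * r.2))) = red hX (α⁻¹ * h * α * (β⁻¹ * h * β))} ≤
      (n / (y * n')) ^ 6 *
        #{t : (ZMod n' × ZMod n' × ZMod n') × (ZMod n' × ZMod n' × ZMod n') |
          lin (B.map (ZMod.castHom hn'n (ZMod n'))) ((h : Matrix (Fin 2) (Fin 2) (ZMod n)).map (ZMod.castHom hn'n (ZMod n')))
            (red hn'n α) (red hn'n β) (tl t.1) (tl t.2) = 0} := by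
  have hZ : ∀ k : SpecialLinearGroup (Fin 2) (ZMod n), ∃ Z : Matrix (Fin 2) (Fin 2) (ZMod n), red hyn k = 1 →
      (k : Matrix (Fin 2) (Fin 2) (ZMod n)) = 1 + (y : ZMod n) • Z := by
    intro k
    by_cases hk : red hyn k = 1
    · obtain ⟨Z, hZ⟩ := exists_eq_one_add hyn k hk
      exact ⟨Z, fun _ => hZ⟩
    · exact ⟨0, fun h => absurd h hk⟩
  choose Z hZ using hZ
  set φ := ZMod.castHom hn'n (ZMod n') with hφ
  set ζ : SpecialLinearGroup (Fin 2) (ZMod n) → ZMod n' × ZMod n' × ZMod n' :=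
    fun k => (φ (Z k 0 0), φ (Z k 0 1), φ (Z k 1 0)) with hζ
  have hζ' : ∀ k, red hyn k = 1 → (Z k).map φ = tl (ζ k) := fun k hk => map_eq_tl hn' hny k (hZ k hk)
  refine (card_le_mul_card_image (f := fun r => (ζ r.1, ζ r.2)) _ ((n / (y * n')) ^ 6) ?_).trans
    (Nat.mul_le_mul_left _ (card_le_card ?_))
  · intro t ht
    obtain ⟨r₀, hr₀, rfl⟩ := mem_image.1 ht
    have hr₀' := (mem_filter.1 hr₀).2.1
    refine (card_le_card (t := (univ.filter fun k => red hn' k = red hn' r₀.1) ×ˢ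
      (univ.filter fun k => red hn' k = red hn' r₀.2)) ?_).trans ?_
    · intro r hr
      obtain ⟨hr1, hr2⟩ := mem_filter.1 hr
      have hr' := (mem_filter.1 hr1).2.1
      have e1 : ζ r.1 = ζ r₀.1 := congrArg Prod.fst hr2
      have e2 : ζ r.2 = ζ r₀.2 := congrArg Prod.snd hr2
      refine mem_product.2 ⟨mem_filter.2 ⟨mem_univ _, ?_⟩, mem_filter.2 ⟨mem_univ _, ?_⟩⟩
      · exact red_eq_red_of hn' (hZ _ hr'.1) (hZ _ hr₀'.1) ((hζ' _ hr'.1).trans (by rw [e1]; exact (hζ' _ hr₀'.1).symm))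
      · exact red_eq_red_of hn' (hZ _ hr'.2) (hZ _ hr₀'.2) ((hζ' _ hr'.2).trans (by rw [e2]; exact (hζ' _ hr₀'.2).symm))
    · rw [card_product]
      calc _ ≤ (n / (y * n')) ^ 3 * (n / (y * n')) ^ 3 := Nat.mul_le_mul (card_red_fiber_le _ _) (card_red_fiber_le _ _)
        _ = _ := by ring
  · intro t ht
    obtain ⟨r, hr, rfl⟩ := mem_image.1 ht
    obtain ⟨⟨hr1, hr2⟩, hr3⟩ := (mem_filter.1 hr).2
    refine mem_filter.2 ⟨mem_univ _, ?_⟩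
    show lin _ _ _ _ (tl (ζ r.1)) (tl (ζ r.2)) = 0
    rw [← hζ' _ hr1, ← hζ' _ hr2]
    have hm := map_lin φ B (h : Matrix (Fin 2) (Fin 2) (ZMod n)) α β (Z r.1) (Z r.2)
    refine hm.symm.trans ?_
    have hXne : NeZero (g * y * n') := ⟨fun h0 => NeZero.ne n (by simpa [h0] using hX)⟩
    set ψ := ZMod.castHom hX (ZMod (g * y * n')) with hψ
    have hψ1 : ((1 : Matrix (Fin 2) (Fin 2) (ZMod n))).map ψ = 1 := Matrix.map_one _ (map_zero ψ) (map_one ψ)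
    have hmap : ∀ k, red hyn k = 1 → ((red hX k : SpecialLinearGroup (Fin 2) (ZMod (g * y * n'))) :
        Matrix (Fin 2) (Fin 2) (ZMod (g * y * n'))) = 1 + (y : ZMod (g * y * n')) • (Z k).map ψ := by
      intro k hk
      have : (k : Matrix (Fin 2) (Fin 2) (ZMod n)).map ψ = (1 + (y : ZMod n) • Z k).map ψ :=
        congrArg (fun M => M.map ψ) (hZ k hk)
      rw [Matrix.map_add _ (map_add ψ), hψ1] at this
      refine Eq.trans this ?_
      congr 1
      ext i j
      simp only [Matrix.map_apply, Matrix.smul_apply, smul_eq_mul, map_mul, map_natCast]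
    have hGm : (h : Matrix (Fin 2) (Fin 2) (ZMod n)).map ψ = (ψ s) • (1 : Matrix (Fin 2) (Fin 2) (ZMod (g * y * n'))) +
        (g : ZMod (g * y * n')) • B.map ψ := by
      rw [hB, Matrix.map_add _ (map_add ψ)]
      congr 1
      · rw [← hψ1]; ext i j
        simp only [Matrix.map_apply, Matrix.smul_apply, smul_eq_mul, map_mul]
      · ext i j
        simp only [Matrix.map_apply, Matrix.smul_apply, smul_eq_mul, map_mul, map_natCast]
    have h0 : (g : ZMod (g * y * n')) * y * y = 0 := by
      obtain ⟨w, hw⟩ := hny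
      have : ((g * y * n' : ℕ) : ZMod (g * y * n')) = 0 := ZMod.natCast_self _
      rw [← Nat.cast_mul, ← Nat.cast_mul, ZMod.natCast_eq_zero_iff]
      exact mul_dvd_mul_left _ (hw ▸ Dvd.intro _ rfl)
    have hprod : cj (red hX α * red hX r.1) ((h : Matrix (Fin 2) (Fin 2) (ZMod n)).map ψ) *
        cj (red hX β * red hX r.2) ((h : Matrix (Fin 2) (Fin 2) (ZMod n)).map ψ) =
        cj (red hX α) ((h : Matrix (Fin 2) (Fin 2) (ZMod n)).map ψ) * cj (red hX β) ((h : Matrix (Fin 2) (Fin 2) (ZMod n)).map ψ) := by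
      have := congrArg Subtype.val hr3
      simp only [map_mul, map_inv] at this
      exact this
    have hfin := smul_lin_eq_zero hGm (hmap _ hr1) (hmap _ hr2) h0 hprod
    have hm2 := map_lin ψ B (h : Matrix (Fin 2) (Fin 2) (ZMod n)) α β (Z r.1) (Z r.2)
    have hfin2 : ((g : ZMod (g * y * n')) * y) • (lin B (h : Matrix (Fin 2) (Fin 2) (ZMod n)) α β (Z r.1) (Z r.2)).map ψ = 0 := by
      rw [hm2]; exact hfin
    ext i j
    have hij := congrFun (congrFun hfin2 i) j
    rw [Matrix.smul_apply, Matrix.map_apply, smul_eq_mul, ← Nat.cast_mul, Matrix.zero_apply] at hij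
    have := cast_eq_zero_of_mul rfl hij
    rw [Matrix.map_apply, Matrix.zero_apply]
    rw [hψ, ← RingHom.comp_apply] at this
    convert this using 2
    exact Subsingleton.elim _ _

/-- The number of ways of writing `v` as a product of the images of `m` conjugates of `h`. -/
def cnt {H L : Type*} [Group H] [Fintype H] [Group L] [DecidableEq L] (π : H →* L) (h : H) : ℕ → L → ℕ
  | 0, v => if v = 1 then 1 else 0
  | m + 1, v => ∑ α : H, cnt π h m (v * (π (α⁻¹ * h * α))⁻¹)

lemma sum_cnt_fiber {H L L' : Type*} [Group H] [Fintype H] [Group L] [Fintype L] [DecidableEq L] [Group L'] [DecidableEq L']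
    (π : H →* L) (ψ : L →* L') (h : H) (m : ℕ) (v : L') :
    ∑ w ∈ univ.filter (fun w : L => ψ w = v), cnt π h m w = cnt (ψ.comp π) h m v := by
  induction m generalizing v with
  | zero =>
    simp only [cnt]
    rw [sum_ite_eq']
    simp [eq_comm]
  | succ m ih =>
    simp only [cnt]
    rw [sum_comm]
    refine sum_congr rfl fun α _ => ?_
    rw [← ih]
    refine sum_nbij' (fun w => w * (π (α⁻¹ * h * α))⁻¹) (fun w => w * π (α⁻¹ * h * α)) ?_ ?_ ?_ ?_ ?_
    · intro w hw
      have := (mem_filter.1 hw).2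
      refine mem_filter.2 ⟨mem_univ _, ?_⟩
      rw [map_mul ψ, this, map_inv ψ]; rfl
    · intro w hw
      have := (mem_filter.1 hw).2
      refine mem_filter.2 ⟨mem_univ _, ?_⟩
      rw [map_mul ψ, this, MonoidHom.comp_apply, inv_mul_cancel_right]
    · intro w _; exact inv_mul_cancel_right _ _
    · intro w _; exact mul_inv_cancel_right _ _
    · intro w _; rfl

lemma cnt_add_two {H L : Type*} [Group H] [Fintype H] [Group L] [DecidableEq L] (π : H →* L) (h : H) (m : ℕ) (v : L) :
    cnt π h (m + 2) v = ∑ β : H, ∑ α : H, cnt π h m (v * (π (α⁻¹ * h * α * (β⁻¹ * h * β)))⁻¹) := by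
  show ∑ β : H, ∑ α : H, cnt π h m _ = _
  refine sum_congr rfl fun β _ => sum_congr rfl fun α _ => ?_
  rw [map_mul π (α⁻¹ * h * α), _root_.mul_inv_rev, mul_assoc]

lemma sum_comp_le_mul {ι L : Type*} [DecidableEq L] (S : Finset ι) (w : ι → L) (f : L → ℕ) (M V : ℕ)
    (hM : ∀ i ∈ S, #{j ∈ S | w j = w i} ≤ M) (hV : ∑ v ∈ S.image w, f v ≤ V) : ∑ i ∈ S, f (w i) ≤ M * V := by
  rw [sum_comp f w]
  calc _ ≤ ∑ v ∈ S.image w, M * f v := sum_le_sum fun v hv => by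
        obtain ⟨i, hi, rfl⟩ := mem_image.1 hv
        exact Nat.mul_le_mul_right _ (hM i hi)
    _ = M * ∑ v ∈ S.image w, f v := by rw [mul_sum]
    _ ≤ _ := Nat.mul_le_mul_left _ hV

lemma sum_translate {H : Type*} [Group H] [Fintype H] (K : Finset H) (f : H → H → ℕ) :
    #K ^ 2 * ∑ β, ∑ α, f α β = ∑ β, ∑ α, ∑ r ∈ K ×ˢ K, f (α * r.1) (β * r.2) := by
  have h1 : ∀ β, ∑ α, ∑ r ∈ K ×ˢ K, f (α * r.1) (β * r.2) = ∑ r ∈ K ×ˢ K, ∑ α, f α (β * r.2) := by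
    intro β
    rw [sum_comm]
    exact sum_congr rfl fun r _ => Equiv.sum_comp (Equiv.mulRight r.1) fun α => f α (β * r.2)
  have h2 : ∑ β, ∑ r ∈ K ×ˢ K, ∑ α, f α (β * r.2) = ∑ r ∈ K ×ˢ K, ∑ β, ∑ α, f α β := by
    rw [sum_comm]
    exact sum_congr rfl fun r _ => Equiv.sum_comp (Equiv.mulRight r.2) fun β => ∑ α, f α β
  rw [sum_congr rfl fun β _ => h1 β, h2, sum_const, card_product, smul_eq_mul, sq]

lemma red_conj_eq {n g y : ℕ} [NeZero n] (hY : g * y ∣ n) (hyn : y ∣ n) (h α ρ : SpecialLinearGroup (Fin 2) (ZMod n))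
    {B : Matrix (Fin 2) (Fin 2) (ZMod n)} {s : ZMod n}
    (hB : (h : Matrix (Fin 2) (Fin 2) (ZMod n)) = s • (1 : Matrix (Fin 2) (Fin 2) (ZMod n)) + (g : ZMod n) • B)
    (hρ : red hyn ρ = 1) : red hY ((α * ρ)⁻¹ * h * (α * ρ)) = red hY (α⁻¹ * h * α) := by
  set x := α⁻¹ * h * α with hx
  have hx2 : (x : Matrix (Fin 2) (Fin 2) (ZMod n)) = s • (1 : Matrix (Fin 2) (Fin 2) (ZMod n)) + (g : ZMod n) • cj α B := by
    have h2 : ((α⁻¹ : SpecialLinearGroup (Fin 2) (ZMod n)) : Matrix (Fin 2) (Fin 2) (ZMod n)) *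
        (α : Matrix (Fin 2) (Fin 2) (ZMod n)) = 1 := congrArg Subtype.val (inv_mul_cancel α)
    have e : (x : Matrix (Fin 2) (Fin 2) (ZMod n)) = cj α (h : Matrix (Fin 2) (Fin 2) (ZMod n)) := rfl
    rw [e, hB]
    simp only [cj, mul_add, add_mul, Matrix.mul_smul, smul_mul_assoc, mul_one, h2]
  have key : red hY (x * ρ) = red hY (ρ * x) := by
    obtain ⟨Z, hZ⟩ := exists_eq_one_add hyn ρ hρ
    have hm : ((x * ρ : SpecialLinearGroup (Fin 2) (ZMod n)) : Matrix (Fin 2) (Fin 2) (ZMod n)) -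
        ((ρ * x : SpecialLinearGroup (Fin 2) (ZMod n)) : Matrix (Fin 2) (Fin 2) (ZMod n)) =
        ((g * y : ℕ) : ZMod n) • (cj α B * Z - Z * cj α B) := by
      rw [Matrix.SpecialLinearGroup.coe_mul x ρ, Matrix.SpecialLinearGroup.coe_mul ρ x, hx2, hZ]
      simp only [mul_add, add_mul, Matrix.mul_smul, smul_mul_assoc, mul_one, one_mul, Nat.cast_mul, smul_sub, smul_smul]
      rw [mul_comm (y : ZMod n) s, mul_comm (y : ZMod n) g]
      abel
    ext i j
    rw [red_apply, red_apply, ← sub_eq_zero, ← map_sub, ← natCast_dvd_iff]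
    have := congrFun (congrFun hm i) j
    rw [Matrix.sub_apply, Matrix.smul_apply, smul_eq_mul] at this
    exact ⟨_, this⟩
  have e : (α * ρ)⁻¹ * h * (α * ρ) = ρ⁻¹ * (x * ρ) := by rw [hx]; group
  rw [e, map_mul (red hY), key, ← map_mul (red hY)]; group

lemma red_red {a b n : ℕ} (h₁ : a ∣ b) (h₂ : b ∣ n) (h₃ : a ∣ n) (x : SpecialLinearGroup (Fin 2) (ZMod n)) :
    red h₁ (red h₂ x) = red h₃ x := by
  ext i j
  rw [red_apply, red_apply, red_apply, ← RingHom.comp_apply]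
  congr 1
  exact Subsingleton.elim _ _

/-- Summing over a group a function of the image under a homomorphism. -/
lemma sum_comp_hom_le {H : Type*} [Fintype H] {L : Type*} [Fintype L] [DecidableEq L] (π : H → L) (f : L → ℕ) (c : ℕ)
    (hc : ∀ v, #{x | π x = v} ≤ c) : ∑ x, f (π x) ≤ c * ∑ v, f v := by
  rw [← sum_fiberwise univ π, mul_sum]
  refine sum_le_sum fun v _ => ?_
  rw [sum_congr rfl fun x hx => by rw [(mem_filter.1 hx).2], sum_const, smul_eq_mul]
  exact Nat.mul_le_mul_right _ (hc v)

lemma cnt_step_le {n g y n' : ℕ} [NeZero n] [NeZero n'] (hX : g * y * n' ∣ n) (hY : g * y ∣ n) (hyn : y ∣ n)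
    (hyrad : ∀ p : ℕ, p.Prime → p ∣ n → p ∣ y) (hn' : y * n' ∣ n) (hny : n' ∣ y) (hn'n : n' ∣ n)
    (h : SpecialLinearGroup (Fin 2) (ZMod n)) {B : Matrix (Fin 2) (Fin 2) (ZMod n)} {s : ZMod n}
    (hB : (h : Matrix (Fin 2) (Fin 2) (ZMod n)) = s • (1 : Matrix (Fin 2) (Fin 2) (ZMod n)) + (g : ZMod n) • B)
    {u v w : ZMod n'} (hprim : u * (B.map (ZMod.castHom hn'n (ZMod n')) 0 0 - B.map (ZMod.castHom hn'n (ZMod n')) 1 1) +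
      v * B.map (ZMod.castHom hn'n (ZMod n')) 0 1 + w * B.map (ZMod.castHom hn'n (ZMod n')) 1 0 = 1)
    {m V : ℕ} (hV : ∀ v, cnt (red hY) h m v ≤ V) (x : SpecialLinearGroup (Fin 2) (ZMod (g * y * n'))) :
    n' ^ 3 * cnt (red hX) h (m + 2) x ≤ 8 * #n.divisors * n ^ 6 * V := by
  have hn0 : n ≠ 0 := NeZero.ne n
  have : NeZero (g * y * n') := ⟨fun h0 => hn0 (Nat.eq_zero_of_zero_dvd (h0 ▸ hX))⟩
  have : NeZero (g * y) := ⟨fun h0 => hn0 (Nat.eq_zero_of_zero_dvd (h0 ▸ hY))⟩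
  set φ := ZMod.castHom hn'n (ZMod n') with hφ
  set hm := (h : Matrix (Fin 2) (Fin 2) (ZMod n)).map φ with hhm
  let sols : SpecialLinearGroup (Fin 2) (ZMod n') → SpecialLinearGroup (Fin 2) (ZMod n') → ℕ := fun α β =>
    #{t : (ZMod n' × ZMod n' × ZMod n') × (ZMod n' × ZMod n' × ZMod n') |
      lin (B.map φ) hm α β (tl t.1) (tl t.2) = 0}
  let K : Finset (SpecialLinearGroup (Fin 2) (ZMod n)) := univ.filter fun k => red hyn k = 1
  let c : SpecialLinearGroup (Fin 2) (ZMod n) → SpecialLinearGroup (Fin 2) (ZMod n) →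
    SpecialLinearGroup (Fin 2) (ZMod n) := fun α β => α⁻¹ * h * α * (β⁻¹ * h * β)
  have hK : ∀ {k}, k ∈ K ↔ red hyn k = 1 := fun {k} => by simp [K]
  have hKn' : ∀ k ∈ K, red hn'n k = 1 := by
    intro k hk
    rw [← red_red hny hyn hn'n, hK.1 hk, map_one]
  have inner : ∀ α β, ∑ r ∈ K ×ˢ K, cnt (red hX) h m (x * (red hX (c (α * r.1) (β * r.2)))⁻¹) ≤
      (n / (y * n')) ^ 6 * sols (red hn'n α) (red hn'n β) * V := by
    intro α β
    refine sum_comp_le_mul (K ×ˢ K) (fun r => x * (red hX (c (α * r.1) (β * r.2)))⁻¹) (cnt (red hX) h m) _ V ?_ ?_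
    · rintro ⟨a, b⟩ hr
      obtain ⟨ha, hb⟩ := mem_product.1 hr
      have hp := card_perturb_le hX hyn hn' hny hn'n h (α * a) (β * b) hB
      have e1 : red hn'n (α * a) = red hn'n α := by rw [map_mul (red hn'n), hKn' a ha, mul_one]
      have e2 : red hn'n (β * b) = red hn'n β := by rw [map_mul (red hn'n), hKn' b hb, mul_one]
      rw [e1, e2] at hp
      refine le_trans ?_ hp
      refine card_le_card_of_injOn (fun r => (a⁻¹ * r.1, b⁻¹ * r.2)) ?_ ?_
      · rintro ⟨a', b'⟩ hr'
        have hr' := mem_coe.1 hr'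
        rw [mem_filter, mem_product] at hr'
        obtain ⟨⟨ha', hb'⟩, he⟩ := hr'
        refine mem_coe.2 (mem_filter.2 ⟨mem_univ _, ⟨?_, ?_⟩, ?_⟩)
        · show red hyn (a⁻¹ * a') = 1
          rw [map_mul (red hyn), map_inv (red hyn), hK.1 ha, hK.1 ha']; group
        · show red hyn (b⁻¹ * b') = 1
          rw [map_mul (red hyn), map_inv (red hyn), hK.1 hb, hK.1 hb']; group
        · have he' := inv_injective (mul_left_cancel he)
          simp only [c] at he'
          rw [mul_assoc α, mul_assoc β, mul_inv_cancel_left, mul_inv_cancel_left]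
          exact he'
      · rintro ⟨a₁, b₁⟩ _ ⟨a₂, b₂⟩ _ he
        have := Prod.ext_iff.1 he
        exact Prod.ext (mul_left_cancel this.1) (mul_left_cancel this.2)
    · have hYX : g * y ∣ g * y * n' := Dvd.intro _ rfl
      let ψ := red hYX
      have hcomp : ψ.comp (red hX) = red hY := MonoidHom.ext fun z => red_red hYX hX hY z
      have h1 := sum_cnt_fiber (red hX) ψ h m (ψ x * (red hY (c α β))⁻¹)
      rw [hcomp] at h1
      refine le_trans (le_trans (sum_le_sum_of_subset ?_) h1.le) (hV _)
      intro z hz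
      obtain ⟨r, hr, rfl⟩ := mem_image.1 hz
      obtain ⟨ha, hb⟩ := mem_product.1 hr
      refine mem_filter.2 ⟨mem_univ _, ?_⟩
      rw [map_mul ψ, map_inv ψ]
      congr 2
      rw [show ψ (red hX (c (α * r.1) (β * r.2))) = red hY (c (α * r.1) (β * r.2)) from red_red hYX hX hY _]
      simp only [c]
      rw [map_mul (red hY), map_mul (red hY) (α⁻¹ * h * α), red_conj_eq hY hyn h α r.1 hB (hK.1 ha),
        red_conj_eq hY hyn h β r.2 hB (hK.1 hb)]
  have hcomm : ((red hn'n h : SpecialLinearGroup (Fin 2) (ZMod n')) : Matrix (Fin 2) (Fin 2) (ZMod n')) * B.map φ =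
      B.map φ * ((red hn'n h : SpecialLinearGroup (Fin 2) (ZMod n')) : Matrix (Fin 2) (Fin 2) (ZMod n')) := by
    have e : ((red hn'n h : SpecialLinearGroup (Fin 2) (ZMod n')) : Matrix (Fin 2) (Fin 2) (ZMod n')) = hm := rfl
    rw [e, hhm, ← Matrix.map_mul, ← Matrix.map_mul, hB]
    simp only [add_mul, mul_add, smul_mul_assoc, Matrix.mul_smul, one_mul, mul_one]
  have hsum : ∑ α, ∑ β, sols α β ≤ 8 * #n'.divisors * n' ^ 9 := sum_card_solutions_le (B.map φ) hprim (red hn'n h) hcomm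
  have hsum2 : ∑ β : SpecialLinearGroup (Fin 2) (ZMod n), ∑ α : SpecialLinearGroup (Fin 2) (ZMod n),
      sols (red hn'n α) (red hn'n β) ≤ (n / n') ^ 6 * (8 * #n'.divisors * n' ^ 9) := by
    calc _ ≤ ∑ β : SpecialLinearGroup (Fin 2) (ZMod n), (n / n') ^ 3 * ∑ α, sols α (red hn'n β) :=
          sum_le_sum fun β _ => sum_comp_hom_le (red hn'n) (fun α => sols α (red hn'n β)) _ fun a => card_red_fiber_le hn'n a
      _ ≤ (n / n') ^ 3 * ∑ β, (n / n') ^ 3 * ∑ α, sols α β :=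
          sum_comp_hom_le (red hn'n) (fun β => (n / n') ^ 3 * ∑ α, sols α β) _ fun a => card_red_fiber_le hn'n a
      _ = (n / n') ^ 6 * ∑ β, ∑ α, sols α β := by rw [← mul_sum]; ring
      _ ≤ _ := by rw [sum_comm]; exact Nat.mul_le_mul_left _ hsum
  have hmain : #K ^ 2 * cnt (red hX) h (m + 2) x ≤
      (n / (y * n')) ^ 6 * ((n / n') ^ 6 * (8 * #n'.divisors * n' ^ 9)) * V := by
    rw [cnt_add_two, sum_translate K fun α β => cnt (red hX) h m (x * (red hX (c α β))⁻¹)]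
    calc _ ≤ ∑ β : SpecialLinearGroup (Fin 2) (ZMod n), ∑ α : SpecialLinearGroup (Fin 2) (ZMod n),
          (n / (y * n')) ^ 6 * sols (red hn'n α) (red hn'n β) * V :=
          sum_le_sum fun β _ => sum_le_sum fun α _ => inner α β
      _ = (n / (y * n')) ^ 6 * (∑ β : SpecialLinearGroup (Fin 2) (ZMod n), ∑ α : SpecialLinearGroup (Fin 2) (ZMod n),
          sols (red hn'n α) (red hn'n β)) * V := by simp only [← sum_mul, ← mul_sum]
      _ ≤ _ := Nat.mul_le_mul_right _ (Nat.mul_le_mul_left _ hsum2)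
  have hKc : (n / y) ^ 3 ≤ #K := le_card_ker_red hyn hyrad
  have hny' : n / y = n / (y * n') * n' := by
    obtain ⟨t, ht⟩ := hn'
    have hy0 : 0 < y := Nat.pos_of_dvd_of_pos hyn (Nat.pos_of_ne_zero hn0)
    have hn'0 : 0 < n' := Nat.pos_of_ne_zero (NeZero.ne n')
    have e : n / (y * n') = t := by rw [ht, Nat.mul_div_cancel_left _ (Nat.mul_pos hy0 hn'0)]
    rw [e, ht, mul_assoc, Nat.mul_div_cancel_left _ hy0, mul_comm]
  have hpos : 0 < n / (y * n') := Nat.div_pos (Nat.le_of_dvd (Nat.pos_of_ne_zero hn0) hn')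
    (Nat.pos_of_dvd_of_pos hn' (Nat.pos_of_ne_zero hn0))
  have hn'0 : 0 < n' := Nat.pos_of_ne_zero (NeZero.ne n')
  have hdiv : #n'.divisors ≤ #n.divisors := card_le_card (Nat.divisors_subset_of_dvd hn0 hn'n)
  have hnn : n / n' * n' = n := Nat.div_mul_cancel hn'n
  refine le_of_mul_le_mul_left (a := (n / (y * n')) ^ 6 * n' ^ 3) ?_ (by positivity)
  calc (n / (y * n')) ^ 6 * n' ^ 3 * (n' ^ 3 * cnt (red hX) h (m + 2) x) =
        ((n / y) ^ 3) ^ 2 * cnt (red hX) h (m + 2) x := by rw [hny']; ring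
    _ ≤ #K ^ 2 * cnt (red hX) h (m + 2) x := Nat.mul_le_mul_right _ (Nat.pow_le_pow_left hKc 2)
    _ ≤ _ := hmain
    _ = (n / (y * n')) ^ 6 * n' ^ 3 * (8 * #n'.divisors * (n / n' * n') ^ 6 * V) := by ring
    _ ≤ (n / (y * n')) ^ 6 * n' ^ 3 * (8 * #n.divisors * n ^ 6 * V) := by rw [hnn]; gcongr

lemma cnt_zero_le {H L : Type*} [Group H] [Fintype H] [Group L] [DecidableEq L] (π : H →* L) (h : H) (v : L) :
    cnt π h 0 v ≤ 1 := by
  unfold cnt; split_ifs <;> simp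

/-- Products of few conjugates of an element of bounded content are nearly equidistributed. -/
lemma cnt_le {n : ℕ} [NeZero n] {h : SpecialLinearGroup (Fin 2) (ZMod n)} {g k a b c : ℕ} (hc : Content h g k a b c)
    {D T : ℕ} (hD0 : 0 < D) (hD : ∀ p : ℕ, p.Prime → p ∣ n → p ∣ k ∧ p ∣ D) (hT : k ∣ D ^ 2 ^ T) (v : SpecialLinearGroup (Fin 2) (ZMod n)) :
    n ^ 3 * cnt (MonoidHom.id _) h (2 * T) v ≤ (g * D) ^ 3 * (8 * #n.divisors * n ^ 6) ^ T := by
  have hn0 : n ≠ 0 := NeZero.ne n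
  have hk0 : 0 < k := Nat.pos_of_ne_zero fun h0 => hn0 (by rw [← hc.mul, h0, mul_zero])
  have hkn : k ∣ n := ⟨g, by rw [← hc.mul, mul_comm]⟩
  let y : ℕ → ℕ := fun t => k.gcd (D ^ 2 ^ t)
  have hy0 : ∀ t, 0 < y t := fun t => Nat.gcd_pos_of_pos_left _ hk0
  have hyk : ∀ t, y t ∣ k := fun t => Nat.gcd_dvd_left _ _
  set B : Matrix (Fin 2) (Fin 2) (ZMod n) := !![(a : ZMod n), (b : ZMod n); (c : ZMod n), 0] with hBdef
  have hB : (h : Matrix (Fin 2) (Fin 2) (ZMod n)) =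
      (h 1 1) • (1 : Matrix (Fin 2) (Fin 2) (ZMod n)) + (g : ZMod n) • B := by
    have e1 := hc.sub
    have e2 := hc.off
    have e3 := hc.low
    ext i j
    fin_cases i <;> fin_cases j
    · simp [hBdef]; linear_combination e1
    · simpa [hBdef] using e2
    · simpa [hBdef] using e3
    · simp [hBdef]
  have key : ∀ t, ∀ Y (hY : Y ∣ n), Y = g * y t → ∀ v, y t ^ 3 * cnt (red hY) h (2 * t) v ≤
      y 0 ^ 3 * (8 * #n.divisors * n ^ 6) ^ t := by
    intro t
    induction t with
    | zero =>
      intro Y hY _ v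
      rw [pow_zero]
      exact Nat.mul_le_mul_left _ (cnt_zero_le _ _ _)
    | succ t ih =>
      have hdvd : y t ∣ y (t + 1) := Nat.gcd_dvd_gcd_of_dvd_right _ (pow_dvd_pow _ (Nat.pow_le_pow_right (by norm_num) (by lia)))
      obtain ⟨n', hn'⟩ := hdvd
      have hn'y : n' ∣ y t := by
        have : y (t + 1) ∣ y t * y t := by
          have := Nat.gcd_mul_right_dvd_mul_gcd k (D ^ 2 ^ t) (D ^ 2 ^ t)
          rwa [← pow_add, ← two_mul, mul_comm, ← pow_succ] at this
        rw [hn'] at this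
        exact Nat.dvd_of_mul_dvd_mul_left (hy0 t) this
      have hn'k : n' ∣ k := (Dvd.intro_left _ hn'.symm).trans (hyk _)
      have hn'n := hn'k.trans hkn
      have : NeZero n' := ⟨fun h0 => hn0 (Nat.eq_zero_of_zero_dvd (h0 ▸ hn'n))⟩
      intro X hX hXe v
      rw [hn', ← mul_assoc] at hXe
      subst hXe
      have hY : g * y t ∣ n := (Dvd.intro _ rfl).trans hX
      obtain ⟨u₁, u₂, u₃, u₄, hu⟩ := hc.prim
      have hu' := congrArg (Int.cast (R := ZMod n')) hu
      push_cast at hu'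
      rw [(ZMod.natCast_eq_zero_iff k n').2 hn'k, mul_zero, add_zero] at hu'
      have hstep := cnt_step_le hX hY ((hyk t).trans hkn)
        (fun p hp hpn => Nat.dvd_gcd (hD p hp hpn).1 (dvd_pow (hD p hp hpn).2 (by positivity)))
        (hn' ▸ (hyk (t + 1)).trans hkn) hn'y hn'n h hB (u := u₁) (v := u₂) (w := u₃) (by simpa [hBdef] using hu')
        (m := 2 * t) (V := y 0 ^ 3 * (8 * #n.divisors * n ^ 6) ^ t / y t ^ 3)
        (fun v => (Nat.le_div_iff_mul_le (pow_pos (hy0 t) 3)).2 (by rw [mul_comm]; exact ih _ hY rfl v)) v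
      calc y (t + 1) ^ 3 * cnt (red hX) h (2 * (t + 1)) v = y t ^ 3 * (n' ^ 3 * cnt (red hX) h (2 * t + 2) v) := by
            rw [hn']; ring_nf
        _ ≤ y t ^ 3 * _ := Nat.mul_le_mul_left _ hstep
        _ = (8 * #n.divisors * n ^ 6) * (y t ^ 3 * (y 0 ^ 3 * (8 * #n.divisors * n ^ 6) ^ t / y t ^ 3)) := by ring
        _ ≤ (8 * #n.divisors * n ^ 6) * (y 0 ^ 3 * (8 * #n.divisors * n ^ 6) ^ t) :=
            Nat.mul_le_mul_left _ (Nat.mul_div_le _ _)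
        _ = _ := by ring
  have hyT : y T = k := Nat.gcd_eq_left hT
  have h1 := key T n dvd_rfl (by rw [hyT, hc.mul]) v
  have hid : red (dvd_refl n) = MonoidHom.id _ := by
    refine MonoidHom.ext fun z => ?_
    ext i j
    rw [red_apply, show ZMod.castHom (dvd_refl n) (ZMod n) = RingHom.id _ from Subsingleton.elim _ _]
    rfl
  rw [hid, hyT] at h1
  have hyD : y 0 ≤ D := Nat.le_of_dvd hD0 ((Nat.gcd_dvd_right k (D ^ 2 ^ 0)).trans (by rw [pow_zero, pow_one]))
  calc n ^ 3 * cnt (MonoidHom.id _) h (2 * T) v = g ^ 3 * (k ^ 3 * cnt (MonoidHom.id _) h (2 * T) v) := by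
        have e : n ^ 3 = g ^ 3 * k ^ 3 := by rw [← mul_pow, hc.mul]
        rw [e]; ring
    _ ≤ g ^ 3 * (y 0 ^ 3 * (8 * #n.divisors * n ^ 6) ^ T) := Nat.mul_le_mul_left _ h1
    _ ≤ g ^ 3 * (D ^ 3 * (8 * #n.divisors * n ^ 6) ^ T) := by gcongr
    _ = _ := by ring

lemma cnt_conj {H L : Type*} [Group H] [Fintype H] [Group L] [DecidableEq L] (π : H →* L) (h : H) (m : ℕ) (x : H) (v : L) :
    cnt π h m (π x * v * (π x)⁻¹) = cnt π h m v := by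
  induction m generalizing v with
  | zero => simp only [cnt, conj_eq_one_iff]
  | succ m ih =>
    simp only [cnt]
    rw [← Equiv.sum_comp (Equiv.mulRight x⁻¹)]
    refine sum_congr rfl fun α _ => ?_
    refine Eq.trans ?_ (ih _)
    congr 1
    simp only [Equiv.coe_mulRight, map_mul π, map_inv π]
    group

/-- Substituting `x` or `x'` between elements of `A'` gives pairs of words whose quotients are products of conjugates. -/
lemma exists_words {G₁ H : Type} [Group G₁] [Group H] [Fintype H] [DecidableEq G₁] [DecidableEq H]
    {A A' : Finset (G₁ × H)} {k₀ : ℕ} {x x' : G₁ × H} (hA' : A' ⊆ A) (hinj : Set.InjOn Prod.snd (A' : Set (G₁ × H)))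
    (hx : x ∈ A ^ k₀) (hx' : x' ∈ A ^ k₀) (h1 : x.1 = x'.1) (m : ℕ) :
    ∃ (ι : Type) (I : Finset ι) (w w' : ι → G₁ × H), #I = #A' ^ m ∧
      (∀ i ∈ I, w i ∈ A ^ (m * (k₀ + 1)) ∧ w' i ∈ A ^ (m * (k₀ + 1)) ∧ (w i).1 = (w' i).1) ∧
      ∀ v, #{i ∈ I | (w i).2⁻¹ * (w' i).2 = v} ≤ cnt (MonoidHom.id H) (x.2⁻¹ * x'.2) m v := by
  induction m with
  | zero =>
    refine ⟨Unit, univ, fun _ => 1, fun _ => 1, by simp, fun i _ => by simp, fun v => ?_⟩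
    simp only [cnt]
    split_ifs with hv
    · exact (card_le_univ _).trans (by simp)
    · rw [filter_false_of_mem fun i _ h => hv (by simpa using h.symm)]; simp
  | succ m ih =>
    obtain ⟨ι, I, w, w', hI, hw, hv⟩ := ih
    refine ⟨ι × (G₁ × H), I ×ˢ A', fun p => w p.1 * (x * p.2), fun p => w' p.1 * (x' * p.2), ?_, ?_, ?_⟩
    · rw [card_product, hI, pow_succ]
    · rintro ⟨i, e⟩ hie
      obtain ⟨hi, he⟩ := mem_product.1 hie
      obtain ⟨ha, hb, hc⟩ := hw i hi
      rw [show (m + 1) * (k₀ + 1) = m * (k₀ + 1) + (k₀ + 1) by ring, pow_add, pow_succ A k₀]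
      refine ⟨mul_mem_mul ha (mul_mem_mul hx (hA' he)), mul_mem_mul hb (mul_mem_mul hx' (hA' he)), ?_⟩
      simp only [Prod.fst_mul, hc, h1]
    · intro v
      set h := x.2⁻¹ * x'.2 with hh
      calc #{p ∈ I ×ˢ A' | (w p.1 * (x * p.2)).2⁻¹ * (w' p.1 * (x' * p.2)).2 = v}
          = ∑ e ∈ A', #{i ∈ I | (w i * (x * e)).2⁻¹ * (w' i * (x' * e)).2 = v} := by
            rw [card_filter, sum_product_right]
            exact sum_congr rfl fun e _ => (card_filter _ _).symm
        _ ≤ ∑ e ∈ A', cnt (MonoidHom.id H) h m (v * (e.2⁻¹ * h * e.2)⁻¹) := by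
            refine sum_le_sum fun e _ => ?_
            have e1 : cnt (MonoidHom.id H) h m (v * (e.2⁻¹ * h * e.2)⁻¹) =
                cnt (MonoidHom.id H) h m ((x.2 * e.2) * (v * (e.2⁻¹ * h * e.2)⁻¹) * (x.2 * e.2)⁻¹) :=
              (cnt_conj (MonoidHom.id H) h m (x.2 * e.2) _).symm
            rw [e1]
            refine le_trans (card_le_card ?_) (hv _)
            intro i hi
            obtain ⟨hi, hiv⟩ := mem_filter.1 hi
            refine mem_filter.2 ⟨hi, ?_⟩
            rw [← hiv, hh]
            simp only [Prod.snd_mul]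
            group
        _ = ∑ α ∈ A'.image Prod.snd, cnt (MonoidHom.id H) h m (v * (α⁻¹ * h * α)⁻¹) :=
            (sum_image (f := fun α => cnt (MonoidHom.id H) h m (v * (α⁻¹ * h * α)⁻¹)) hinj).symm
        _ ≤ ∑ α, cnt (MonoidHom.id H) h m (v * (α⁻¹ * h * α)⁻¹) := sum_le_sum_of_subset (subset_univ _)

/-- A growth inequality for subsets of a product of groups containing two elements with equal first coordinates. -/
lemma growth {G₁ H : Type} [Group G₁] [Group H] [Fintype H] [DecidableEq G₁] [DecidableEq H]
    {A : Finset (G₁ × H)} {k₀ : ℕ} {x x' : G₁ × H} (hx : x ∈ A ^ k₀) (hx' : x' ∈ A ^ k₀) (h1 : x.1 = x'.1) (m V : ℕ)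
    (hV : ∀ v, cnt (MonoidHom.id H) (x.2⁻¹ * x'.2) m v ≤ V) (hA : A.Nonempty) (j : ℕ) :
    #(A.image Prod.fst) * #(A.image Prod.snd) ^ m * #(A ^ j) ≤ V * #(A ^ (j + m * (k₀ + 1) + 1)) ^ 2 := by
  obtain ⟨A', hA', hinj, him⟩ : ∃ A' ⊆ A, Set.InjOn Prod.snd (A' : Set (G₁ × H)) ∧ A'.image Prod.snd = A.image Prod.snd := by
    obtain ⟨A', h1, h2, h3⟩ := exists_subset_injOn_image_eq_of_surjOn (f := Prod.snd) (A : Set (G₁ × H))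
      (A.image Prod.snd) (by rw [coe_image]; exact Set.surjOn_image _ _)
    exact ⟨A', coe_subset.1 h1, h2, h3⟩
  obtain ⟨ι, I, w, w', hI, hw, hv⟩ := exists_words hA' hinj hx hx' h1 m
  set s := m * (k₀ + 1) with hs
  have hcard : #(A.image Prod.snd) = #A' := by rw [← him, card_image_of_injOn hinj]
  set U : Finset (G₁ × H) := A ^ j with hU
  have hUI : ∀ p ∈ U ×ˢ I, p.1 * w p.2 ∈ A ^ (j + s) := by
    intro p hp
    rw [pow_add]
    exact mul_mem_mul (mem_product.1 hp).1 (hw _ (mem_product.1 hp).2).1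
  obtain ⟨c, hpop⟩ : ∃ c, #(U ×ˢ I) ≤ #(A ^ (j + s)) * #{p ∈ U ×ˢ I | p.1 * w p.2 = c} := by
    obtain ⟨c, -, hc⟩ := exists_max_image (A ^ (j + s)) (fun c => #{p ∈ U ×ˢ I | p.1 * w p.2 = c}) hA.pow
    refine ⟨c, ?_⟩
    rw [mul_comm]
    exact card_le_mul_card_image_of_maps_to hUI _ hc
  set P := (U ×ˢ I).filter fun p => p.1 * w p.2 = c with hP
  set Δ := P.image fun p => (w p.2).2⁻¹ * (w' p.2).2 with hΔ
  have hPΔ : #P ≤ V * #Δ := by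
    refine card_le_mul_card_image P V fun v _ => le_trans ?_ ((hv v).trans (hV v))
    refine card_le_card_of_injOn Prod.snd ?_ ?_
    · intro p hp
      obtain ⟨hp, hpv⟩ := mem_filter.1 (mem_coe.1 hp)
      exact mem_coe.2 (mem_filter.2 ⟨(mem_product.1 (mem_filter.1 hp).1).2, hpv⟩)
    · intro p hp p' hp' he
      have e1 := (mem_filter.1 (mem_filter.1 (mem_coe.1 hp)).1).2
      have e2 := (mem_filter.1 (mem_filter.1 (mem_coe.1 hp')).1).2
      rw [← e2, he] at e1
      exact Prod.ext (mul_right_cancel e1) he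
  have hbig : #(A.image Prod.fst) * #Δ ≤ #(A ^ (j + s + 1)) := by
    have hΔmem : ∀ d ∈ Δ, c * (1, d) ∈ A ^ (j + s) := by
      intro d hd
      obtain ⟨p, hp, rfl⟩ := mem_image.1 hd
      obtain ⟨hp, hpc⟩ := mem_filter.1 hp
      rw [← hpc]
      obtain ⟨hpU, hpI⟩ := mem_product.1 hp
      obtain ⟨-, hw', hf⟩ := hw _ hpI
      have e : p.1 * w p.2 * (1, (w p.2).2⁻¹ * (w' p.2).2) = p.1 * w' p.2 := by
        refine Prod.ext ?_ ?_
        · simp [hf]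
        · simp [mul_assoc]
      rw [e, pow_add]
      exact mul_mem_mul hpU hw'
    have hsec : ∀ a ∈ A.image Prod.fst, ∃ b, (a, b) ∈ A := by
      intro a ha
      obtain ⟨⟨a', b⟩, hab, rfl⟩ := mem_image.1 ha
      exact ⟨b, hab⟩
    choose! f hf using hsec
    rw [← card_product]
    refine card_le_card_of_injOn (fun p => (p.1, f p.1) * (c * (1, p.2))) ?_ ?_
    · intro p hp
      obtain ⟨hp1, hp2⟩ := mem_product.1 (mem_coe.1 hp)
      rw [pow_succ']
      exact mem_coe.2 (mul_mem_mul (hf _ hp1) (hΔmem _ hp2))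
    · intro p _ p' _ he
      have e1 : p.1 = p'.1 := by
        have := congrArg Prod.fst he
        simpa using this
      have e2 := congrArg Prod.snd he
      simp only [Prod.snd_mul, e1] at e2
      exact Prod.ext e1 (mul_left_cancel (mul_left_cancel e2))
  have hmono : #(A ^ (j + s)) ≤ #(A ^ (j + s + 1)) := by
    rw [pow_succ]; exact card_le_card_mul_right hA
  rw [card_product, hI] at hpop
  rw [hcard]
  calc #(A.image Prod.fst) * #A' ^ m * #U = #(A.image Prod.fst) * (#U * #A' ^ m) := by ring
    _ ≤ #(A.image Prod.fst) * (#(A ^ (j + s)) * (V * #Δ)) := 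
        Nat.mul_le_mul_left _ (hpop.trans (Nat.mul_le_mul_left _ hPΔ))
    _ = V * ((#(A.image Prod.fst) * #Δ) * #(A ^ (j + s))) := by ring
    _ ≤ V * (#(A ^ (j + s + 1)) * #(A ^ (j + s + 1))) := by gcongr
    _ = _ := by ring

lemma growth_iterate {G₁ H : Type} [Group G₁] [Group H] [Fintype H] [DecidableEq G₁] [DecidableEq H]
    {A : Finset (G₁ × H)} {k₀ : ℕ} {x x' : G₁ × H} (hx : x ∈ A ^ k₀) (hx' : x' ∈ A ^ k₀) (h1 : x.1 = x'.1) (m V : ℕ)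
    (hV : ∀ v, cnt (MonoidHom.id H) (x.2⁻¹ * x'.2) m v ≤ V) (hA : A.Nonempty) (i : ℕ) :
    (#(A.image Prod.fst) * #(A.image Prod.snd) ^ m) ^ (2 ^ i - 1) ≤
      V ^ (2 ^ i - 1) * #(A ^ (i * (m * (k₀ + 1) + 1))) ^ 2 ^ i := by
  induction i with
  | zero => simp
  | succ i ih =>
    set α := #(A.image Prod.fst) * #(A.image Prod.snd) ^ m with hα
    set j := i * (m * (k₀ + 1) + 1) with hj
    have hg := growth hx hx' h1 m V hV hA j
    rw [← hα] at hg
    have e : 2 ^ (i + 1) - 1 = (2 ^ i - 1) + 2 ^ i := by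
      have := Nat.one_le_two_pow (n := i); rw [pow_succ]; lia
    have ej : (i + 1) * (m * (k₀ + 1) + 1) = j + m * (k₀ + 1) + 1 := by rw [hj]; ring
    rw [e, ej, pow_add α]
    calc α ^ (2 ^ i - 1) * α ^ 2 ^ i ≤ (V ^ (2 ^ i - 1) * #(A ^ j) ^ 2 ^ i) * α ^ 2 ^ i := Nat.mul_le_mul_right _ ih
      _ = V ^ (2 ^ i - 1) * (α * #(A ^ j)) ^ 2 ^ i := by rw [mul_pow]; ring
      _ ≤ V ^ (2 ^ i - 1) * (V * #(A ^ (j + m * (k₀ + 1) + 1)) ^ 2) ^ 2 ^ i :=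
          Nat.mul_le_mul_left _ (Nat.pow_le_pow_left hg _)
      _ = _ := by rw [mul_pow, pow_add V, ← pow_mul, pow_succ 2 i, mul_comm 2]; ring

/-- If two elements of `A ^ k₀` with the same first coordinate differ, in the second coordinate, by an element far
from the centre at every prime, then a bounded power of `A` is almost everything. -/
lemma card_pow_ge {q n : ℕ} [NeZero q] [NeZero n]
    {A : Finset (SpecialLinearGroup (Fin 2) (ZMod q) × SpecialLinearGroup (Fin 2) (ZMod n))} (hA : A.Nonempty) {k₀ : ℕ}
    {x x' : SpecialLinearGroup (Fin 2) (ZMod q) × SpecialLinearGroup (Fin 2) (ZMod n)}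
    (hx : x ∈ A ^ k₀) (hx' : x' ∈ A ^ k₀) (h1 : x.1 = x'.1) (L : ℕ → ℕ) (T : ℕ)
    (hL : ∀ p ∈ n.primeFactors, 0 < L p ∧ L p ≤ n.factorization p ∧ n.factorization p ≤ L p * 2 ^ T)
    (hcen : ∀ p ∈ n.primeFactors, x.2⁻¹ * x'.2 ∉ Cen ((p ^ L p : ℕ) : ZMod n)) :
    (#(A.image Prod.fst) * #(A.image Prod.snd) ^ (2 * T) * n ^ 3) ^ (2 ^ T - 1) ≤
      ((∏ p ∈ n.primeFactors, p ^ L p) ^ 6 * (8 * #n.divisors * n ^ 6) ^ T) ^ (2 ^ T - 1) *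
        #(A ^ (T * (2 * T * (k₀ + 1) + 1))) ^ 2 ^ T := by
  have hn0 : n ≠ 0 := NeZero.ne n
  set D := ∏ p ∈ n.primeFactors, p ^ L p with hD
  have hD0 : 0 < D := prod_pos fun p hp => pow_pos (Nat.prime_of_mem_primeFactors hp).pos _
  obtain ⟨g, k, a, b, c, hc⟩ := exists_content (x.2⁻¹ * x'.2)
  have hg0 : g ≠ 0 := fun h0 => hn0 (by rw [← hc.mul, h0, zero_mul])
  have hk0 : k ≠ 0 := fun h0 => hn0 (by rw [← hc.mul, h0, mul_zero])
  have hgn : g ∣ n := ⟨k, hc.mul.symm⟩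
  have hkn : k ∣ n := ⟨g, by rw [← hc.mul, mul_comm]⟩
  have hfac : ∀ p, n.factorization p = g.factorization p + k.factorization p := by
    intro p; rw [← hc.mul, Nat.factorization_mul hg0 hk0]; rfl
  have hgL : ∀ p ∈ n.primeFactors, g.factorization p < L p := by
    intro p hp
    by_contra! hcon
    have hpp := Nat.prime_of_mem_primeFactors hp
    refine hcen p hp ((hc.mem_Cen_iff ?_).2 ?_)
    · exact (hpp.pow_dvd_iff_le_factorization hn0).2 (hL p hp).2.1
    · exact (hpp.pow_dvd_iff_le_factorization hg0).2 hcon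
  have hDfac : ∀ p ∈ n.primeFactors, p ^ L p ∣ D := fun p hp => dvd_prod_of_mem (fun p => p ^ L p) hp
  have hgD : g ∣ D := by
    rw [← Nat.factorization_prime_le_iff_dvd hg0 hD0.ne']
    intro p hpp
    by_cases hp : p ∣ n
    · have hp' := Nat.mem_primeFactors.2 ⟨hpp, hp, hn0⟩
      exact (hgL p hp').le.trans ((hpp.pow_dvd_iff_le_factorization hD0.ne').1 (hDfac p hp'))
    · rw [Nat.factorization_eq_zero_of_not_dvd fun h => hp (h.trans hgn)]; exact Nat.zero_le _
  have hkD : k ∣ D ^ 2 ^ T := by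
    rw [← Nat.factorization_prime_le_iff_dvd hk0 (pow_pos hD0 _).ne']
    intro p hpp
    by_cases hp : p ∣ n
    · have hp' := Nat.mem_primeFactors.2 ⟨hpp, hp, hn0⟩
      have h2 := (hpp.pow_dvd_iff_le_factorization hD0.ne').1 (hDfac p hp')
      rw [Nat.factorization_pow]
      have h3 := (hL p hp').2.2
      have h4 := hfac p
      calc k.factorization p ≤ L p * 2 ^ T := by lia
        _ ≤ 2 ^ T * D.factorization p := by rw [mul_comm]; exact Nat.mul_le_mul_left _ h2
    · rw [Nat.factorization_eq_zero_of_not_dvd fun h => hp (h.trans hkn)]; exact Nat.zero_le _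
  have hcnt := cnt_le hc hD0 (T := T) (fun p hpp hpn => by
    have hp' := Nat.mem_primeFactors.2 ⟨hpp, hpn, hn0⟩
    have h4 := hfac p
    have h5 := hgL p hp'
    have h6 := (hL p hp').2.1
    exact ⟨Nat.dvd_of_factorization_pos (by lia), (dvd_pow_self p (by lia)).trans (hDfac p hp')⟩) hkD
  set W := D ^ 6 * (8 * #n.divisors * n ^ 6) ^ T with hW
  have hn3 : 0 < n ^ 3 := pow_pos (Nat.pos_of_ne_zero hn0) 3
  have hV : ∀ v, cnt (MonoidHom.id (SpecialLinearGroup (Fin 2) (ZMod n))) (x.2⁻¹ * x'.2) (2 * T) v ≤ W / n ^ 3 := by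
    intro v
    rw [Nat.le_div_iff_mul_le hn3, mul_comm]
    refine (hcnt v).trans (Nat.mul_le_mul_right _ ?_)
    calc (g * D) ^ 3 ≤ (D * D) ^ 3 := by gcongr; exact Nat.le_of_dvd hD0 hgD
      _ = D ^ 6 := by ring
  have := growth_iterate hx hx' h1 (2 * T) _ hV hA T
  rw [mul_pow _ (n ^ 3)]
  calc _ ≤ _ := Nat.mul_le_mul_right ((n ^ 3) ^ (2 ^ T - 1)) this
    _ = (W / n ^ 3 * n ^ 3) ^ (2 ^ T - 1) * #(A ^ (T * (2 * T * (k₀ + 1) + 1))) ^ 2 ^ T := by rw [mul_pow]; ring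
    _ ≤ _ := Nat.mul_le_mul_right _ (Nat.pow_le_pow_left (Nat.div_mul_le_self _ _) _)

lemma factorization_prod_pow {S : Finset ℕ} (hS : ∀ p ∈ S, p.Prime) (e : ℕ → ℕ) (p : ℕ) :
    (∏ p ∈ S, p ^ e p).factorization p = if p ∈ S then e p else 0 := by
  rw [Nat.factorization_prod_apply fun x hx => pow_ne_zero _ (hS x hx).ne_zero]
  have h : ∀ x ∈ S, (x ^ e x).factorization p = if x = p then e x else 0 := by
    intro x hx
    rw [(hS x hx).factorization_pow, Finsupp.single_apply]
  rw [sum_congr rfl h]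
  by_cases hp : p ∈ S
  · rw [sum_ite_eq' S p e]
  · rw [if_neg hp]
    refine sum_eq_zero fun x hx => if_neg ?_
    rintro rfl
    exact hp hx

lemma prod_prime_pow_dvd {S : Finset ℕ} (hS : ∀ p ∈ S, p.Prime) (e : ℕ → ℕ) {n : ℕ} (h : ∀ p ∈ S, p ^ e p ∣ n) :
    ∏ p ∈ S, p ^ e p ∣ n := by
  refine Finset.prod_dvd_of_isRelPrime ?_ h
  intro p hp r hr hne
  exact Nat.coprime_iff_isRelPrime.1 (Nat.Coprime.pow _ _ ((Nat.coprime_primes (hS p hp) (hS r hr)).2 hne))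

lemma mem_Cen_red {m n r : ℕ} (h : m ∣ n) {g : SpecialLinearGroup (Fin 2) (ZMod n)} (hg : g ∈ Cen (r : ZMod n)) :
    red h g ∈ Cen (r : ZMod m) := by
  obtain ⟨h1, h2, h3⟩ := hg
  have hr : ∀ {x : ZMod n}, (r : ZMod n) ∣ x → (r : ZMod m) ∣ ZMod.castHom h (ZMod m) x := fun hx => by
    simpa only [map_natCast] using map_dvd (ZMod.castHom h (ZMod m)) hx
  refine ⟨?_, ?_, ?_⟩
  · rw [red_apply]; exact hr h1
  · rw [red_apply]; exact hr h2
  · rw [red_apply, red_apply, ← map_sub]; exact hr h3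

lemma exists_far_pair : ∃ K : ℕ, ∀ (q N E : ℕ) [NeZero q] [NeZero N] (ℓ : ℕ → ℕ) (S : Finset ℕ), S ⊆ N.primeFactors →
    (∀ p ∈ S, 0 < ℓ p ∧ 2 * ℓ p ≤ N.factorization p) →
    q.Coprime N → 2 * #N.divisors ≤ E → ∏ p ∈ N.primeFactors, p ≤ E → q ≤ q.totient * E →
    E ^ K < ∏ p ∈ S, p ^ (2 * ℓ p) →
    ∀ A : Finset (SpecialLinearGroup (Fin 2) (ZMod q) × SpecialLinearGroup (Fin 2) (ZMod N)),
    q ^ 3 ≤ #(A.image Prod.fst) * E → N ^ 3 ≤ #(A.image Prod.snd) * E →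
    ∃ x ∈ A ^ 3, ∃ x' ∈ A ^ 3, x.1 = x'.1 ∧
      E < ∏ p ∈ S with x.2⁻¹ * x'.2 ∉ Cen ((p ^ (2 * ℓ p) : ℕ) : ZMod N), p ^ (2 * ℓ p) := by
  obtain ⟨K, hK⟩ := exists_not_nearCentral
  refine ⟨K, ?_⟩
  intro q N E _ _ ℓ S hSN hℓ hcop hτ hrad hq hES A h1 h2
  have hN0 : N ≠ 0 := NeZero.ne N
  have hSp : ∀ p ∈ S, p.Prime := fun p hp => Nat.prime_of_mem_primeFactors (hSN hp)
  set d := ∏ p ∈ S, p ^ (2 * ℓ p) with hd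
  have hdN : d ∣ N := prod_prime_pow_dvd hSp _ fun p hp =>
    ((hSp p hp).pow_dvd_iff_le_factorization hN0).2 (hℓ p hp).2
  have : NeZero d := ⟨fun h0 => hN0 (Nat.eq_zero_of_zero_dvd (h0 ▸ hdN))⟩
  have hd0 : 0 < d := Nat.pos_of_ne_zero (NeZero.ne d)
  let f : SpecialLinearGroup (Fin 2) (ZMod q) × SpecialLinearGroup (Fin 2) (ZMod N) →*
    SpecialLinearGroup (Fin 2) (ZMod q) × SpecialLinearGroup (Fin 2) (ZMod d) := MonoidHom.prodMap (MonoidHom.id _) (red hdN)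
  have hf1 : (A.image f).image Prod.fst = A.image Prod.fst := by
    rw [image_image]; rfl
  have hf2 : (A.image f).image Prod.snd = (A.image Prod.snd).image (red hdN) := by
    rw [image_image, image_image]; rfl
  have hc2 : #(A.image Prod.snd) ≤ (N / d) ^ 3 * #((A.image f).image Prod.snd) := by
    rw [hf2]
    refine card_le_mul_card_image _ _ fun b _ => ?_
    exact (card_le_card (filter_subset_filter _ (subset_univ _))).trans (card_red_fiber_le hdN b)
  have hNd : N / d * d = N := Nat.div_mul_cancel hdN
  have hNd0 : 0 < N / d := Nat.div_pos (Nat.le_of_dvd (Nat.pos_of_ne_zero hN0) hdN) hd0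
  obtain ⟨y, hy, y', hy', hyy, hfar⟩ := hK q d (∏ p ∈ S, p ^ ℓ p) E
    (by rw [hd, ← prod_mul_distrib]; exact prod_congr rfl fun p _ => by rw [two_mul, pow_add])
    (hcop.coprime_dvd_right hdN)
    ((Nat.mul_le_mul_left 2 (card_le_card (Nat.divisors_subset_of_dvd hN0 hdN))).trans hτ)
    ((prod_le_prod_of_subset_of_one_le' (Nat.primeFactors_mono hdN hN0)
      fun p hp _ => (Nat.prime_of_mem_primeFactors hp).one_lt.le).trans hrad) hq hES (A.image f)
    (by rw [hf1]; exact h1)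
    (by
      refine le_of_mul_le_mul_left (a := (N / d) ^ 3) ?_ (by positivity)
      calc (N / d) ^ 3 * d ^ 3 = N ^ 3 := by rw [← mul_pow, hNd]
        _ ≤ _ := h2
        _ ≤ ((N / d) ^ 3 * #((A.image f).image Prod.snd)) * E := Nat.mul_le_mul_right _ hc2
        _ = _ := by ring)
  rw [← image_pow] at hy hy'
  obtain ⟨x, hx, rfl⟩ := mem_image.1 hy
  obtain ⟨x', hx', rfl⟩ := mem_image.1 hy'
  refine ⟨x, hx, x', hx', hyy, ?_⟩
  by_contra! hcon
  refine hfar ?_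
  set S₁ := S.filter fun p => x.2⁻¹ * x'.2 ∈ Cen ((p ^ (2 * ℓ p) : ℕ) : ZMod N) with hS₁
  have hS₁p : ∀ p ∈ S₁, p.Prime := fun p hp => hSp p (mem_filter.1 hp).1
  have hsplit : (∏ p ∈ S₁, p ^ (2 * ℓ p)) * (∏ p ∈ S with x.2⁻¹ * x'.2 ∉ Cen ((p ^ (2 * ℓ p) : ℕ) : ZMod N), p ^ (2 * ℓ p)) = d :=
    prod_filter_mul_prod_filter_not _ _ _
  have hmd : ∏ p ∈ S₁, p ^ (2 * ℓ p) ∣ d := Dvd.intro _ hsplit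
  refine ⟨∏ p ∈ S₁, p ^ (2 * ℓ p), hmd, ?_, ?_⟩
  · rw [← hsplit, mul_comm]; exact Nat.mul_le_mul_right _ hcon
  · refine mem_Cen_of_forall_prime_pow hmd fun p hp => ?_
    have hp0 : (∏ p ∈ S₁, p ^ (2 * ℓ p)).factorization p ≠ 0 := Finsupp.mem_support_iff.1 hp
    rw [factorization_prod_pow hS₁p] at hp0 ⊢
    by_cases hpS : p ∈ S₁
    · rw [if_pos hpS]
      have := mem_Cen_red hdN (mem_filter.1 hpS).2
      rw [map_mul (red hdN), map_inv (red hdN)] at this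
      exact this
    · rw [if_neg hpS] at hp0; exact absurd rfl hp0

/-- There is a finite family in `A ^ k` with constant first coordinate such that, for every `p ∈ J`, no coset of `C p`
contains the second coordinates of more than half of the family. -/
def Spread {G₁ H : Type} [Group G₁] [Group H] [DecidableEq G₁] [DecidableEq H] (A : Finset (G₁ × H)) (k : ℕ) (C : ℕ → Subgroup H) (J : Finset ℕ) : Prop :=
  ∃ (ι : Type) (I : Finset ι) (e : ι → G₁ × H), I.Nonempty ∧ (∀ i ∈ I, e i ∈ A ^ k) ∧
    (∀ i ∈ I, ∀ j ∈ I, (e i).1 = (e j).1) ∧ ∀ p ∈ J, ∀ c : H, 2 * #{i ∈ I | c⁻¹ * (e i).2 ∈ C p} ≤ #I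

lemma spread_zero {G₁ H : Type} [Group G₁] [Group H] [DecidableEq G₁] [DecidableEq H] (A : Finset (G₁ × H)) (C : ℕ → Subgroup H) : Spread A 0 C ∅ :=
  ⟨Unit, univ, fun _ => 1, univ_nonempty, fun _ _ => by simp, fun _ _ _ _ => rfl, fun p hp => absurd hp (notMem_empty p)⟩

lemma Spread.step {G₁ H : Type} [Group G₁] [Group H] [DecidableEq G₁] [DecidableEq H] {A : Finset (G₁ × H)} {k r : ℕ} {C : ℕ → Subgroup H}
    (hC : ∀ p, (C p).Normal) {J J' : Finset ℕ} (hS : Spread A k C J) {x x' : G₁ × H} (hx : x ∈ A ^ r) (hx' : x' ∈ A ^ r)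
    (h1 : x.1 = x'.1) (hJ' : ∀ p ∈ J', x.2⁻¹ * x'.2 ∉ C p) : Spread A (k + r) C (J ∪ J') := by
  obtain ⟨ι, I, e, hI, he, hf, hJ⟩ := hS
  let y : Bool → G₁ × H := fun b => if b then x else x'
  have hcard : #(I ×ˢ (univ : Finset Bool)) = 2 * #I := by rw [card_product, card_univ, Fintype.card_bool, mul_comm]
  refine ⟨ι × Bool, I ×ˢ univ, fun p => e p.1 * y p.2, hI.product univ_nonempty, ?_, ?_, ?_⟩
  · rintro ⟨i, b⟩ hp
    rw [pow_add]
    refine mul_mem_mul (he _ (mem_product.1 hp).1) ?_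
    simp only [y]; split_ifs <;> assumption
  · have hy : ∀ b, (y b).1 = x.1 := by
      intro b; simp only [y]; split_ifs
      · rfl
      · exact h1.symm
    rintro ⟨i, b⟩ hi ⟨j, b'⟩ hj
    simp only [Prod.fst_mul, hy, hf _ (mem_product.1 hi).1 _ (mem_product.1 hj).1]
  · intro p hp c
    rw [hcard]
    refine Nat.mul_le_mul_left 2 ?_
    by_cases hpJ : p ∈ J
    · have hb : ∀ b, 2 * #{i ∈ I | c⁻¹ * (e i * y b).2 ∈ C p} ≤ #I := by
        intro b
        refine le_trans (Nat.mul_le_mul_left 2 (card_le_card ?_)) (hJ p hpJ (c * (y b).2⁻¹))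
        intro i hi
        obtain ⟨hi, hm⟩ := mem_filter.1 hi
        refine mem_filter.2 ⟨hi, ?_⟩
        rw [Prod.snd_mul, ← mul_assoc] at hm
        rw [_root_.mul_inv_rev, inv_inv, mul_assoc]
        exact (hC p).mem_comm hm
      rw [card_filter, sum_product_right, Fintype.sum_bool, ← card_filter, ← card_filter]
      have h1 := hb true
      have h2 := hb false
      lia
    · have hpJ' : p ∈ J' := (mem_union.1 hp).resolve_left hpJ
      refine card_le_card_of_injOn Prod.fst (fun q hq => ?_) ?_
      · exact mem_coe.2 (mem_product.1 (mem_filter.1 (mem_coe.1 hq)).1).1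
      · rintro ⟨i, b⟩ hi ⟨j, b'⟩ hj hij
        have hi := (mem_filter.1 (mem_coe.1 hi)).2
        have hj := (mem_filter.1 (mem_coe.1 hj)).2
        simp only at hij
        subst hij
        refine Prod.ext rfl ?_
        have key := (C p).mul_mem ((C p).inv_mem hi) hj
        have e1 : (c⁻¹ * (e i * y b).2)⁻¹ * (c⁻¹ * (e i * y b').2) = (y b).2⁻¹ * (y b').2 := by
          simp only [Prod.snd_mul]; group
        simp only [e1] at key
        cases b <;> cases b'
        · rfl
        · exact absurd (by simpa [y] using (C p).inv_mem key) (hJ' p hpJ')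
        · exact absurd (by simpa [y] using key) (hJ' p hpJ')
        · rfl

lemma Spread.exists_pair {G₁ H : Type} [Group G₁] [Group H] [DecidableEq G₁] [DecidableEq H] {A : Finset (G₁ × H)} {k : ℕ} {C : ℕ → Subgroup H}
    {J : Finset ℕ} (hS : Spread A k C J) {w : ℕ → ℝ} (hw : ∀ p ∈ J, 0 ≤ w p) :
    ∃ x ∈ A ^ k, ∃ x' ∈ A ^ k, x.1 = x'.1 ∧ ∑ p ∈ J, w p ≤ 2 * ∑ p ∈ J with x.2⁻¹ * x'.2 ∉ C p, w p := by
  obtain ⟨ι, I, e, hI, he, hf, hJ⟩ := hS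
  have hsum : ∑ _ij ∈ I ×ˢ I, ∑ p ∈ J, w p ≤
      ∑ ij ∈ I ×ˢ I, 2 * ∑ p ∈ J with (e ij.1).2⁻¹ * (e ij.2).2 ∉ C p, w p := by
    simp only [sum_filter, mul_sum]
    rw [sum_comm, sum_comm (s := I ×ˢ I)]
    refine sum_le_sum fun p hp => ?_
    rw [sum_product, sum_product]
    refine sum_le_sum fun i hi => ?_
    rw [sum_const, ← mul_sum, ← sum_filter, sum_const, nsmul_eq_mul, nsmul_eq_mul, ← mul_assoc]
    refine mul_le_mul_of_nonneg_right ?_ (hw p hp)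
    have h1 := hJ p hp (e i).2
    have h2 := card_filter_add_card_filter_not (s := I) (fun j => (e i).2⁻¹ * (e j).2 ∈ C p)
    exact_mod_cast (show #I ≤ 2 * #{j ∈ I | (e i).2⁻¹ * (e j).2 ∉ C p} by lia)
  obtain ⟨⟨i, j⟩, hij, hle⟩ := exists_le_of_sum_le (hI.product hI) hsum
  obtain ⟨hi, hj⟩ := mem_product.1 hij
  exact ⟨e i, he i hi, e j, he j hj, hf i hi j hj, hle⟩

lemma exists_spread {G₁ H : Type} [Group G₁] [Group H] [DecidableEq G₁] [DecidableEq H] {A : Finset (G₁ × H)} {C : ℕ → Subgroup H}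
    (hC : ∀ p, (C p).Normal) {P : Finset ℕ} {w : ℕ → ℝ} {δ η : ℝ} {r s : ℕ}
    (hstep : ∀ J ⊆ P, ∑ p ∈ J, w p < δ → ∃ x ∈ A ^ r, ∃ x' ∈ A ^ r, x.1 = x'.1 ∧
      η ≤ ∑ p ∈ P \ J with x.2⁻¹ * x'.2 ∉ C p, w p) (hs : δ ≤ s * η) :
    ∃ k ≤ s * r, ∃ J ⊆ P, Spread A k C J ∧ δ ≤ ∑ p ∈ J, w p := by
  have key : ∀ i : ℕ, ∃ k ≤ i * r, ∃ J ⊆ P, Spread A k C J ∧ min δ (i * η) ≤ ∑ p ∈ J, w p := by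
    intro i
    induction i with
    | zero => exact ⟨0, Nat.zero_le _, ∅, empty_subset _, spread_zero A C, by simp⟩
    | succ i ih =>
      obtain ⟨k, hk, J, hJP, hS, hle⟩ := ih
      rcases lt_or_ge (∑ p ∈ J, w p) δ with hlt | hge
      · obtain ⟨x, hx, x', hx', h1, hη⟩ := hstep J hJP hlt
        set J' := (P \ J).filter fun p => x.2⁻¹ * x'.2 ∉ C p with hJ'
        refine ⟨k + r, by lia, J ∪ J', union_subset hJP fun p hp => (mem_sdiff.1 (mem_filter.1 hp).1).1,
          hS.step hC hx hx' h1 fun p hp => (mem_filter.1 hp).2, ?_⟩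
        have hdisj : Disjoint J J' := disjoint_left.2 fun p hp hp' => (mem_sdiff.1 (mem_filter.1 hp').1).2 hp
        rw [sum_union hdisj]
        have h2 : (i : ℝ) * η ≤ ∑ p ∈ J, w p := by
          rcases min_le_iff.1 hle with h | h
          · exact absurd hlt (not_lt.2 h)
          · exact h
        refine (min_le_right _ _).trans ?_
        push_cast
        linarith
      · exact ⟨k, hk.trans (Nat.mul_le_mul_right _ (Nat.le_succ i)), J, hJP, hS, (min_le_left _ _).trans hge⟩
  obtain ⟨k, hk, J, hJP, hS, hle⟩ := key s
  exact ⟨k, hk, J, hJP, hS, by rwa [min_eq_left hs] at hle⟩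

lemma twenty_five_le_log {x : ℝ} (hx : 10 ^ 12 ≤ x) : 25 ≤ Real.log x := by
  rw [Real.le_log_iff_exp_le (by linarith [show (0 : ℝ) < 10 ^ 12 by norm_num])]
  refine le_trans ?_ hx
  have h := Real.exp_one_lt_d9
  calc Real.exp 25 = Real.exp 1 ^ 25 := by rw [← Real.exp_nat_mul]; norm_num
    _ ≤ (2.72 : ℝ) ^ 25 := pow_le_pow_left₀ (Real.exp_pos 1).le (by linarith) 25
    _ ≤ 10 ^ 12 := by norm_num

lemma pow_le_two_rpow {ε : ℝ} (hε : 0 < ε) (hε' : ε ≤ 1 / 10 ^ 6) {T n : ℕ} (hT : (2 : ℝ) ^ T ≤ 2 / ε)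
    (hn : 1 / ε ^ 2 < n) : (8 * ((n : ℝ) + 1)) ^ T ≤ 2 ^ (ε * n) := by
  have hεn : 1 < ε ^ 2 * n := by rw [div_lt_iff₀ (by positivity)] at hn; linarith
  have hn12 : (10 : ℝ) ^ 12 ≤ n := by
    refine le_trans ?_ hn.le
    rw [le_div_iff₀ (by positivity)]
    have : ε ^ 2 ≤ (1 / 10 ^ 6) ^ 2 := pow_le_pow_left₀ hε.le hε' 2
    norm_num at this ⊢; linarith
  have hn0 : (0 : ℝ) < n := lt_of_lt_of_le (by norm_num) hn12
  set u := Real.log n with hu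
  have hu25 : 25 ≤ u := twenty_five_le_log hn12
  have hsq : Real.exp (u / 2) ^ 2 = n := by
    rw [← Real.exp_nat_mul, hu]; push_cast
    rw [mul_div_cancel₀ _ (by norm_num : (2 : ℝ) ≠ 0), Real.exp_log hn0]
  have he0 := Real.exp_pos (u / 2)
  have h1ε : 1 ≤ ε * Real.exp (u / 2) := by
    by_contra! hcon
    have : (ε * Real.exp (u / 2)) ^ 2 < 1 := by
      have h0 : 0 ≤ ε * Real.exp (u / 2) := by positivity
      nlinarith
    rw [mul_pow, hsq] at this
    linarith
  have hεe : Real.exp (u / 2) ≤ ε * n := by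
    rw [← hsq, sq, ← mul_assoc]; nlinarith
  have hlog2 := Real.log_two_gt_d9
  have hlog2' := Real.log_two_lt_d9
  have hTu : (T : ℝ) ≤ 1 + u := by
    have h1 : (2 : ℝ) ^ T ≤ 2 * Real.exp (u / 2) := by
      refine hT.trans ?_
      rw [div_le_iff₀ hε]; nlinarith
    have h2 := Real.log_le_log (by positivity) h1
    rw [Real.log_pow, Real.log_mul (by norm_num) he0.ne', Real.log_exp] at h2
    nlinarith
  have hlog : Real.log (8 * ((n : ℝ) + 1)) ≤ 3 + u := by
    have h1 : 8 * ((n : ℝ) + 1) ≤ 16 * n := by linarith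
    refine (Real.log_le_log (by positivity) h1).trans ?_
    rw [Real.log_mul (by norm_num) hn0.ne', show (16 : ℝ) = 2 ^ 4 by norm_num, Real.log_pow]
    push_cast; linarith
  have hexp : u ^ 5 / 3840 ≤ Real.exp (u / 2) := by
    have h := Real.pow_div_factorial_le_exp (x := u / 2) (by positivity) 5
    refine le_trans (le_of_eq ?_) h
    rw [show (Nat.factorial 5 : ℝ) = 120 by norm_num [Nat.factorial]]
    ring
  have hmain : (T : ℝ) * Real.log (8 * ((n : ℝ) + 1)) ≤ Real.log 2 * (ε * n) := by
    have h0 : 0 ≤ Real.log (8 * ((n : ℝ) + 1)) := Real.log_nonneg (by linarith)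
    calc (T : ℝ) * Real.log (8 * ((n : ℝ) + 1)) ≤ (1 + u) * (3 + u) := mul_le_mul hTu hlog h0 (by linarith)
      _ ≤ 2 * u ^ 2 := by nlinarith
      _ ≤ 0.5 * (u ^ 5 / 3840) := by
        have : (25 : ℝ) ^ 3 ≤ u ^ 3 := pow_le_pow_left₀ (by norm_num) hu25 3
        have h2 : u ^ 5 = u ^ 2 * u ^ 3 := by ring
        rw [h2]; nlinarith [sq_nonneg u]
      _ ≤ Real.log 2 * (ε * n) := by
        refine mul_le_mul (by linarith) (hexp.trans hεe) (by positivity) (by linarith)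
  rw [← Real.log_le_log_iff (by positivity) (by positivity), Real.log_pow, Real.log_rpow (by norm_num), mul_comm (ε * n)]
  exact hmain

lemma cast_prod_rpow {N : ℕ} (hN : N ≠ 0) (ε : ℝ) :
    ∏ p ∈ N.primeFactors, ((p : ℝ) ^ N.factorization p) ^ ε = (N : ℝ) ^ ε := by
  rw [Real.finsetProd_rpow _ _ (fun p _ => by positivity)]
  congr 1
  conv_rhs => rw [← Nat.prod_factorization_pow_eq_self hN]
  rw [Finsupp.prod, Nat.support_factorization]
  push_cast
  rfl

lemma card_divisors_pow_le {ε : ℝ} (hε : 0 < ε) (hε' : ε ≤ 1 / 10 ^ 6) {T N : ℕ} (hT : (2 : ℝ) ^ T ≤ 2 / ε) (hN : 1 < N)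
    (hn : ∀ p : ℕ, p.Prime → p ∣ N → 1 / ε ^ 2 < (N.factorization p : ℝ)) : ((8 * #N.divisors : ℕ) : ℝ) ^ T ≤ (N : ℝ) ^ ε := by
  have hN0 : N ≠ 0 := by lia
  have h1 : ((8 * #N.divisors : ℕ) : ℝ) ≤ ∏ p ∈ N.primeFactors, (8 * ((N.factorization p : ℝ) + 1)) := by
    rw [prod_mul_distrib, prod_const, Nat.card_divisors hN0]
    push_cast
    refine mul_le_mul_of_nonneg_right (le_self_pow₀ (by norm_num) ?_) (by positivity)
    exact (card_pos.2 (Nat.nonempty_primeFactors.2 hN)).ne'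
  calc ((8 * #N.divisors : ℕ) : ℝ) ^ T ≤ (∏ p ∈ N.primeFactors, (8 * ((N.factorization p : ℝ) + 1))) ^ T :=
        pow_le_pow_left₀ (by positivity) h1 T
    _ = ∏ p ∈ N.primeFactors, (8 * ((N.factorization p : ℝ) + 1)) ^ T := (prod_pow _ _ _).symm
    _ ≤ ∏ p ∈ N.primeFactors, ((p : ℝ) ^ N.factorization p) ^ ε := by
        refine prod_le_prod (fun p _ => by positivity) fun p hp => ?_
        have hpp := Nat.prime_of_mem_primeFactors hp
        refine (pow_le_two_rpow hε hε' hT (hn p hpp (Nat.dvd_of_mem_primeFactors hp))).trans ?_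
        rw [← Real.rpow_natCast, ← Real.rpow_mul (by positivity), mul_comm]
        exact Real.rpow_le_rpow (by norm_num) (by exact_mod_cast hpp.two_le) (by positivity)
    _ = _ := cast_prod_rpow hN0 ε

lemma prod_primeFactors_le_rpow {ε : ℝ} {N : ℕ} (hN : N ≠ 0)
    (hn : ∀ p : ℕ, p.Prime → p ∣ N → 1 ≤ ε * (N.factorization p : ℝ)) : ((∏ p ∈ N.primeFactors, p : ℕ) : ℝ) ≤ (N : ℝ) ^ ε := by
  rw [← cast_prod_rpow hN ε]
  push_cast
  refine prod_le_prod (fun p _ => by positivity) fun p hp => ?_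
  have hpp := Nat.prime_of_mem_primeFactors hp
  rw [← Real.rpow_natCast, ← Real.rpow_mul (by positivity), mul_comm]
  exact Real.self_le_rpow_of_one_le (by exact_mod_cast hpp.one_lt.le) (hn p hpp (Nat.dvd_of_mem_primeFactors hp))

lemma one_div_sq_le_log {ε : ℝ} {N : ℕ} (hN : 1 < N)
    (hn : ∀ p : ℕ, p.Prime → p ∣ N → 1 / ε ^ 2 < (N.factorization p : ℝ)) : 1 / ε ^ 2 * Real.log 2 ≤ Real.log N := by
  obtain ⟨p, hp, hpN⟩ := Nat.exists_prime_and_dvd hN.ne'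
  have hN0 : N ≠ 0 := by lia
  have h1 : p ^ N.factorization p ≤ N := Nat.le_of_dvd (by lia) (Nat.ordProj_dvd N p)
  have h2 : ((p ^ N.factorization p : ℕ) : ℝ) ≤ N := by exact_mod_cast h1
  have h3 := Real.log_le_log (by exact_mod_cast pow_pos hp.pos _) h2
  push_cast at h3
  rw [Real.log_pow] at h3
  refine le_trans ?_ h3
  exact mul_le_mul (hn p hp hpN).le (Real.log_le_log (by norm_num) (by exact_mod_cast hp.two_le))
    (Real.log_nonneg (by norm_num)) (by positivity)

lemma log_add_one_le_rpow {ε : ℝ} (hε : 0 < ε) (hε' : ε ≤ 1 / 10 ^ 6) {N q : ℕ} (hN : 1 < N)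
    (hL : 1 / ε ^ 2 * Real.log 2 ≤ Real.log N) (hq0 : 0 < q) (hq : (q : ℝ) ≤ (N : ℝ) ^ (3 / ε)) :
    ((Nat.log 2 q + 1 : ℕ) : ℝ) ≤ (N : ℝ) ^ ε := by
  have hN0 : (0 : ℝ) < N := by exact_mod_cast (by lia : 0 < N)
  set L := Real.log N with hLdef
  have hlog2 := Real.log_two_gt_d9
  set y := ε * L with hy
  have h1 : 1 / ε ≤ 2 * y := by
    rw [hy, div_le_iff₀ hε]
    rw [div_mul_eq_mul_div, div_le_iff₀ (by positivity), one_mul] at hL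
    nlinarith
  have hy6 : 1000 ≤ y := by
    have : (10 : ℝ) ^ 6 ≤ 1 / ε := by
      rw [le_div_iff₀ hε]; norm_num at hε' ⊢; linarith
    linarith [show (2000 : ℝ) ≤ 10 ^ 6 by norm_num]
  have hLy : L ≤ 2 * y ^ 2 := by
    have : L = (1 / ε) * y := by rw [hy]; field_simp
    rw [this]; nlinarith
  have hlogq : (Nat.log 2 q : ℝ) ≤ 24 * y ^ 3 := by
    have h2 : ((2 ^ Nat.log 2 q : ℕ) : ℝ) ≤ (N : ℝ) ^ (3 / ε) :=
      le_trans (by exact_mod_cast Nat.pow_log_le_self 2 hq0.ne') hq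
    have h3 := Real.log_le_log (by positivity) h2
    push_cast at h3
    rw [Real.log_pow, Real.log_rpow hN0, ← hLdef] at h3
    have h4 : 3 / ε * L ≤ 12 * y ^ 3 := by
      have e : 3 / ε * L = 3 * (1 / ε) * L := by ring
      rw [e]
      have hL0 : 0 ≤ L := Real.log_nonneg (by exact_mod_cast hN.le)
      calc 3 * (1 / ε) * L ≤ 3 * (2 * y) * (2 * y ^ 2) :=
            mul_le_mul (by linarith) hLy hL0 (by linarith)
        _ = _ := by ring
    nlinarith [Nat.cast_nonneg (α := ℝ) (Nat.log 2 q)]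
  have hexp : y ^ 4 / 24 ≤ Real.exp y := by
    have h := Real.pow_div_factorial_le_exp (x := y) (by linarith) 4
    rwa [show (Nat.factorial 4 : ℝ) = 24 by norm_num [Nat.factorial]] at h
  have e : (N : ℝ) ^ ε = Real.exp y := by rw [Real.rpow_def_of_pos hN0, hy, mul_comm]
  rw [e]
  push_cast
  refine le_trans ?_ hexp
  have hy3 : (1 : ℝ) ≤ y ^ 3 := one_le_pow₀ (by linarith)
  nlinarith

lemma log_prod_pow {S : Finset ℕ} (hS : ∀ p ∈ S, p.Prime) (e : ℕ → ℕ) :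
    Real.log ((∏ p ∈ S, p ^ e p : ℕ) : ℝ) = ∑ p ∈ S, (e p : ℝ) * Real.log p := by
  push_cast
  rw [Real.log_prod fun p hp => pow_ne_zero _ (by exact_mod_cast (hS p hp).ne_zero)]
  simp only [Real.log_pow]

lemma sum_factorization_mul_log {N : ℕ} (hN : N ≠ 0) :
    ∑ p ∈ N.primeFactors, (N.factorization p : ℝ) * Real.log p = Real.log N := by
  rw [← log_prod_pow fun p hp => Nat.prime_of_mem_primeFactors hp]
  congr 2
  exact Nat.prod_factorization_pow_eq_self hN

set_option maxHeartbeats 400000 in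
lemma exists_separated_pair : ∃ C : ℕ, 1 ≤ C ∧ ∀ (ε : ℝ) (q N : ℕ) [NeZero q] [NeZero N], 0 < ε → ε ≤ 1 / 10 ^ 6 →
    4 * (C : ℝ) * ε ≤ 1 → 1 < N → q.Coprime N → (∀ p : ℕ, p.Prime → p ∣ N → 1 / ε ^ 2 < (N.factorization p : ℝ)) →
    (q : ℝ) ≤ (N : ℝ) ^ (3 / ε) → ∀ A : Finset (SpecialLinearGroup (Fin 2) (ZMod q) × SpecialLinearGroup (Fin 2) (ZMod N)),
    (q : ℝ) ^ 3 ≤ #(A.image Prod.fst) * (N : ℝ) ^ (3 * ε) → (N : ℝ) ^ 3 ≤ #(A.image Prod.snd) * (N : ℝ) ^ ε →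
    ∃ k ≤ 3 * C, ∃ x ∈ A ^ k, ∃ x' ∈ A ^ k, x.1 = x'.1 ∧ ∃ J ⊆ N.primeFactors, ∃ m : ℕ → ℕ,
      Real.log N ≤ 20000 * ∑ p ∈ J, (N.factorization p : ℝ) * Real.log p ∧
      ∀ p ∈ J, x.2⁻¹ * x'.2 ∉ Cen ((p ^ m p : ℕ) : ZMod N) ∧ 0 < m p ∧ m p ≤ N.factorization p ∧
        ε * N.factorization p ≤ m p ∧ (m p : ℝ) ≤ 4 * C * ε * N.factorization p := by
  obtain ⟨K, hK⟩ := exists_far_pair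
  refine ⟨5 * K + 1, by lia, ?_⟩
  intro ε q N _ _ hε hε' hC hN hcop hn hq A h1 h2
  set C : ℕ := 5 * K + 1 with hCdef
  have hN0 : N ≠ 0 := by lia
  have hNR : (1 : ℝ) < N := by exact_mod_cast hN
  have hNpos : (0 : ℝ) < N := by linarith
  set L := Real.log N with hL
  have hLpos : 0 < L := Real.log_pos hNR
  have hC1 : (1 : ℝ) ≤ C := by exact_mod_cast (by lia : 1 ≤ C)
  set n : ℕ → ℕ := fun p => N.factorization p with hndef
  have hprime : ∀ p ∈ N.primeFactors, p.Prime := fun p hp => Nat.prime_of_mem_primeFactors hp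
  have hn1 : ∀ p : ℕ, p.Prime → p ∣ N → 1 ≤ ε * (n p : ℝ) := by
    intro p hp hpN
    have h := hn p hp hpN
    rw [div_lt_iff₀ (by positivity)] at h
    have : ε ^ 2 ≤ ε := by nlinarith
    nlinarith [Nat.cast_nonneg (α := ℝ) (n p)]
  set ℓ : ℕ → ℕ := fun p => ⌈(C : ℝ) * ε * n p⌉₊ with hℓdef
  have hℓ : ∀ p ∈ N.primeFactors, 0 < ℓ p ∧ 2 * ℓ p ≤ n p ∧ (C : ℝ) * ε * n p ≤ ℓ p ∧ ((2 * ℓ p : ℕ) : ℝ) ≤ 4 * C * ε * n p := by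
    intro p hp
    have h := hn1 p (hprime p hp) (Nat.dvd_of_mem_primeFactors hp)
    have hle : (C : ℝ) * ε * n p ≤ ℓ p := Nat.le_ceil _
    have h1' : 1 ≤ (C : ℝ) * ε * n p := by nlinarith
    have hlt : (ℓ p : ℝ) < C * ε * n p + 1 := Nat.ceil_lt_add_one (by linarith)
    have h4 : ((2 * ℓ p : ℕ) : ℝ) ≤ 4 * C * ε * n p := by push_cast; linarith
    refine ⟨Nat.ceil_pos.2 (by linarith), ?_, hle, h4⟩
    have : ((2 * ℓ p : ℕ) : ℝ) ≤ n p := h4.trans (by nlinarith [Nat.cast_nonneg (α := ℝ) (n p)])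
    exact_mod_cast this
  have hτ : ((8 * #N.divisors : ℕ) : ℝ) ≤ (N : ℝ) ^ ε := by
    have h := card_divisors_pow_le (T := 1) hε hε' (by
      rw [pow_one, le_div_iff₀ hε]; nlinarith) hN hn
    rwa [pow_one] at h
  have hNε : (8 : ℝ) ≤ (N : ℝ) ^ ε := by
    refine le_trans ?_ hτ
    have : 1 ≤ #N.divisors := card_pos.2 ⟨1, Nat.one_mem_divisors.2 hN0⟩
    exact_mod_cast (by lia : 8 ≤ 8 * #N.divisors)
  set E : ℕ := ⌈(N : ℝ) ^ (4 * ε)⌉₊ with hE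
  have hElow : (N : ℝ) ^ (4 * ε) ≤ E := Nat.le_ceil _
  have hmono : ∀ {a b : ℝ}, a ≤ b → (N : ℝ) ^ a ≤ (N : ℝ) ^ b := fun h => Real.rpow_le_rpow_of_exponent_le hNR.le h
  have hElow' : (N : ℝ) ^ ε ≤ E := (hmono (by linarith)).trans hElow
  have hEpos : (0 : ℝ) < E := by linarith
  have hEup : (E : ℝ) ≤ (N : ℝ) ^ (5 * ε) := by
    have h := (Nat.ceil_lt_add_one (Real.rpow_nonneg hNpos.le (4 * ε))).le
    have h4 : (1 : ℝ) ≤ (N : ℝ) ^ (4 * ε) := Real.one_le_rpow hNR.le (by linarith)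
    have e : (N : ℝ) ^ (5 * ε) = (N : ℝ) ^ (4 * ε) * (N : ℝ) ^ ε := by
      rw [← Real.rpow_add hNpos]; congr 1; ring
    rw [e]
    nlinarith
  have hE1 : 2 * #N.divisors ≤ E := by
    have : ((8 * #N.divisors : ℕ) : ℝ) ≤ E := hτ.trans hElow'
    have : 8 * #N.divisors ≤ E := by exact_mod_cast this
    lia
  have hE2 : ∏ p ∈ N.primeFactors, p ≤ E := by
    have := (prod_primeFactors_le_rpow hN0 hn1).trans hElow'
    exact_mod_cast this
  have hE3 : q ≤ q.totient * E := by
    refine (le_totient_mul_log q).trans (Nat.mul_le_mul_left _ ?_)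
    have := (log_add_one_le_rpow hε hε' hN (one_div_sq_le_log hN hn) (NeZero.pos q) hq).trans hElow'
    exact_mod_cast this
  have hE4 : q ^ 3 ≤ #(A.image Prod.fst) * E := by
    have : (q : ℝ) ^ 3 ≤ #(A.image Prod.fst) * (E : ℝ) :=
      h1.trans (mul_le_mul_of_nonneg_left ((hmono (by linarith)).trans hElow) (Nat.cast_nonneg _))
    exact_mod_cast this
  have hE5 : N ^ 3 ≤ #(A.image Prod.snd) * E := by
    have : (N : ℝ) ^ 3 ≤ #(A.image Prod.snd) * (E : ℝ) :=
      h2.trans (mul_le_mul_of_nonneg_left hElow' (Nat.cast_nonneg _))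
    exact_mod_cast this
  have hlogElow : 4 * ε * L ≤ Real.log E := by
    have := Real.log_le_log (by positivity) hElow
    rwa [Real.log_rpow hNpos] at this
  have hlogEup : Real.log E ≤ 5 * ε * L := by
    have := Real.log_le_log hEpos hEup
    rwa [Real.log_rpow hNpos] at this
  set w : ℕ → ℝ := fun p => (n p : ℝ) * Real.log p with hw
  have hw0 : ∀ p, 0 ≤ w p := fun p => mul_nonneg (Nat.cast_nonneg _) (Real.log_natCast_nonneg p)
  have hwsum : ∑ p ∈ N.primeFactors, w p = L := sum_factorization_mul_log hN0
  set D : ℕ → Subgroup (SpecialLinearGroup (Fin 2) (ZMod N)) := fun p => Cen ((p ^ (2 * ℓ p) : ℕ) : ZMod N) with hD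
  have hstep : ∀ J ⊆ N.primeFactors, ∑ p ∈ J, w p < L / 10000 → ∃ x ∈ A ^ 3, ∃ x' ∈ A ^ 3, x.1 = x'.1 ∧
      L / C ≤ ∑ p ∈ N.primeFactors \ J with x.2⁻¹ * x'.2 ∉ D p, w p := by
    intro J hJ hJL
    have hS : N.primeFactors \ J ⊆ N.primeFactors := sdiff_subset
    have hwS : L / 2 ≤ ∑ p ∈ N.primeFactors \ J, w p := by
      have := sum_sdiff (f := w) hJ
      linarith
    have hlow : E ^ K < ∏ p ∈ N.primeFactors \ J, p ^ (2 * ℓ p) := by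
      have hpos : (0 : ℝ) < ((∏ p ∈ N.primeFactors \ J, p ^ (2 * ℓ p) : ℕ) : ℝ) := by
        exact_mod_cast prod_pos fun p hp => pow_pos (hprime p (hS hp)).pos _
      have h : Real.log ((E ^ K : ℕ) : ℝ) < Real.log ((∏ p ∈ N.primeFactors \ J, p ^ (2 * ℓ p) : ℕ) : ℝ) := by
        rw [log_prod_pow fun p hp => hprime p (hS hp)]
        have hterm : ∑ p ∈ N.primeFactors \ J, 2 * C * ε * w p ≤ ∑ p ∈ N.primeFactors \ J, ((2 * ℓ p : ℕ) : ℝ) * Real.log p := by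
          refine sum_le_sum fun p hp => ?_
          have h3 := (hℓ p (hS hp)).2.2.1
          have : 2 * C * ε * w p = 2 * (C * ε * n p) * Real.log p := by simp only [hw]; ring
          rw [this]
          push_cast
          exact mul_le_mul_of_nonneg_right (by linarith) (Real.log_natCast_nonneg p)
        rw [← mul_sum] at hterm
        refine lt_of_lt_of_le ?_ hterm
        push_cast
        rw [Real.log_pow]
        have hCK : (C : ℝ) = 5 * K + 1 := by rw [hCdef]; push_cast; ring
        have hK0 : (0 : ℝ) ≤ K := Nat.cast_nonneg K
        have hεL : 0 < ε * L := by positivity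
        calc (K : ℝ) * Real.log E ≤ K * (5 * ε * L) := mul_le_mul_of_nonneg_left hlogEup hK0
          _ < C * (ε * L) := by rw [hCK]; linarith
          _ = 2 * C * ε * (L / 2) := by ring
          _ ≤ _ := mul_le_mul_of_nonneg_left hwS (by positivity)
      have := (Real.log_lt_log_iff (by
        have : (0 : ℕ) < E ^ K := pow_pos (by exact_mod_cast hEpos) _
        exact_mod_cast this) hpos).1 h
      exact_mod_cast this
    obtain ⟨x, hx, x', hx', h1', hfar⟩ := hK q N E ℓ _ hS (fun p hp => ⟨(hℓ p (hS hp)).1, (hℓ p (hS hp)).2.1⟩) hcop hE1 hE2 hE3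
      hlow A hE4 hE5
    refine ⟨x, hx, x', hx', h1', ?_⟩
    set S' := (N.primeFactors \ J).filter fun p => x.2⁻¹ * x'.2 ∉ Cen ((p ^ (2 * ℓ p) : ℕ) : ZMod N) with hS'
    have hS'P : S' ⊆ N.primeFactors := (filter_subset _ _).trans hS
    have h3 : Real.log E ≤ Real.log ((∏ p ∈ S', p ^ (2 * ℓ p) : ℕ) : ℝ) :=
      Real.log_le_log hEpos (by exact_mod_cast hfar.le)
    rw [log_prod_pow fun p hp => hprime p (hS'P hp)] at h3
    have h4 : ∑ p ∈ S', ((2 * ℓ p : ℕ) : ℝ) * Real.log p ≤ ∑ p ∈ S', 4 * C * ε * w p := by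
      refine sum_le_sum fun p hp => ?_
      have : 4 * C * ε * w p = (4 * C * ε * n p) * Real.log p := by simp only [hw]; ring
      rw [this]
      exact mul_le_mul_of_nonneg_right (hℓ p (hS'P hp)).2.2.2 (Real.log_natCast_nonneg p)
    rw [← mul_sum] at h4
    have h5 : 4 * ε * L ≤ 4 * ε * (C * ∑ p ∈ S', w p) := by
      calc _ ≤ _ := hlogElow.trans (h3.trans h4)
        _ = _ := by ring
    rw [div_le_iff₀ (by linarith), mul_comm]
    exact le_of_mul_le_mul_left h5 (by linarith)
  have hDn : ∀ p, (D p).Normal := fun p => inferInstance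
  have hsC : L / 10000 ≤ C * (L / C) := by
    rw [mul_div_cancel₀ _ (by linarith)]; linarith
  obtain ⟨k, hk, J, hJ, hsp, hJw⟩ := exists_spread hDn hstep hsC
  obtain ⟨x, hx, x', hx', h1', hsum⟩ := hsp.exists_pair (w := w) fun p _ => hw0 p
  refine ⟨k, by lia, x, hx, x', hx', h1', J.filter fun p => x.2⁻¹ * x'.2 ∉ D p, (filter_subset _ _).trans hJ,
    fun p => 2 * ℓ p, ?_, ?_⟩
  · have : L / 10000 ≤ 2 * ∑ p ∈ J with x.2⁻¹ * x'.2 ∉ D p, w p := hJw.trans hsum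
    linarith
  · intro p hp
    rw [mem_filter] at hp
    obtain ⟨ha, hb, hc, hd⟩ := hℓ p (hJ hp.1)
    refine ⟨hp.2, by lia, hb, ?_, hd⟩
    have h := hn1 p (hprime p (hJ hp.1)) (Nat.dvd_of_mem_primeFactors (hJ hp.1))
    push_cast
    nlinarith

lemma mem_Cen_of_red {n N r : ℕ} [NeZero n] [NeZero N] (h : n ∣ N) (hr : r ∣ n) {g : SpecialLinearGroup (Fin 2) (ZMod N)}
    (hg : red h g ∈ Cen (r : ZMod n)) : g ∈ Cen (r : ZMod N) := by
  have key : ∀ x : ZMod N, (r : ZMod n) ∣ ZMod.castHom h (ZMod n) x → (r : ZMod N) ∣ x := by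
    intro x hx
    rw [natCast_dvd_iff hr, ← RingHom.comp_apply] at hx
    rw [natCast_dvd_iff (hr.trans h), ← hx]
    congr 1
    exact Subsingleton.elim _ _
  obtain ⟨h1, h2, h3⟩ := hg
  rw [red_apply] at h1 h2
  rw [red_apply, red_apply, ← map_sub] at h3
  exact ⟨key _ h1, key _ h2, key _ h3⟩

lemma prod_coprime_div {N : ℕ} (hN : N ≠ 0) {J : Finset ℕ} (hJ : J ⊆ N.primeFactors) :
    ∃ m, (∏ p ∈ J, p ^ N.factorization p) * m = N ∧ (∏ p ∈ J, p ^ N.factorization p).Coprime m := by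
  refine ⟨∏ p ∈ N.primeFactors \ J, p ^ N.factorization p, ?_, ?_⟩
  · rw [mul_comm, prod_sdiff hJ]
    exact Nat.prod_factorization_pow_eq_self hN
  · refine Nat.Coprime.prod_left fun p hp => Nat.Coprime.prod_right fun r hr => ?_
    rw [mem_sdiff] at hr
    refine Nat.Coprime.pow _ _ ((Nat.coprime_primes (Nat.prime_of_mem_primeFactors (hJ hp))
      (Nat.prime_of_mem_primeFactors hr.1)).2 ?_)
    rintro rfl
    exact hr.2 hp

lemma log_card_image_red {n N : ℕ} [NeZero n] [NeZero N] (h : n ∣ N) {A : Finset (SpecialLinearGroup (Fin 2) (ZMod N))}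
    {δ : ℝ} (hA : (N : ℝ) ^ 3 ≤ #A * (N : ℝ) ^ δ) :
    3 * Real.log n ≤ Real.log #(A.image (red h)) + δ * Real.log N := by
  have hN : (0 : ℝ) < N := by exact_mod_cast NeZero.pos N
  have hn : (0 : ℝ) < n := by exact_mod_cast NeZero.pos n
  have hcard : #A ≤ (N / n) ^ 3 * #(A.image (red h)) :=
    card_le_mul_card_image A _ fun a _ => (card_le_card (filter_subset_filter _ (subset_univ A))).trans (card_red_fiber_le h a)
  have hnm : N / n * n = N := Nat.div_mul_cancel h
  set m := N / n with hm
  set b := #(A.image (red h)) with hb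
  have hmN : (m : ℝ) * n = N := by exact_mod_cast hnm
  have hm0 : (0 : ℝ) < m := by
    by_contra! hcon
    nlinarith
  have hle : (n : ℝ) ^ 3 ≤ b * (N : ℝ) ^ δ := by
    have h1 : (#A : ℝ) ≤ (m : ℝ) ^ 3 * b := by exact_mod_cast hcard
    have h2 : (m : ℝ) ^ 3 * (n : ℝ) ^ 3 ≤ (m : ℝ) ^ 3 * (b * (N : ℝ) ^ δ) := by
      calc (m : ℝ) ^ 3 * (n : ℝ) ^ 3 = (N : ℝ) ^ 3 := by rw [← hmN]; ring
        _ ≤ #A * (N : ℝ) ^ δ := hA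
        _ ≤ (m : ℝ) ^ 3 * b * (N : ℝ) ^ δ := mul_le_mul_of_nonneg_right h1 (Real.rpow_nonneg hN.le _)
        _ = _ := by ring
    exact le_of_mul_le_mul_left h2 (by positivity)
  have hb0 : (0 : ℝ) < b := by
    by_contra! hcon
    have : (b : ℝ) = 0 := le_antisymm hcon (Nat.cast_nonneg _)
    rw [this, zero_mul] at hle
    have : 0 < (n : ℝ) ^ 3 := by positivity
    linarith
  have h3 := Real.log_le_log (by positivity) hle
  rw [Real.log_pow, Real.log_mul hb0.ne' (Real.rpow_pos_of_pos hN _).ne', Real.log_rpow hN] at h3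
  exact_mod_cast h3

lemma log_ge_of_pow_le {F G a t : ℕ} {ε x y : ℝ} (hF : 0 < F) (hG : 0 < G) (ha : 0 < a)
    (h : F ^ (t - 1) ≤ G ^ (t - 1) * a ^ t) (ht : 1 / ε < (t : ℝ)) (hε : 0 < ε)
    (hx : 0 ≤ x) (hy : 0 ≤ y) (hFG : x - y ≤ Real.log F - Real.log G) : (1 - ε) * x - y ≤ Real.log a := by
  have ht0 : (0 : ℝ) < t := lt_trans (by positivity) ht
  have ht1 : 1 ≤ t := by exact_mod_cast (by exact_mod_cast ht0 : 0 < t)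
  have ha' : (0 : ℝ) < a := by exact_mod_cast ha
  have hF' : (0 : ℝ) < F := by exact_mod_cast hF
  have hG' : (0 : ℝ) < G := by exact_mod_cast hG
  have h1 : ((F ^ (t - 1) : ℕ) : ℝ) ≤ ((G ^ (t - 1) * a ^ t : ℕ) : ℝ) := by exact_mod_cast h
  have h2 := Real.log_le_log (by exact_mod_cast pow_pos hF _) h1
  push_cast at h2
  rw [Real.log_mul (by positivity) (by positivity), Real.log_pow, Real.log_pow, Real.log_pow, Nat.cast_sub ht1, Nat.cast_one] at h2
  have h3 : ((t : ℝ) - 1) * (x - y) ≤ t * Real.log a := by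
    have ht1' : (1 : ℝ) ≤ t := by exact_mod_cast ht1
    nlinarith
  have h4 : 1 < t * ε := by rwa [div_lt_iff₀ hε] at ht
  refine le_of_mul_le_mul_left ?_ ht0
  refine le_trans ?_ h3
  nlinarith [mul_nonneg hx (by linarith : (0 : ℝ) ≤ t * ε - 1)]

lemma log_mul_pow_mul_pow {a b n : ℝ} (ha : 0 < a) (hb : 0 < b) (hn : 0 < n) (T : ℕ) :
    Real.log (a * b ^ (2 * T) * n ^ 3) = Real.log a + 2 * T * Real.log b + 3 * Real.log n := by
  rw [Real.log_mul (by positivity) (by positivity), Real.log_mul (by positivity) (by positivity), Real.log_pow, Real.log_pow]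
  push_cast
  ring

lemma log_pow_mul_mul_pow {D u n : ℝ} (hD : 0 < D) (hu : 0 < u) (hn : 0 < n) (T : ℕ) :
    Real.log (D ^ 6 * (u * n ^ 6) ^ T) = 6 * Real.log D + Real.log (u ^ T) + 6 * T * Real.log n := by
  rw [mul_pow, Real.log_mul (by positivity) (by positivity), Real.log_mul (by positivity) (by positivity), ← pow_mul,
    Real.log_pow, Real.log_pow n]
  push_cast
  ring

set_option maxHeartbeats 400000 in
lemma exists_large_pow : ∃ C : ℕ, 1 ≤ C ∧ ∀ (ε : ℝ) (q N T : ℕ) [NeZero q] [NeZero N], 0 < ε → ε ≤ 1 / 10 ^ 6 →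
    4 * (C : ℝ) * ε ≤ 1 → 1 < N → q.Coprime N → (∀ p : ℕ, p.Prime → p ∣ N → 1 / ε ^ 2 < (N.factorization p : ℝ)) →
    (q : ℝ) ≤ (N : ℝ) ^ (3 / ε) → (2 : ℝ) ^ T ≤ 2 / ε → 1 / ε < (2 : ℝ) ^ T →
    ∀ A : Finset (SpecialLinearGroup (Fin 2) (ZMod q) × SpecialLinearGroup (Fin 2) (ZMod N)),
    (q : ℝ) ^ 3 ≤ #(A.image Prod.fst) * (N : ℝ) ^ (3 * ε) → (N : ℝ) ^ 3 ≤ #(A.image Prod.snd) * (N : ℝ) ^ (ε ^ 2) →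
    ∃ (n : ℕ) (h : n ∣ N), n.Coprime (N / n) ∧ Real.log N ≤ 20000 * Real.log n ∧ ∃ k₀ ≤ 3 * C,
      (3 - (3 + 20000 * (24 * C + 8)) * ε) * Real.log (q * n : ℕ) ≤
        Real.log #((A ^ (T * (2 * T * (k₀ + 1) + 1))).image fun x => (x.1, red h x.2)) := by
  obtain ⟨C, hC1, hC⟩ := exists_separated_pair
  refine ⟨C, hC1, ?_⟩
  intro ε q N T _ _ hε hε' hCε hN hcop hn hq hT hT' A h1 h2
  have hN0 : N ≠ 0 := by lia
  have hNR : (1 : ℝ) < N := by exact_mod_cast hN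
  have hNpos : (0 : ℝ) < N := by linarith
  have hLpos : 0 < Real.log N := Real.log_pos hNR
  have hεε : ε ^ 2 ≤ ε := by nlinarith
  obtain ⟨k₀, hk₀, x, hx, x', hx', h1', J, hJ, m, hJL, hm⟩ := hC ε q N hε hε' hCε hN hcop hn hq A h1
    (h2.trans (mul_le_mul_of_nonneg_left (Real.rpow_le_rpow_of_exponent_le hNR.le hεε) (Nat.cast_nonneg _)))
  have hJp : ∀ p ∈ J, p.Prime := fun p hp => Nat.prime_of_mem_primeFactors (hJ hp)
  obtain ⟨n', hnn, hncop⟩ := prod_coprime_div hN0 hJ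
  have hfac := factorization_prod_pow hJp (fun p => N.factorization p)
  have hlogn := log_prod_pow hJp (fun p => N.factorization p)
  set n := ∏ p ∈ J, p ^ N.factorization p with hndef
  have hnN : n ∣ N := ⟨n', hnn.symm⟩
  have hn0 : n ≠ 0 := fun h0 => hN0 (by rw [← hnn, h0, zero_mul])
  have : NeZero n := ⟨hn0⟩
  have hnJ : ∀ p ∈ n.primeFactors, p ∈ J := by
    intro p hp
    by_contra hpJ
    have h := hfac p
    rw [if_neg hpJ] at h
    have := (Nat.prime_of_mem_primeFactors hp).factorization_pos_of_dvd hn0 (Nat.dvd_of_mem_primeFactors hp)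
    lia
  have hdiv : N / n = n' := by rw [← hnn, Nat.mul_div_cancel_left _ (Nat.pos_of_ne_zero hn0)]
  refine ⟨n, hnN, hdiv ▸ hncop, by rw [hlogn]; exact hJL, k₀, hk₀, ?_⟩
  let f : SpecialLinearGroup (Fin 2) (ZMod q) × SpecialLinearGroup (Fin 2) (ZMod N) →*
      SpecialLinearGroup (Fin 2) (ZMod q) × SpecialLinearGroup (Fin 2) (ZMod n) := (MonoidHom.id _).prodMap (red hnN)
  set B := A.image f with hB
  set k := T * (2 * T * (k₀ + 1) + 1) with hk
  have hBk : (A ^ k).image (fun x => (x.1, red hnN x.2)) = B ^ k := (Finset.image_pow f A k)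
  have hBk₀ : (A ^ k₀).image f = B ^ k₀ := Finset.image_pow f A k₀
  rw [hBk]
  have hq0 : (0 : ℝ) < q := by exact_mod_cast NeZero.pos q
  have hA1 : (0 : ℝ) < #(A.image Prod.fst) := by
    by_contra! hcon
    have h0 : (0 : ℝ) < (q : ℝ) ^ 3 := by positivity
    have := Real.rpow_nonneg hNpos.le (3 * ε)
    nlinarith
  have hAne : A.Nonempty := by
    have h0 : 0 < #(A.image Prod.fst) := by exact_mod_cast hA1
    exact image_nonempty.1 (card_pos.1 h0)
  have hBne : B.Nonempty := hAne.image _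
  have hB1 : B.image Prod.fst = A.image Prod.fst := by rw [hB, image_image]; rfl
  have hB2 : B.image Prod.snd = (A.image Prod.snd).image (red hnN) := by rw [hB, image_image, image_image]; rfl
  have hmain := card_pow_ge hBne (hBk₀ ▸ mem_image_of_mem f hx) (hBk₀ ▸ mem_image_of_mem f hx') h1' m T ?_ ?_
  rotate_left
  · intro p hp
    obtain ⟨-, ha, hb, hc, -⟩ := hm p (hnJ p hp)
    have hfp : n.factorization p = N.factorization p := by rw [hfac p, if_pos (hnJ p hp)]
    refine ⟨ha, hfp ▸ hb, ?_⟩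
    rw [hfp]
    have : (N.factorization p : ℝ) ≤ m p * 2 ^ T := by
      have h3 : 1 ≤ ε * 2 ^ T := by
        rw [div_lt_iff₀ hε] at hT'; linarith
      calc (N.factorization p : ℝ) ≤ (ε * 2 ^ T) * N.factorization p := le_mul_of_one_le_left (Nat.cast_nonneg _) h3
        _ = ε * N.factorization p * 2 ^ T := by ring
        _ ≤ _ := mul_le_mul_of_nonneg_right hc (by positivity)
    exact_mod_cast this
  · intro p hp hmem
    obtain ⟨ha, -, hb, -, -⟩ := hm p (hnJ p hp)
    have hfp : n.factorization p = N.factorization p := by rw [hfac p, if_pos (hnJ p hp)]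
    refine ha (mem_Cen_of_red hnN (((hJp p (hnJ p hp)).pow_dvd_iff_le_factorization hn0).2 (hfp ▸ hb)) ?_)
    rw [map_mul (red hnN), map_inv (red hnN)]
    exact hmem
  rw [← hk] at hmain
  have hB2' := log_card_image_red hnN h2
  rw [← hB2] at hB2'
  rw [hB1] at hmain
  set b₁ := #(A.image Prod.fst) with hb₁
  set b₂ := #(B.image Prod.snd) with hb₂
  set D := ∏ p ∈ n.primeFactors, p ^ m p with hD
  have hb₁0 : 0 < b₁ := by exact_mod_cast hA1
  have hb₂0 : 0 < b₂ := card_pos.2 (hBne.image _)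
  have hD0 : 0 < D := prod_pos fun p hp => pow_pos (Nat.prime_of_mem_primeFactors hp).pos _
  have hτ0 : 0 < #n.divisors := card_pos.2 ⟨1, Nat.one_mem_divisors.2 hn0⟩
  have hnpos : 0 < n := Nat.pos_of_ne_zero hn0
  have hb₁log : 3 * Real.log q ≤ Real.log b₁ + 3 * ε * Real.log N := by
    have h3 := Real.log_le_log (by positivity) h1
    rw [Real.log_pow, Real.log_mul hA1.ne' (Real.rpow_pos_of_pos hNpos _).ne', Real.log_rpow hNpos] at h3
    exact_mod_cast h3
  have hDlog : Real.log D ≤ 4 * C * ε * Real.log N := by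
    rw [hD, log_prod_pow fun p hp => Nat.prime_of_mem_primeFactors hp, ← sum_factorization_mul_log hN0, mul_sum]
    refine (sum_le_sum fun p hp => ?_).trans (sum_le_sum_of_subset_of_nonneg ((fun p hp => hJ (hnJ p hp) :
      n.primeFactors ⊆ N.primeFactors)) fun p _ _ => ?_)
    · rw [← mul_assoc]
      exact mul_le_mul_of_nonneg_right (hm p (hnJ p hp)).2.2.2.2 (Real.log_natCast_nonneg p)
    · have := Real.log_natCast_nonneg p
      positivity
  have hτlog : Real.log (((8 * #n.divisors) ^ T : ℕ) : ℝ) ≤ ε * Real.log N := by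
    rw [← Real.log_rpow hNpos]
    refine Real.log_le_log (by exact_mod_cast pow_pos (by lia) T) (le_trans ?_ (card_divisors_pow_le hε hε' hT hN hn))
    have : 8 * #n.divisors ≤ 8 * #N.divisors := Nat.mul_le_mul_left _ (card_le_card (Nat.divisors_subset_of_dvd hN0 hnN))
    exact_mod_cast Nat.pow_le_pow_left this T
  have hlogq : 0 ≤ Real.log q := Real.log_natCast_nonneg q
  have hlogn0 : 0 ≤ Real.log n := Real.log_natCast_nonneg n
  have hqn : Real.log (q * n : ℕ) = Real.log q + Real.log n := by
    push_cast
    exact Real.log_mul hq0.ne' (by exact_mod_cast hn0)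
  have hTε : T * ε ≤ 2 := by
    have h3 : (T : ℝ) ≤ 2 ^ T := by exact_mod_cast Nat.lt_two_pow_self.le
    rw [le_div_iff₀ hε] at hT
    nlinarith
  have hfin := log_ge_of_pow_le (ε := ε) (x := 3 * Real.log (q * n : ℕ)) (y := (24 * C + 8) * ε * Real.log N)
    (by positivity) (by positivity) (card_pos.2 hBne.pow) hmain (by exact_mod_cast hT') hε
    (by rw [hqn]; positivity) (by positivity) ?_
  · refine le_trans ?_ hfin
    have hLn : Real.log N ≤ 20000 * Real.log (q * n : ℕ) := by
      rw [hqn, hlogn]; linarith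
    have := mul_le_mul_of_nonneg_left hLn (by positivity : (0 : ℝ) ≤ (24 * C + 8) * ε)
    linarith
  · have e1 := log_mul_pow_mul_pow hA1 (by exact_mod_cast hb₂0 : (0 : ℝ) < b₂) (by exact_mod_cast hnpos : (0 : ℝ) < n) T
    have e2 := log_pow_mul_mul_pow (by exact_mod_cast hD0 : (0 : ℝ) < D) (by positivity : (0 : ℝ) < 8 * #n.divisors)
      (by exact_mod_cast hnpos : (0 : ℝ) < n) T
    push_cast at hτlog ⊢
    push_cast at hqn
    rw [e1, e2, hqn]
    have hT0 : (0 : ℝ) ≤ 2 * T := by positivity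
    have h5 := mul_le_mul_of_nonneg_left hB2' hT0
    have h6 : 2 * T * (ε ^ 2 * Real.log N) ≤ 4 * (ε * Real.log N) := by
      have : 0 ≤ ε * Real.log N := by positivity
      nlinarith
    linarith

lemma card_image_red_mono {a b n : ℕ} (hab : a ∣ b) (hb : b ∣ n) (ha : a ∣ n) (A : Finset (SpecialLinearGroup (Fin 2) (ZMod n))) :
    #(A.image (red ha)) ≤ #(A.image (red hb)) := by
  have : A.image (red ha) = (A.image (red hb)).image (red hab) := by
    rw [image_image]
    exact image_congr fun x _ => (red_red hab hb ha x).symm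
  rw [this]
  exact card_image_le

lemma card_image_prod_le {a b c n : ℕ} (hab : a ∣ c) (hbc : b ∣ c) (hc : c ∣ n) (ha : a ∣ n) (hb : b ∣ n)
    (A : Finset (SpecialLinearGroup (Fin 2) (ZMod n))) :
    #(A.image fun g => (red ha g, red hb g)) ≤ #(A.image (red hc)) := by
  have : (A.image fun g => (red ha g, red hb g)) = (A.image (red hc)).image fun g => (red hab g, red hbc g) := by
    rw [image_image]
    refine image_congr fun x _ => ?_
    simp only [Function.comp_apply, red_red hab hc ha x, red_red hbc hc hb x]
  rw [this]
  exact card_image_le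

lemma cube_le_mul_rpow {N c : ℕ} [NeZero N] {δ : ℝ} (h : (N : ℝ) ^ ((3 : ℝ) - δ) ≤ c) : (N : ℝ) ^ 3 ≤ c * (N : ℝ) ^ δ := by
  have hN : (0 : ℝ) < N := by exact_mod_cast NeZero.pos N
  calc (N : ℝ) ^ 3 = (N : ℝ) ^ ((3 : ℝ) - δ) * (N : ℝ) ^ δ := by
        rw [← Real.rpow_add hN, sub_add_cancel]; exact_mod_cast rfl
    _ ≤ _ := mul_le_mul_of_nonneg_right h (Real.rpow_nonneg hN.le _)

lemma exists_two_pow_near {ε : ℝ} (hε : 0 < ε) (hε' : ε ≤ 1 / 10 ^ 6) :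
    ∃ T : ℕ, 0 < T ∧ (2 : ℝ) ^ T ≤ 2 / ε ∧ 1 / ε < (2 : ℝ) ^ T ∧ (T : ℝ) ≤ 2 * Real.log (1 / ε ^ 2) := by
  have h6 : (10 : ℝ) ^ 6 ≤ 1 / ε := by
    rw [le_div_iff₀ hε]
    calc (10 : ℝ) ^ 6 * ε ≤ 10 ^ 6 * (1 / 10 ^ 6) := mul_le_mul_of_nonneg_left hε' (by positivity)
      _ = 1 := by norm_num
  obtain ⟨n, hn, hn'⟩ := exists_nat_pow_near (x := 1 / ε) (y := (2 : ℝ)) (le_trans (by norm_num) h6) (by norm_num)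
  have e : Real.log (1 / ε ^ 2) = 2 * Real.log (1 / ε) := by
    rw [← _root_.one_div_pow, Real.log_pow]; norm_num
  have h1 := Real.log_le_log (by positivity) hn
  rw [Real.log_pow] at h1
  have h2 := Real.log_two_gt_d9
  have h3 : 25 ≤ Real.log (1 / ε ^ 2) := twenty_five_le_log (by
    rw [← _root_.one_div_pow]
    calc (10 : ℝ) ^ 12 = (10 ^ 6) ^ 2 := by norm_num
      _ ≤ _ := pow_le_pow_left₀ (by norm_num) h6 2)
  refine ⟨n + 1, n.succ_pos, ?_, hn', ?_⟩
  · rw [pow_succ, show 2 / ε = 1 / ε * 2 by ring]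
    exact mul_le_mul_of_nonneg_right hn (by norm_num)
  · push_cast
    rw [e] at h3 ⊢
    nlinarith [Nat.cast_nonneg (α := ℝ) n]

end Gluing

open Gluing

theorem gluing :
    ∃ C₁ C₂ : ℝ, 0 < C₁ ∧ 0 < C₂ ∧
      ∀ θ : ℝ, 0 < θ → θ < 1 / 10 ^ 12 →
        ∀ (q q₁ q₂ : ℕ), 0 < q →
          ∀ (h₁ : q₁ ∣ q) (h₂ : q₂ ∣ q),
            Nat.Coprime q₁ q₂ →
            Nat.Coprime q₁ (q / q₁) →
            Nat.Coprime q₂ (q / q₂) →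
            (∀ p : ℕ, p.Prime → p ∣ q₂ → 1 / θ < (q₂.factorization p : ℝ)) →
            ∀ A : Finset (Matrix.SpecialLinearGroup (Fin 2) (ZMod q)),
              (q₁ : ℝ) ^ ((3 : ℝ) - θ) <
                ((A.image (Matrix.SpecialLinearGroup.map
                  (ZMod.castHom h₁ (ZMod q₁)))).card : ℝ) →
              (q₂ : ℝ) ^ ((3 : ℝ) - θ) <
                ((A.image (Matrix.SpecialLinearGroup.map
                  (ZMod.castHom h₂ (ZMod q₂)))).card : ℝ) →
              ∃ (q₃ : ℕ) (h₃ : q₃ ∣ q₂), Nat.Coprime q₃ (q₂ / q₃) ∧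
                (q₂ : ℝ) ^ ((1 : ℝ) / 40000) < (q₃ : ℝ) ∧
                ∃ (k : ℕ) (h₁₃ : q₁ * q₃ ∣ q), 0 < k ∧
                  (k : ℝ) ≤ C₁ * (Real.log (1 / θ)) ^ 2 ∧
                  ((q₁ * q₃ : ℕ) : ℝ) ^ ((3 : ℝ) - C₂ * Real.sqrt θ) <
                    (((A ^ k).image (Matrix.SpecialLinearGroup.map
                      (ZMod.castHom h₁₃ (ZMod (q₁ * q₃))))).card : ℝ) := by
  obtain ⟨C, hC1, hC⟩ := exists_large_pow
  have hC1' : (1 : ℝ) ≤ C := by exact_mod_cast hC1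
  refine ⟨24 * C + 12, 4 + 20000 * (24 * C + 8), by positivity, by positivity, ?_⟩
  intro θ hθ hθ' q q₁ q₂ hq h₁ h₂ hcop _ _ hn A hA₁ hA₂
  have : NeZero q := ⟨hq.ne'⟩
  have : NeZero q₁ := ⟨fun h0 => hq.ne' (Nat.eq_zero_of_zero_dvd (h0 ▸ h₁))⟩
  have : NeZero q₂ := ⟨fun h0 => hq.ne' (Nat.eq_zero_of_zero_dvd (h0 ▸ h₂))⟩
  have hq₁1 : 1 ≤ q₁ := NeZero.pos q₁
  set C₂ : ℝ := 4 + 20000 * (24 * C + 8) with hC₂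
  obtain ⟨ε, hε, hεθ⟩ : ∃ ε : ℝ, 0 < ε ∧ ε ^ 2 = θ := ⟨Real.sqrt θ, Real.sqrt_pos.2 hθ, Real.sq_sqrt hθ.le⟩
  have hsqrt : Real.sqrt θ = ε := by rw [← hεθ, Real.sqrt_sq hε.le]
  have hε' : ε ≤ 1 / 10 ^ 6 := by
    refine le_of_sq_le_sq ?_ (by positivity)
    rw [hεθ]
    exact hθ'.le.trans_eq (by norm_num)
  have hΛ : 25 ≤ Real.log (1 / θ) := twenty_five_le_log (by
    rw [le_div_iff₀ hθ]
    calc (10 : ℝ) ^ 12 * θ ≤ 10 ^ 12 * (1 / 10 ^ 12) := mul_le_mul_of_nonneg_left hθ'.le (by positivity)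
      _ = 1 := by norm_num)
  rw [hsqrt]
  have hθε : θ ≤ ε := by rw [← hεθ]; nlinarith
  have h12 : q₁ * q₂ ∣ q := hcop.mul_dvd_of_dvd_of_dvd h₁ h₂
  have hq₂ : 1 < q₂ := by
    by_contra! hcon
    have h1 : q₂ = 1 := le_antisymm hcon (NeZero.pos q₂)
    subst h1
    rw [Nat.cast_one, Real.one_rpow] at hA₂
    have h2 := (Finset.card_le_univ (A.image (red h₂))).trans (card_SL_le 1)
    have h3 : ((A.image (red h₂)).card : ℝ) ≤ 1 := by exact_mod_cast h2
    linarith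
  have hq₁R : (1 : ℝ) ≤ q₁ := by exact_mod_cast hq₁1
  have hq₂R : (1 : ℝ) < q₂ := by exact_mod_cast hq₂
  have hl₁ : 0 ≤ Real.log q₁ := Real.log_nonneg hq₁R
  have hl₂ : 0 < Real.log q₂ := Real.log_pos hq₂R
  have htriv : ((q₁ * q₂ : ℕ) : ℝ) ^ ((3 : ℝ) - C₂ * ε) < ((A.image (red h12)).card : ℝ) →
      ∃ (q₃ : ℕ) (_ : q₃ ∣ q₂), Nat.Coprime q₃ (q₂ / q₃) ∧ (q₂ : ℝ) ^ ((1 : ℝ) / 40000) < (q₃ : ℝ) ∧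
        ∃ (k : ℕ) (h₁₃ : q₁ * q₃ ∣ q), 0 < k ∧ (k : ℝ) ≤ (24 * C + 12) * (Real.log (1 / θ)) ^ 2 ∧
          ((q₁ * q₃ : ℕ) : ℝ) ^ ((3 : ℝ) - C₂ * ε) < (((A ^ k).image (red h₁₃)).card : ℝ) := by
    intro h
    refine ⟨q₂, dvd_rfl, ?_, ?_, 1, h12, one_pos, ?_, by rwa [pow_one]⟩
    · rw [Nat.div_self (NeZero.pos q₂)]; exact Nat.coprime_one_right _
    · exact Real.rpow_lt_self_of_one_lt hq₂R (by norm_num)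
    · push_cast
      nlinarith
  by_cases hbig : 3 ≤ C₂ * ε
  · refine htriv ?_
    calc ((q₁ * q₂ : ℕ) : ℝ) ^ ((3 : ℝ) - C₂ * ε) ≤ 1 :=
          Real.rpow_le_one_of_one_le_of_nonpos (by push_cast; nlinarith) (by linarith)
      _ ≤ (q₂ : ℝ) ^ ((3 : ℝ) - θ) := Real.one_le_rpow hq₂R.le (by linarith)
      _ < _ := hA₂
      _ ≤ _ := by exact_mod_cast card_image_red_mono (Dvd.intro_left _ rfl) h12 h₂ A
  push Not at hbig
  by_cases hlarge : (q₁ : ℝ) ≤ (q₂ : ℝ) ^ (3 / ε)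
  swap
  · push Not at hlarge
    refine htriv ?_
    refine lt_of_le_of_lt ?_ (lt_of_lt_of_le hA₁
      (by exact_mod_cast card_image_red_mono (Dvd.intro _ rfl) h12 h₁ A))
    have h3 := Real.log_le_log (by positivity) hlarge.le
    rw [Real.log_rpow (by linarith), div_mul_eq_mul_div, div_le_iff₀ hε] at h3
    rw [← Real.log_le_log_iff (by positivity) (by positivity), Real.log_rpow (by positivity), Real.log_rpow (by positivity)]
    push_cast
    rw [Real.log_mul (by positivity) (by positivity)]
    have h4 : (3 - C₂ * ε) * Real.log q₂ ≤ Real.log q₁ * ε := by nlinarith [mul_pos (by positivity : 0 < C₂ * ε) hl₂]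
    have h5 : (θ + ε) * Real.log q₁ ≤ C₂ * ε * Real.log q₁ :=
      mul_le_mul_of_nonneg_right (by rw [hC₂]; nlinarith) hl₁
    linarith
  obtain ⟨T, hT0, hT, hT', hTlog⟩ := exists_two_pow_near hε hε'
  rw [hεθ] at hTlog
  let f := (red h₁).prod (red h₂)
  have hCε : 4 * (C : ℝ) * ε ≤ 1 := by
    rw [hC₂] at hbig
    nlinarith
  obtain ⟨n, hnd, hncop, hnlog, k₀, hk₀, hmain⟩ := hC ε q₁ q₂ T hε hε' hCε hq₂ hcop (by rwa [hεθ]) hlarge hT hT' (A.image f)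
    (by
      rw [Finset.image_image]
      refine (cube_le_mul_rpow hA₁.le).trans (mul_le_mul_of_nonneg_left ?_ (Nat.cast_nonneg _))
      refine (Real.rpow_le_rpow (by positivity) hlarge hθ.le).trans_eq ?_
      rw [← Real.rpow_mul (by positivity), ← hεθ]
      congr 1
      field_simp)
    (by
      rw [Finset.image_image, hεθ]
      exact cube_le_mul_rpow hA₂.le)
  set k := T * (2 * T * (k₀ + 1) + 1) with hk
  have h13 : q₁ * n ∣ q := (mul_dvd_mul_left q₁ hnd).trans h12
  have hn1 : 0 < Real.log n := by linarith
  have hn0 : (0 : ℝ) < n := by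
    refine lt_of_le_of_ne (Nat.cast_nonneg n) fun h0 => ?_
    rw [← h0, Real.log_zero] at hn1
    exact lt_irrefl _ hn1
  refine ⟨n, hnd, hncop, ?_, k, h13, by positivity, ?_, ?_⟩
  · rw [← Real.log_lt_log_iff (by positivity) hn0, Real.log_rpow (by linarith)]
    linarith
  · have hT1 : (1 : ℝ) ≤ T := by exact_mod_cast hT0
    have hk₀' : (k₀ : ℝ) ≤ 3 * C := by exact_mod_cast hk₀
    calc (k : ℝ) = T * (2 * T * (k₀ + 1) + 1) := by rw [hk]; push_cast; ring
      _ ≤ T * (2 * T * (3 * C + 1) + T) := by gcongr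
      _ = T ^ 2 * (6 * C + 3) := by ring
      _ ≤ (2 * Real.log (1 / θ)) ^ 2 * (6 * C + 3) := by gcongr
      _ = _ := by ring
  · have himg : ((A.image f) ^ k).image (fun x => (x.1, red hnd x.2)) =
        (A ^ k).image fun g => (red h₁ g, red (hnd.trans h₂) g) := by
      rw [← Finset.image_pow f A k, Finset.image_image]
      refine Finset.image_congr fun x _ => ?_
      simp only [f, Function.comp_apply, MonoidHom.prod_apply, red_red hnd h₂ (hnd.trans h₂) x]
    rw [himg] at hmain
    have hcard := card_image_prod_le (Dvd.intro n rfl) (Dvd.intro_left q₁ rfl) h13 h₁ (hnd.trans h₂) (A ^ k)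
    have hAne : A.Nonempty := by
      by_contra! hcon
      rw [hcon, Finset.image_empty, Finset.card_empty, Nat.cast_zero] at hA₁
      exact absurd hA₁ (not_lt.2 (by positivity))
    have hpos : 0 < ((A ^ k).image fun g => (red h₁ g, red (hnd.trans h₂) g)).card :=
      Finset.card_pos.2 (hAne.pow.image _)
    refine lt_of_lt_of_le ?_ (by exact_mod_cast hcard : ((_ : ℕ) : ℝ) ≤ _)
    have hq₁n : (0 : ℝ) < (q₁ * n : ℕ) := by push_cast; positivity
    rw [← Real.log_lt_log_iff (Real.rpow_pos_of_pos hq₁n _) (by exact_mod_cast hpos), Real.log_rpow hq₁n]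
    refine lt_of_lt_of_le ?_ hmain
    have hlog : 0 < Real.log ((q₁ * n : ℕ) : ℝ) := by
      push_cast
      rw [Real.log_mul (by positivity) hn0.ne']
      linarith
    refine mul_lt_mul_of_pos_right ?_ hlog
    rw [hC₂]
    linarith
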